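/- Any two finite groups G and H, each of order 2^5 · 3 · 7 · 11^2 · 13 · 43^3 · 139 and each having prime graph degrees deg(2) = 4, deg(3) = 3, deg(7) = 3, deg(11) = 4, deg(13) = 1, deg(43) = 2, deg(139) = 1, are isomorphic. -/

import Mathlib

open scoped MonoidAlgebra

namespace WedderburnChar

section Trace

variable {k : Type*} [Field k]

theorem trace_mul_mul_pi {ι : Type*} [Fintype ι] [DecidableEq ι] (d : ι → ℕ)
    (A B : ∀ i, Matrix (Fin (d i)) (Fin (d i)) k) :
    LinearMap.trace k _ (LinearMap.mulLeftRight k (A, B)) = ∑ i, (A i).trace * (B i).trace := by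
  classical
  rw [LinearMap.trace_eq_matrix_trace k
    (Pi.basis fun i => Matrix.stdBasis k (Fin (d i)) (Fin (d i))), Matrix.trace, Fintype.sum_sigma]
  refine Finset.sum_congr rfl fun i _ => ?_
  rw [Fintype.sum_prod_type, Matrix.trace, Matrix.trace, Finset.sum_mul_sum]
  refine Finset.sum_congr rfl fun a _ => Finset.sum_congr rfl fun b _ => ?_
  rw [Matrix.diag_apply, LinearMap.toMatrix_apply, Pi.basis_repr, Pi.basis_apply,
    Matrix.stdBasis_eq_single]
  have : ∀ M : Matrix (Fin (d i)) (Fin (d i)) k,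
    (Matrix.stdBasis k (Fin (d i)) (Fin (d i))).repr M (a, b) = M a b := fun M => rfl
  simp only [LinearMap.mulLeftRight_apply, this, Pi.mul_apply, Pi.single_eq_same]
  rw [Matrix.mul_assoc, Matrix.mul_apply]
  simp [Matrix.single_apply, Matrix.mul_apply, ite_and]

theorem exists_nat_trace_of_isIdempotent {d : ℕ} (E : Matrix (Fin d) (Fin d) k) (h : E * E = E) :
    ∃ m : ℕ, E.trace = m := by
  have h' : IsIdempotentElem (Matrix.toLin' E) := by
    rw [IsIdempotentElem, Module.End.mul_eq_comp, ← Matrix.toLin'_mul, h]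
  refine ⟨Module.finrank k (LinearMap.range (Matrix.toLin' E)), ?_⟩
  rw [← Matrix.trace_toLin'_eq]
  exact (LinearMap.IsIdempotentElem.isProj_range _ h').trace

end Trace

section Group

variable {k G : Type*} [Field k] [Group G] {n : ℕ} {d : Fin n → ℕ}
  (Φ : MonoidAlgebra k G ≃ₐ[k] ∀ i, Matrix (Fin (d i)) (Fin (d i)) k)

/-- The `i`-th matrix representation attached to a Wedderburn decomposition. -/
noncomputable def rep (i : Fin n) : G →* Matrix (Fin (d i)) (Fin (d i)) k :=
  (((Pi.evalAlgHom k _ i).comp Φ.toAlgHom : MonoidAlgebra k G →ₐ[k] _) : _ →* _).comp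
    (MonoidAlgebra.of k G)

/-- The `i`-th irreducible character attached to a Wedderburn decomposition. -/
noncomputable def chr (i : Fin n) (g : G) : k := (rep Φ i g).trace

theorem rep_apply (i : Fin n) (g : G) : rep Φ i g = Φ (MonoidAlgebra.of k G g) i := rfl

theorem chr_one (i : Fin n) : chr Φ i 1 = d i := by
  simp [chr]

theorem chr_conj (i : Fin n) (g h : G) : chr Φ i (h⁻¹ * g * h) = chr Φ i g := by
  simp only [chr, map_mul]
  rw [Matrix.trace_mul_comm, ← mul_assoc, ← map_mul]
  simp

theorem sum_chr_mul_chr [Fintype G] [DecidableEq G] (g h : G) :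
    ∑ i, chr Φ i g * chr Φ i h = (Finset.univ.filter fun x : G => g * x * h = x).card := by
  have h1 := trace_mul_mul_pi d (Φ (MonoidAlgebra.of k G g)) (Φ (MonoidAlgebra.of k G h))
  simp only [chr, rep_apply]
  rw [← h1]
  have h2 : LinearMap.mulLeftRight k (Φ (MonoidAlgebra.of k G g), Φ (MonoidAlgebra.of k G h)) =
      Φ.toLinearEquiv.conj
        (LinearMap.mulLeftRight k (MonoidAlgebra.of k G g, MonoidAlgebra.of k G h)) := by
    refine LinearMap.ext fun x => ?_
    simp [LinearEquiv.conj_apply]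
  rw [h2, LinearMap.trace_conj', LinearMap.trace_eq_matrix_trace k
    (MonoidAlgebra.basis G k), Matrix.trace, Finset.card_filter]
  push_cast
  refine Finset.sum_congr rfl fun x _ => ?_
  rw [Matrix.diag_apply, LinearMap.toMatrix_apply]
  simp [LinearMap.mulLeftRight_apply, MonoidAlgebra.basis, MonoidAlgebra.single_mul_single]
  rw [Finsupp.single_apply]

theorem card_centralizer [Fintype G] (g : G) :
    ∑ i, chr Φ i g * chr Φ i g⁻¹ = Nat.card (Subgroup.centralizer {g}) := by
  classical
  rw [sum_chr_mul_chr, Nat.card_eq_fintype_card, Fintype.card_subtype]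
  congr 2
  ext x
  simp [Subgroup.mem_centralizer_iff, mul_inv_eq_iff_eq_mul]

theorem sum_chr_eq_zero [Fintype G] {g h : G} (hgh : ¬ IsConj g h) :
    ∑ i, chr Φ i g * chr Φ i h⁻¹ = 0 := by
  classical
  rw [sum_chr_mul_chr, Finset.card_eq_zero.2, Nat.cast_zero]
  refine Finset.filter_eq_empty_iff.2 fun x _ hx => hgh ?_
  refine isConj_iff.2 ⟨x⁻¹, ?_⟩
  rw [mul_inv_eq_iff_eq_mul] at hx
  simp [mul_assoc, hx]


/-- The linear extension of `chr Φ i` to the group algebra. -/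
noncomputable def chrLin (i : Fin n) : MonoidAlgebra k G →ₗ[k] k :=
  Matrix.traceLinearMap (Fin (d i)) k k ∘ₗ LinearMap.proj i ∘ₗ Φ.toLinearMap

theorem linearIndependent_chr [∀ i, NeZero (d i)] (c : Fin n → k)
    (hc : ∀ g, ∑ i, c i * chr Φ i g = 0) (i : Fin n) : c i = 0 := by
  have h : ∑ i, c i • chrLin Φ i = 0 := by
    refine MonoidAlgebra.lhom_ext' fun g => LinearMap.ext_ring ?_
    have h0 : ∀ i, chrLin Φ i (MonoidAlgebra.single g 1) = chr Φ i g := fun _ => rfl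
    simpa [h0] using hc g
  have h2 := LinearMap.congr_fun h (Φ.symm (Pi.single i (Matrix.single 0 0 1)))
  simp only [LinearMap.sum_apply, LinearMap.smul_apply, chrLin, LinearMap.comp_apply,
    AlgEquiv.toLinearMap_apply, AlgEquiv.apply_symm_apply, LinearMap.proj_apply,
    LinearMap.zero_apply] at h2
  rw [Finset.sum_eq_single i] at h2
  · simpa using h2
  · intro j _ hj
    simp [Pi.single_eq_of_ne hj]
  · simp

theorem trace_unique {m : ℕ} [NeZero m] (t : Matrix (Fin m) (Fin m) k →ₗ[k] k)
    (ht : ∀ A B, t (A * B) = t (B * A)) (A : Matrix (Fin m) (Fin m) k) :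
    t A = t (Matrix.single 0 0 1) * A.trace := by
  have h1 : t = t (Matrix.single 0 0 1) • Matrix.traceLinearMap (Fin m) k k := by
    refine Matrix.ext_linearMap k fun a b => LinearMap.ext_ring ?_
    by_cases hab : a = b
    · subst hab
      have := ht (Matrix.single a 0 (1 : k)) (Matrix.single 0 a 1)
      simp only [Matrix.single_mul_single_same, mul_one] at this
      simp [this]
    · have := ht (Matrix.single a a (1 : k)) (Matrix.single a b 1)
      rw [Matrix.single_mul_single_same, Matrix.single_mul_single_of_ne _ _ _ _ (Ne.symm hab)] at this
      simp only [mul_one, map_zero] at this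
      simp [this, hab]
  conv_lhs => rw [h1]
  rfl

theorem exists_nat_decomp [∀ i, NeZero (d i)] {m : ℕ}
    (F : MonoidAlgebra k G →ₐ[k] Matrix (Fin m) (Fin m) k) :
    ∃ c : Fin n → ℕ, ∀ g : G, (F (MonoidAlgebra.of k G g)).trace = ∑ i, c i * chr Φ i g := by
  have h1 : ∀ i, ∃ m : ℕ, (F (Φ.symm (Pi.single i (Matrix.single 0 0 1)))).trace = m := by
    intro i
    refine exists_nat_trace_of_isIdempotent _ ?_
    rw [← map_mul, ← map_mul, ← Pi.single_mul]
    simp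
  choose c hc using h1
  refine ⟨c, fun g => ?_⟩
  let t (i : Fin n) : Matrix (Fin (d i)) (Fin (d i)) k →ₗ[k] k :=
    Matrix.traceLinearMap (Fin m) k k ∘ₗ F.toLinearMap ∘ₗ Φ.symm.toLinearMap ∘ₗ
      LinearMap.single k (fun i => Matrix (Fin (d i)) (Fin (d i)) k) i
  have h2 : ∀ i A, t i A = c i * A.trace := by
    intro i A
    rw [trace_unique (t i), ← hc]
    · rfl
    · intro A B
      simp only [t, LinearMap.comp_apply, LinearMap.coe_single, Pi.single_mul,
        AlgEquiv.toLinearMap_apply, map_mul, AlgHom.toLinearMap_apply,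
        Matrix.traceLinearMap_apply]
      exact Matrix.trace_mul_comm _ _
  simp only [chr, rep_apply, ← h2]
  have h3 : MonoidAlgebra.of k G g = ∑ i, Φ.symm (Pi.single i (Φ (MonoidAlgebra.of k G g) i)) := by
    rw [← map_sum, Finset.univ_sum_single, AlgEquiv.symm_apply_apply]
  conv_lhs => rw [h3, map_sum, Matrix.trace_sum]
  rfl

theorem sum_class [Fintype G] (f : G → k) (hf : ∀ x g, f (x⁻¹ * g * x) = f g) (g : G) :
    ∑ i, (∑ h, f h * chr Φ i h⁻¹) * chr Φ i g = Fintype.card G * f g := by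
  classical
  simp_rw [Finset.sum_mul]
  rw [Finset.sum_comm]
  have h1 : ∀ h, ∑ i, f h * chr Φ i h⁻¹ * chr Φ i g =
      ∑ x : G, if x⁻¹ * g * x = h then f h else 0 := by
    intro h
    have := sum_chr_mul_chr Φ g h⁻¹
    simp only [mul_assoc, ← Finset.mul_sum]
    simp_rw [mul_comm (chr Φ _ h⁻¹), this, Finset.card_filter]
    push_cast
    rw [Finset.mul_sum]
    refine Finset.sum_congr rfl fun x _ => ?_
    have : g * x * h⁻¹ = x ↔ x⁻¹ * g * x = h := by
      rw [mul_inv_eq_iff_eq_mul, mul_assoc x⁻¹, inv_mul_eq_iff_eq_mul]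
    simp only [← mul_assoc, this, mul_ite, mul_one, mul_zero]
  simp_rw [h1]
  rw [Finset.sum_comm]
  simp [hf]

theorem row_orthogonality [Fintype G] [∀ i, NeZero (d i)] (i j : Fin n) :
    ∑ h, chr Φ i h * chr Φ j h⁻¹ = if i = j then (Fintype.card G : k) else 0 := by
  have h1 := linearIndependent_chr Φ (fun j => ∑ h, chr Φ i h * chr Φ j h⁻¹ -
    if i = j then (Fintype.card G : k) else 0) (fun g => ?_) j
  · exact sub_eq_zero.1 h1
  · simp only [sub_mul, Finset.sum_sub_distrib, sum_class Φ (chr Φ i) (fun x g => chr_conj Φ i g x)]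
    simp

end Group
end WedderburnChar

open scoped MonoidAlgebra
namespace WedderburnChar

section Abelian

variable {k : Type*} [Field k] [CharZero k]

theorem exists_nat_sum_hom {A : Type*} [Group A] [Fintype A] {d : ℕ}
    (F : A →* Matrix (Fin d) (Fin d) k) (l : A →* kˣ) :
    ∃ m : ℕ, ∑ a, (l a⁻¹ : kˣ) * (F a).trace = m * Fintype.card A := by
  have hA : (Fintype.card A : k) ≠ 0 := by simp
  set S : Matrix (Fin d) (Fin d) k := ∑ a, ((l a⁻¹ : kˣ) : k) • F a with hS
  have h1 : ∀ b, ((l b⁻¹ : kˣ) : k) • F b * S = S := by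
    intro b
    rw [hS, Finset.mul_sum]
    refine Fintype.sum_equiv (Equiv.mulLeft b) _ _ fun a => ?_
    simp only [Equiv.coe_mulLeft, mul_inv_rev, map_mul, smul_mul_smul_comm, Units.val_mul]
    rw [mul_comm]
  have h2 : S * S = (Fintype.card A : k) • S := by
    conv_lhs => lhs; rw [hS]
    rw [Finset.sum_mul, Finset.sum_congr rfl fun b _ => h1 b, Finset.sum_const, Finset.card_univ,
      Nat.cast_smul_eq_nsmul]
  obtain ⟨m, hm⟩ := exists_nat_trace_of_isIdempotent ((Fintype.card A : k)⁻¹ • S) (by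
    rw [smul_mul_smul_comm, h2, smul_smul]
    congr 1
    field_simp)
  refine ⟨m, ?_⟩
  rw [← hm, Matrix.trace_smul, hS, Matrix.trace_sum]
  simp only [Matrix.trace_smul, smul_eq_mul]
  field_simp

theorem sum_hom_eq_zero [IsAlgClosed k] {A : Type*} [CommGroup A] [Fintype A] [Fintype (A →* kˣ)] {a : A}
    (ha : a ≠ 1) : ∑ l : A →* kˣ, ((l a : kˣ) : k) = 0 := by
  obtain ⟨μ, hμ⟩ := CommGroup.exists_apply_ne_one_of_hasEnoughRootsOfUnity A k ha
  have h1 : ((μ a : kˣ) : k) * ∑ l : A →* kˣ, ((l a : kˣ) : k) = ∑ l : A →* kˣ, ((l a : kˣ) : k) := by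
    rw [Finset.mul_sum]
    exact Fintype.sum_equiv (Equiv.mulLeft μ) _ _ fun l => by simp
  have h2 : (((μ a : kˣ) : k) - 1) * ∑ l : A →* kˣ, ((l a : kˣ) : k) = 0 := by
    rw [sub_mul, h1, one_mul, sub_self]
  refine (mul_eq_zero.1 h2).resolve_left fun h => hμ ?_
  exact Units.ext (sub_eq_zero.1 h)

theorem sum_hom [IsAlgClosed k] {A : Type*} [CommGroup A] [Fintype A] [DecidableEq A] [Fintype (A →* kˣ)] (a : A) :
    ∑ l : A →* kˣ, ((l a : kˣ) : k) = if a = 1 then (Fintype.card A : k) else 0 := by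
  split_ifs with h
  · subst h
    have := CommGroup.card_monoidHom_of_hasEnoughRootsOfUnity A k
    rw [Nat.card_eq_fintype_card, Nat.card_eq_fintype_card] at this
    simp [this]
  · exact sum_hom_eq_zero h

theorem exists_nat_mult [IsAlgClosed k] {A : Type*} [CommGroup A] [Fintype A] [Fintype (A →* kˣ)] {d : ℕ}
    (F : A →* Matrix (Fin d) (Fin d) k) :
    ∃ m : (A →* kˣ) → ℕ, (∀ a, (F a).trace = ∑ l, m l * ((l a : kˣ) : k)) ∧
      ∀ l : A →* kˣ, ∑ a, ((l a⁻¹ : kˣ) : k) * (F a).trace = m l * Fintype.card A := by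
  classical
  choose m hm using exists_nat_sum_hom F
  refine ⟨m, fun a => ?_, hm⟩
  have hA : (Fintype.card A : k) ≠ 0 := by simp
  rw [← mul_left_inj' hA, Finset.sum_mul]
  have h1 : ∀ l : A →* kˣ, (m l : k) * ((l a : kˣ) : k) * Fintype.card A =
      ∑ b, ((l (a * b⁻¹) : kˣ) : k) * (F b).trace := by
    intro l
    rw [mul_right_comm, ← hm, Finset.sum_mul]
    refine Finset.sum_congr rfl fun b _ => ?_
    simp only [map_mul, Units.val_mul]
    ring
  simp_rw [h1]
  rw [Finset.sum_comm]
  simp_rw [← Finset.sum_mul, sum_hom]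
  simp [mul_inv_eq_one, mul_comm]

theorem int_dvd_of_isIntegral {a b : ℤ} (hb : b ≠ 0) {x : k} (hx : IsIntegral ℤ x)
    (h : (b : k) * x = a) : b ∣ a := by
  have hb' : (b : k) ≠ 0 := by exact_mod_cast hb
  have h1 : x = algebraMap ℚ k (a / b) := by
    rw [eq_ratCast]; push_cast; rw [eq_div_iff hb', mul_comm, h]
  rw [h1, isIntegral_algebraMap_iff (algebraMap ℚ k).injective] at hx
  obtain ⟨c, hc⟩ := IsIntegrallyClosed.isIntegral_iff.1 hx
  have hb2 : (b : ℚ) ≠ 0 := by exact_mod_cast hb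
  refine ⟨c, ?_⟩
  rw [eq_div_iff hb2] at hc
  have hc' : (c : ℚ) * b = a := hc
  rw [mul_comm]
  exact_mod_cast hc'.symm

end Abelian

section Values

variable {k : Type*} [Field k] [CharZero k] [IsAlgClosed k]
variable {G : Type*} [Group G] [Fintype G] {d : ℕ} (F : G →* Matrix (Fin d) (Fin d) k)

/-- Restricting a representation to a cyclic group. -/
theorem exists_multiset_roots (g : G) : ∃ s : Multiset k, Multiset.card s = d ∧
    (∀ w ∈ s, w ^ orderOf g = 1) ∧ ∀ j : ℕ, (F (g ^ j)).trace = (s.map (· ^ j)).sum := by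
  classical
  let A := Subgroup.zpowers g
  let _ : CommGroup A :=
    { (inferInstance : Group A) with mul_comm := (Subgroup.zpowers_isMulCommutative g).is_comm.comm }
  have : Finite (A →* kˣ) := inferInstance
  have : Fintype (A →* kˣ) := Fintype.ofFinite _
  have : Fintype A := Fintype.ofFinite _
  obtain ⟨m, hm, -⟩ := exists_nat_mult (A := A) (F.comp A.subtype)
  let γ : A := ⟨g, Subgroup.mem_zpowers g⟩
  have h2 : ∀ j : ℕ, (F (g ^ j)).trace =
      ((∑ l, m l • ({((l γ : kˣ) : k)} : Multiset k)).map (· ^ j)).sum := by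
    intro j
    have := hm (γ ^ j)
    simp only [MonoidHom.comp_apply] at this
    refine Eq.trans this ?_
    rw [← Multiset.coe_mapAddMonoidHom, map_sum, Multiset.sum_sum]
    refine Finset.sum_congr rfl fun l _ => ?_
    simp [Multiset.map_nsmul, Multiset.sum_nsmul]
  refine ⟨∑ l, m l • {((l γ : kˣ) : k)}, ?_, ?_, h2⟩
  · have := h2 0
    simp at this
    rw [Multiset.card_sum]
    simp only [Multiset.card_nsmul, Multiset.card_singleton, mul_one]
    exact_mod_cast this.symm
  · intro w hw
    obtain ⟨l, -, hl⟩ := Multiset.mem_sum.1 hw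
    have := Multiset.mem_of_mem_nsmul hl
    rw [Multiset.mem_singleton] at this
    have h3 : γ ^ orderOf g = 1 := Subtype.ext (pow_orderOf_eq_one g)
    rw [this, ← Units.val_pow_eq_pow_val, ← map_pow, h3]
    simp

theorem isIntegral_trace (g : G) : IsIntegral ℤ (F g).trace := by
  obtain ⟨s, -, hs, h⟩ := exists_multiset_roots F g
  have := h 1
  simp only [pow_one, Multiset.map_id'] at this
  rw [this]
  refine IsIntegral.multiset_sum fun w hw => ?_
  exact IsIntegral.of_pow (orderOf_pos g) (by rw [hs w hw]; exact isIntegral_one)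

theorem map_trace_inv (φ : k →+* ℂ) (g : G) : φ (F g⁻¹).trace = star (φ (F g).trace) := by
  obtain ⟨s, -, hs, h⟩ := exists_multiset_roots F g
  have h1 : g⁻¹ = g ^ (orderOf g - 1) := by
    rw [inv_eq_iff_mul_eq_one, ← pow_succ', Nat.sub_add_cancel (orderOf_pos g), pow_orderOf_eq_one]
  have h2 := h 1
  rw [pow_one] at h2
  rw [h1, h, h2, map_multiset_sum, map_multiset_sum, ← starRingEnd_apply, map_multiset_sum,
    Multiset.map_map, Multiset.map_map, Multiset.map_map]
  congr 1
  refine Multiset.map_congr rfl fun w hw => ?_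
  have h3 : φ w ^ orderOf g = 1 := by rw [← map_pow, hs w hw, map_one]
  have h4 : φ w * φ w ^ (orderOf g - 1) = 1 := by
    rw [← pow_succ', Nat.sub_add_cancel (orderOf_pos g), h3]
  have h5 := Complex.norm_eq_one_of_pow_eq_one h3 (orderOf_pos g).ne'
  simp only [Function.comp_apply, map_pow, pow_one]
  rw [← Complex.inv_eq_conj h5]
  exact eq_inv_of_mul_eq_one_right h4

theorem dvd_trace_sub {p e : ℕ} [hp : Fact p.Prime] {g : G} (hg : g ^ p ^ e = 1) {t : ℤ}
    (ht : (F g).trace = t) : (p : ℤ) ∣ t - d := by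
  obtain ⟨s, hs, hs1, h⟩ := exists_multiset_roots F g
  have h1 := h 1
  simp only [pow_one, Multiset.map_id', ht] at h1
  have hs2 : ∀ w ∈ s, w ^ p ^ e = 1 := fun w hw => by
    obtain ⟨c, hc⟩ := orderOf_dvd_of_pow_eq_one hg
    rw [hc, pow_mul, hs1 w hw, one_pow]
  let O := integralClosure ℤ k
  let I : Ideal O := Ideal.span {(p : O)}
  have hI : I ≠ ⊤ := by
    intro hI
    obtain ⟨c, hc⟩ := Ideal.mem_span_singleton.1 ((Ideal.eq_top_iff_one _).1 hI)
    have hc' : ((p : ℤ) : k) * (c : k) = ((1 : ℤ) : k) := by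
      have := congrArg (fun x : O => (x : k)) hc
      push_cast at this ⊢
      exact this.symm
    have := int_dvd_of_isIntegral (by exact_mod_cast hp.out.ne_zero) c.2 hc'
    exact hp.out.one_lt.ne' (by exact_mod_cast Int.eq_one_of_dvd_one (by positivity) this)
  have : Nontrivial (O ⧸ I) := Ideal.Quotient.nontrivial_iff.2 hI
  have hpz : ((p : ℕ) : O ⧸ I) = 0 := by
    rw [← map_natCast (Ideal.Quotient.mk I)]
    exact Ideal.Quotient.eq_zero_iff_mem.2 (Ideal.mem_span_singleton_self _)
  have : CharP (O ⧸ I) p := by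
    refine (CharP.charP_iff_prime_eq_zero hp.out).2 hpz
  let q := Ideal.Quotient.mk I
  obtain ⟨s', hs'⟩ : ∃ s' : Multiset O, s'.map Subtype.val = s := by
    refine ⟨s.attach.map fun w => ⟨w.1, IsIntegral.of_pow (orderOf_pos g)
      (by rw [hs1 w.1 w.2]; exact isIntegral_one)⟩, ?_⟩
    rw [Multiset.map_map]
    exact Multiset.attach_map_val s
  have hsum : s'.sum = (t : O) := by
    apply Subtype.ext
    have h3 := map_multiset_sum (algebraMap O k) s'
    have h4 : (algebraMap O k : O → k) = Subtype.val := rfl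
    rw [h4, hs', ← h1] at h3
    rw [h3]
    push_cast
    rfl
  have h5 : ∀ w ∈ s', w ^ p ^ e = 1 := by
    intro w hw
    apply Subtype.ext
    push_cast
    exact hs2 _ (hs' ▸ Multiset.mem_map_of_mem _ hw)
  have h6 : (q s'.sum) ^ p ^ e = (d : O ⧸ I) := by
    rw [map_multiset_sum, ← iterateFrobenius_def, map_multiset_sum, Multiset.map_map,
      Multiset.map_congr rfl (g := fun _ => (1 : O ⧸ I))]
    · have : Multiset.card s' = d := by rw [← hs, ← hs', Multiset.card_map]
      simp [this]
    · intro w hw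
      simp only [Function.comp_apply, iterateFrobenius_def]
      rw [← map_pow, h5 w hw, map_one]
  have h7 : (q s'.sum) ^ p ^ e = ((t : ℤ) : O ⧸ I) := by
    rw [hsum, map_intCast]
    have h8 : ((t : ℤ) : O ⧸ I) = ZMod.castHom dvd_rfl (O ⧸ I) (t : ZMod p) := by simp
    rw [h8, ← map_pow, ZMod.pow_card_pow]
  have h9 : ((t - d : ℤ) : O ⧸ I) = 0 := by
    push_cast
    rw [← h6, ← h7, sub_self]
  exact (CharP.intCast_eq_zero_iff (O ⧸ I) p _).1 h9

end Values
end WedderburnChar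

open scoped MonoidAlgebra
namespace WedderburnChar

section Irreducible

variable {k G : Type*} [Field k] [CharZero k] [Group G] [Fintype G]
  {n : ℕ} {d : Fin n → ℕ} [∀ i, NeZero (d i)]
  (Φ : MonoidAlgebra k G ≃ₐ[k] ∀ i, Matrix (Fin (d i)) (Fin (d i)) k)

theorem isIntegral_class_sum (f : G → k) (hf : ∀ x g, f (x⁻¹ * g * x) = f g)
    (hi : ∀ g, IsIntegral ℤ (f g)) (i : Fin n) :
    IsIntegral ℤ ((∑ g, f g * chr Φ i g) / d i) := by
  classical
  let O := integralClosure ℤ k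
  let z : MonoidAlgebra O G := ∑ g, MonoidAlgebra.single g (⟨f g, hi g⟩ : O)
  let ev : MonoidAlgebra O G →ₐ[O] Matrix (Fin (d i)) (Fin (d i)) k :=
    MonoidAlgebra.lift O _ G (rep Φ i)
  have hev : ev z = ∑ g, f g • rep Φ i g := by
    simp only [z, map_sum, ev, MonoidAlgebra.lift_single]
    rfl
  have hz : IsIntegral O (ev z) := by
    have : Module.Finite O (MonoidAlgebra O G) := Module.Finite.of_basis (MonoidAlgebra.basis G O)
    exact (IsIntegral.of_finite O z).map ev
  have hc : ∀ h, rep Φ i h * ev z = ev z * rep Φ i h := by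
    intro h
    rw [hev, Finset.mul_sum, Finset.sum_mul]
    refine Fintype.sum_equiv (MulAut.conj h).toEquiv _ _ fun g => ?_
    have := hf h (h * g * h⁻¹)
    simp only [MulEquiv.toEquiv_eq_coe, MulEquiv.coe_toEquiv, MulAut.conj_apply, mul_smul_comm,
      smul_mul_assoc, ← map_mul]
    rw [← this]
    simp [mul_assoc]
  have hc2 : ∀ M, Commute M (ev z) := by
    intro M
    let Z : MonoidAlgebra k G := Φ.symm (Pi.single i M)
    have h1 : ∀ Z : MonoidAlgebra k G, Commute (Φ Z i) (ev z) := by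
      intro Z
      induction Z using MonoidAlgebra.induction_on with
      | of g => exact hc g
      | add a b ha hb => rw [map_add, Pi.add_apply]; exact ha.add_left hb
      | smul r a ha => rw [map_smul, Pi.smul_apply]; exact ha.smul_left r
    have := h1 Z
    simpa [Z] using this
  obtain ⟨c, hc3⟩ := Matrix.mem_range_scalar_iff_commute_single'.2 fun a b => hc2 _
  have hd : (d i : k) ≠ 0 := by exact_mod_cast NeZero.ne (d i)
  have h4 : (∑ g, f g * chr Φ i g) / d i = c := by
    rw [div_eq_iff hd]
    have := congrArg Matrix.trace (hc3.trans hev)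
    rw [Matrix.trace_sum] at this
    simp only [Matrix.trace_smul, smul_eq_mul] at this
    rw [show (∑ g, f g * chr Φ i g) = _ from this.symm]
    simp [Matrix.trace, mul_comm]
  rw [h4]
  have h5 : IsIntegral O c := by
    rw [← hc3] at hz
    have h6 : Function.Injective (Algebra.ofId k (Matrix (Fin (d i)) (Fin (d i)) k)) :=
      (algebraMap k _).injective
    refine (isIntegral_algHom_iff ((Algebra.ofId k (Matrix (Fin (d i)) (Fin (d i)) k)).restrictScalars O) h6).1 ?_
    exact hz
  exact isIntegral_trans (R := ℤ) c h5

theorem degree_mul_centralizer_dvd {i : Fin n} {g : G} {t : ℤ} (ht : chr Φ i g = t) :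
    (d i * Nat.card (Subgroup.centralizer {g}) : ℤ) ∣ Fintype.card G * t := by
  classical
  have h1 := isIntegral_class_sum Φ (fun h => if IsConj g h then 1 else 0) (fun x h => by
    congr 1
    refine propext ⟨fun H => H.trans (isConj_iff.2 ⟨x, by group⟩),
      fun H => H.trans (isConj_iff.2 ⟨x⁻¹, by group⟩)⟩) (fun h => by
      split_ifs; exacts [isIntegral_one, isIntegral_zero]) i
  have hd : (d i : k) ≠ 0 := by exact_mod_cast NeZero.ne (d i)
  have h2 : ∑ h, (if IsConj g h then (1 : k) else 0) * chr Φ i h =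
      (Nat.card (ConjClasses.mk g).carrier : k) * t := by
    simp_rw [ite_mul, one_mul, zero_mul]
    rw [← Finset.sum_filter, Finset.sum_congr rfl (g := fun _ => (t : k))]
    · rw [Finset.sum_const, nsmul_eq_mul, Nat.card_eq_fintype_card, Fintype.card_subtype]
      congr 3
      ext h
      simp only [ConjClasses.mem_carrier_iff_mk_eq, ConjClasses.mk_eq_mk_iff_isConj, Finset.mem_filter,
        Finset.mem_univ, true_and]
      exact isConj_comm
    · intro h hh
      obtain ⟨c, hc⟩ := isConj_iff.1 (Finset.mem_filter.1 hh).2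
      rw [← hc, ← ht]
      have := chr_conj Φ i g c⁻¹
      simpa using this
  rw [h2] at h1
  have h3 := int_dvd_of_isIntegral (a := Nat.card (ConjClasses.mk g).carrier * t) (b := d i)
    (by exact_mod_cast NeZero.ne (d i)) h1 (by push_cast; field_simp)
  have h4 : Nat.card (ConjClasses.mk g).carrier * Nat.card (Subgroup.centralizer {g}) =
      Fintype.card G := by
    have h5 := Nat.card_congr (MulAction.orbitProdStabilizerEquivGroup (ConjAct G) g)
    rw [Nat.card_prod, ConjAct.orbit_eq_carrier_conjClasses,
      ← Subgroup.nat_card_centralizer_nat_card_stabilizer] at h5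
    rw [h5, ← Nat.card_eq_fintype_card]
    rfl
  rw [← h4]
  push_cast
  rw [mul_right_comm]
  exact mul_dvd_mul_right h3 _

variable [IsAlgClosed k]

include Φ in
theorem degree_dvd_card (i : Fin n) : d i ∣ Fintype.card G := by
  have h1 := isIntegral_class_sum Φ (fun g => chr Φ i g⁻¹) (fun x g => by
    rw [← chr_conj Φ i g⁻¹ x]; simp [mul_assoc]) (fun g => isIntegral_trace _ _) i
  have h2 := row_orthogonality Φ i i
  simp only [if_true] at h2
  simp_rw [mul_comm (chr Φ i _⁻¹)] at h1
  rw [h2] at h1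
  have hd : (d i : k) ≠ 0 := by exact_mod_cast NeZero.ne (d i)
  have := int_dvd_of_isIntegral (a := Fintype.card G) (b := d i)
    (by exact_mod_cast NeZero.ne (d i)) h1 (by push_cast; field_simp)
  exact_mod_cast this

omit [∀ i, NeZero (d i)] in
theorem sum_sq_le_centralizer (φ : k →+* ℂ) (g : G) (s : Finset (Fin n)) (t : Fin n → ℤ)
    (ht : ∀ i ∈ s, chr Φ i g = t i) :
    ∑ i ∈ s, t i ^ 2 ≤ Nat.card (Subgroup.centralizer {g}) := by
  have h1 := congrArg φ (card_centralizer Φ g)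
  rw [map_sum, map_natCast] at h1
  have h2 : ∀ i, φ (chr Φ i g * chr Φ i g⁻¹) = ((Complex.normSq (φ (chr Φ i g)) : ℝ) : ℂ) := by
    intro i
    rw [map_mul, chr, chr, map_trace_inv, Complex.normSq_eq_conj_mul_self, mul_comm]
    rfl
  simp_rw [h2] at h1
  have h3 : ∑ i, Complex.normSq (φ (chr Φ i g)) = Nat.card (Subgroup.centralizer {g}) := by
    exact_mod_cast h1
  have h4 : ∑ i ∈ s, Complex.normSq (φ (chr Φ i g)) ≤ ∑ i, Complex.normSq (φ (chr Φ i g)) :=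
    Finset.sum_le_sum_of_subset_of_nonneg (Finset.subset_univ _) fun _ _ _ => Complex.normSq_nonneg _
  rw [h3, Finset.sum_congr rfl (g := fun i => ((t i : ℤ) : ℝ) ^ 2)] at h4
  · exact_mod_cast h4
  · intro i hi
    rw [ht i hi, map_intCast, ← Complex.ofReal_intCast, Complex.normSq_ofReal, sq]

end Irreducible

section Galois

variable {G : Type*} [Group G] [Fintype G] {n : ℕ} {d : Fin n → ℕ} [∀ i, NeZero (d i)]
  (Φ : MonoidAlgebra (AlgebraicClosure ℚ) G ≃ₐ[AlgebraicClosure ℚ]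
    ∀ i, Matrix (Fin (d i)) (Fin (d i)) (AlgebraicClosure ℚ))

local notation "ℚa" => AlgebraicClosure ℚ

theorem exists_galois_conj (σ : ℚa ≃ₐ[ℚ] ℚa) (i : Fin n) :
    ∃ j, d j = d i ∧ ∀ g, σ (chr Φ i g) = chr Φ j g := by
  obtain ⟨c, hc⟩ := exists_nat_decomp Φ (MonoidAlgebra.lift ℚa (Matrix (Fin (d i)) (Fin (d i)) ℚa) G
    (((σ : ℚa →+* ℚa).mapMatrix.toMonoidHom).comp (rep Φ i)))
  have hc' : ∀ g, σ (chr Φ i g) = ∑ j, c j * chr Φ j g := by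
    intro g
    rw [← hc, MonoidAlgebra.lift_of]
    simp [chr, Matrix.trace, map_sum]
  have h1 : ∑ h, σ (chr Φ i h) * σ (chr Φ i h⁻¹) = Fintype.card G := by
    simp_rw [← map_mul]
    rw [← map_sum, row_orthogonality]
    simp
  have h2 : (∑ j, (c j : ℚa) ^ 2) * Fintype.card G = Fintype.card G := by
    refine Eq.trans (Eq.symm ?_) h1
    simp_rw [hc', Finset.sum_mul_sum]
    rw [Finset.sum_comm, Finset.sum_mul]
    refine Finset.sum_congr rfl fun j _ => ?_
    rw [Finset.sum_comm]
    have : ∀ l, ∑ h, c j * chr Φ j h * (c l * chr Φ l h⁻¹) =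
        c j * c l * ∑ h, chr Φ j h * chr Φ l h⁻¹ := by
      intro l
      rw [Finset.mul_sum]
      exact Finset.sum_congr rfl fun h _ => by ring
    simp_rw [this, row_orthogonality]
    simp [sq]
  have h3 : ∑ j, c j ^ 2 = 1 := by
    have hG : (Fintype.card G : ℚa) ≠ 0 := by simp
    have := (mul_eq_right₀ hG).1 h2
    exact_mod_cast this
  obtain ⟨j, hj⟩ : ∃ j, c j ≠ 0 := by
    by_contra! h
    simp [h] at h3
  have h4 : c j = 1 ∧ ∀ l, l ≠ j → c l = 0 := by
    classical
    rw [← Finset.add_sum_erase _ _ (Finset.mem_univ j)] at h3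
    have h5 : 1 ≤ c j ^ 2 := Nat.one_le_iff_ne_zero.2 (pow_ne_zero _ hj)
    have h6 : ∑ l ∈ Finset.univ.erase j, c l ^ 2 = 0 := by omega
    refine ⟨by nlinarith, fun l hl => ?_⟩
    have := Finset.sum_eq_zero_iff.1 h6 l (by simp [hl])
    exact pow_eq_zero_iff (two_ne_zero) |>.1 this
  have h5 : ∀ g, σ (chr Φ i g) = chr Φ j g := by
    intro g
    rw [hc', Finset.sum_eq_single j]
    · simp [h4.1]
    · intro l _ hl
      simp [h4.2 l hl]
    · simp
  refine ⟨j, ?_, h5⟩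
  have := h5 1
  rw [chr_one, chr_one, map_natCast] at this
  exact_mod_cast this.symm

theorem exists_int_of_fixed {x : ℚa} (hx : IsIntegral ℤ x) (h : ∀ σ : ℚa ≃ₐ[ℚ] ℚa, σ x = x) :
    ∃ t : ℤ, x = t := by
  have : Algebra.IsAlgebraic ℚ ℚa := by
    have := AlgebraicClosure.isAlgebraic ℚ
    rwa [Subsingleton.elim (AlgebraicClosure.instAlgebra ℚ) DivisionRing.toRatAlgebra] at this
  have : IsGalois ℚ ℚa :=
    { to_normal := normal_iff.2 fun x => ⟨Algebra.IsIntegral.isIntegral x, IsAlgClosed.splits _⟩ }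
  have h1 := (InfiniteGalois.mem_range_algebraMap_iff_fixed x).2 h
  obtain ⟨q, rfl⟩ := h1
  rw [isIntegral_algebraMap_iff (algebraMap ℚ ℚa).injective] at hx
  obtain ⟨c, hc⟩ := IsIntegrallyClosed.isIntegral_iff.1 hx
  refine ⟨c, ?_⟩
  rw [← hc]
  simp

theorem exists_int_of_unique_degree {i : Fin n} (hi : ∀ j, d j = d i → j = i) (g : G) :
    ∃ t : ℤ, chr Φ i g = t := by
  refine exists_int_of_fixed (isIntegral_trace _ _) fun σ => ?_
  obtain ⟨j, hj, h⟩ := exists_galois_conj Φ σ i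
  have := h g
  rwa [hi j hj] at this

end Galois

theorem exists_wedderburn (G : Type*) [Group G] [Finite G] :
    ∃ (n : ℕ) (d : Fin n → ℕ), (∀ i, NeZero (d i)) ∧
      Nonempty (MonoidAlgebra (AlgebraicClosure ℚ) G ≃ₐ[AlgebraicClosure ℚ]
        ∀ i, Matrix (Fin (d i)) (Fin (d i)) (AlgebraicClosure ℚ)) := by
  have : NeZero (Nat.card G : AlgebraicClosure ℚ) := ⟨by exact_mod_cast Nat.card_pos.ne'⟩
  exact IsSemisimpleRing.exists_algEquiv_pi_matrix_of_isAlgClosed _ _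

end WedderburnChar

/-- The degree of the prime `p` in the prime graph (Gruenberg–Kegel graph) `GK(G)` of the
group `G`: the number of primes `q ≠ p` such that `G` contains an element of order `p * q`
(two distinct primes being adjacent in `GK(G)` iff `G` has an element of order their
product). -/
noncomputable def gkDegree (G : Type*) [Group G] (p : ℕ) : ℕ :=
  Nat.card {q : ℕ // p ≠ q ∧ p.Prime ∧ q.Prime ∧ ∃ g : G, orderOf g = p * q}

namespace U343

/-- The order and the degree pattern of `U₃(43)`. -/
structure ODPattern (G : Type*) [Group G] : Prop where
  card : Nat.card G = 2^5 * 3 * 7 * 11^2 * 13 * 43^3 * 139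
  deg2 : gkDegree G 2 = 4
  deg11 : gkDegree G 11 = 4
  deg13 : gkDegree G 13 = 1
  deg43 : gkDegree G 43 = 2
  deg139 : gkDegree G 139 = 1

/-- The neighbours of `p` in the prime graph of `G`. -/
def nbrs (G : Type*) [Group G] (p : ℕ) : Set ℕ :=
  {q | p ≠ q ∧ p.Prime ∧ q.Prime ∧ ∃ g : G, orderOf g = p * q}

theorem gkDegree_eq (G : Type*) [Group G] (p : ℕ) : gkDegree G p = (nbrs G p).ncard := rfl

theorem nbrs_symm {G : Type*} [Group G] {p q : ℕ} (h : q ∈ nbrs G p) : p ∈ nbrs G q :=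
  ⟨h.1.symm, h.2.2.1, h.2.1, by obtain ⟨g, hg⟩ := h.2.2.2; exact ⟨g, by rw [hg, mul_comm]⟩⟩

theorem exists_exponents {x : ℕ} (h : x ∣ 2^5 * 3 * 7 * 11^2 * 13 * 43^3 * 139) :
    ∃ a < 6, ∃ b < 2, ∃ c < 2, ∃ d < 3, ∃ e < 2, ∃ f < 4, ∃ g < 2,
      x = 2^a * 3^b * 7^c * 11^d * 13^e * 43^f * 139^g := by
  have key : ∀ {p m y : ℕ}, p.Prime → y ∣ p ^ m → ∃ a < m + 1, y = p ^ a := fun hp h => by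
    obtain ⟨a, ha, rfl⟩ := (Nat.dvd_prime_pow hp).1 h
    exact ⟨a, by omega, rfl⟩
  have key1 : ∀ {p y : ℕ}, p.Prime → y ∣ p → ∃ a < 2, y = p ^ a := fun {p y} hp h =>
    key (m := 1) hp (by rwa [pow_one])
  obtain ⟨x6, x7, h6, k7, rfl⟩ := (Nat.dvd_mul).1 h
  obtain ⟨x5, y6, h5, k6, rfl⟩ := (Nat.dvd_mul).1 h6
  obtain ⟨x4, y5, h4, k5, rfl⟩ := (Nat.dvd_mul).1 h5
  obtain ⟨x3, y4, h3, k4, rfl⟩ := (Nat.dvd_mul).1 h4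
  obtain ⟨x2, y3, h2, k3, rfl⟩ := (Nat.dvd_mul).1 h3
  obtain ⟨x1, y2, k1, k2, rfl⟩ := (Nat.dvd_mul).1 h2
  obtain ⟨a, ha, rfl⟩ := key (by norm_num) k1
  obtain ⟨b, hb, rfl⟩ := key1 (by norm_num) k2
  obtain ⟨c, hc, rfl⟩ := key1 (by norm_num) k3
  obtain ⟨d, hd, rfl⟩ := key (by norm_num) k4
  obtain ⟨e, he, rfl⟩ := key1 (by norm_num) k5
  obtain ⟨f, hf, rfl⟩ := key (by norm_num) k6
  obtain ⟨g, hg, rfl⟩ := key1 (by norm_num) k7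
  exact ⟨a, ha, b, hb, c, hc, d, hd, e, he, f, hf, g, hg, rfl⟩

theorem prime_cases {p : ℕ} (hp : p.Prime) (h : p ∣ 2^5 * 3 * 7 * 11^2 * 13 * 43^3 * 139) :
    p = 2 ∨ p = 3 ∨ p = 7 ∨ p = 11 ∨ p = 13 ∨ p = 43 ∨ p = 139 := by
  have key : ∀ q m, q.Prime → p ∣ q ^ m → p = q := fun q m hq h =>
    (Nat.prime_dvd_prime_iff_eq hp hq).1 (hp.dvd_of_dvd_pow h)
  simp only [hp.dvd_mul] at h
  rcases h with (((((h | h) | h) | h) | h) | h) | h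
  · exact .inl (key _ _ (by norm_num) h)
  · exact .inr (.inl (key 3 1 (by norm_num) (by simpa using h)))
  · exact .inr (.inr (.inl (key 7 1 (by norm_num) (by simpa using h))))
  · exact .inr (.inr (.inr (.inl (key _ _ (by norm_num) h))))
  · exact .inr (.inr (.inr (.inr (.inl (key 13 1 (by norm_num) (by simpa using h))))))
  · exact .inr (.inr (.inr (.inr (.inr (.inl (key _ _ (by norm_num) h))))))
  · exact .inr (.inr (.inr (.inr (.inr (.inr (key 139 1 (by norm_num) (by simpa using h)))))))

section Basic

variable {G : Type*} [Group G]

theorem mem_centralizer {x y : G} : y ∈ Subgroup.centralizer {x} ↔ Commute x y := by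
  rw [Subgroup.mem_centralizer_singleton_iff]
  exact eq_comm

theorem centralizer_zpowers (x : G) :
    Subgroup.centralizer (Subgroup.zpowers x : Set G) = Subgroup.centralizer {x} := by
  rw [Subgroup.zpowers_eq_closure, Subgroup.centralizer_closure]

theorem mem_cases_of_mem_nbrs (hG : ODPattern G) {p q : ℕ} (h : q ∈ nbrs G p) :
    q = 2 ∨ q = 3 ∨ q = 7 ∨ q = 11 ∨ q = 13 ∨ q = 43 ∨ q = 139 := by
  obtain ⟨-, -, hq, g, hg⟩ := h
  refine prime_cases hq ?_
  rw [← hG.card]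
  exact (Dvd.intro_left _ hg.symm).trans (orderOf_dvd_natCard g)

theorem orderOf_pow_of_mul {g : G} {p q : ℕ} (hq : 0 < q) (hg : orderOf g = p * q) :
    orderOf (g ^ q) = p := by
  rw [orderOf_pow_of_dvd hq.ne' (by rw [hg]; exact dvd_mul_left _ _), hg, Nat.mul_div_cancel _ hq]


theorem dvd_centralizer_of_mem_nbrs {p q : ℕ} (h : q ∈ nbrs G p) :
    ∃ g : G, orderOf g = p * q ∧ orderOf (g ^ q) = p ∧
      p * q ∣ Nat.card (Subgroup.centralizer {g ^ q}) := by
  obtain ⟨-, -, hq, g, hg⟩ := h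
  refine ⟨g, hg, orderOf_pow_of_mul hq.pos hg, ?_⟩
  rw [← hg, ← Nat.card_zpowers]
  refine Subgroup.card_dvd_of_le ?_
  rw [Subgroup.zpowers_le, mem_centralizer]
  exact (Commute.refl g).pow_left q

variable [Finite G]

theorem mem_nbrs_of_dvd_centralizer {x : G} {p q : ℕ} (hp : p.Prime) (hq : q.Prime) (hpq : p ≠ q)
    (hx : orderOf x = p) (h : q ∣ Nat.card (Subgroup.centralizer {x})) : q ∈ nbrs G p := by
  have := Fact.mk hq
  obtain ⟨y, hy⟩ := exists_prime_orderOf_dvd_card' q h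
  have hc : Commute x (y : G) := mem_centralizer.1 y.2
  refine ⟨hpq, hp, hq, x * y, ?_⟩
  have hy' : orderOf (y : G) = q := by rw [← hy]; exact Subgroup.orderOf_coe y
  rw [hc.orderOf_mul_eq_mul_orderOf_of_coprime, hx, hy']
  rw [hx, hy']
  exact (Nat.coprime_primes hp hq).2 hpq

theorem card_normalizer_dvd (x : G) {p : ℕ} [hp : Fact p.Prime] (hx : orderOf x = p) :
    ∃ e, e ∣ p - 1 ∧ Nat.card (Subgroup.normalizer (Subgroup.zpowers x : Set G)) =
      Nat.card (Subgroup.centralizer {x}) * e := by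
  have key := Subgroup.card_dvd_of_injective _
    (QuotientGroup.kerLift_injective (Subgroup.zpowers x).normalizerMonoidHom)
  refine ⟨Nat.card (_ ⧸ (Subgroup.zpowers x).normalizerMonoidHom.ker), ?_,
    (Subgroup.card_eq_card_quotient_mul_card_subgroup
    (Subgroup.zpowers x).normalizerMonoidHom.ker).trans ?_⟩
  · rwa [IsCyclic.card_mulAut, Nat.card_zpowers, hx, Nat.totient_prime hp.out] at key
  · rw [mul_comm]
    congr 1
    rw [Subgroup.normalizerMonoidHom_ker, ← centralizer_zpowers]
    exact Nat.card_congr (Subgroup.subgroupOfEquivOfLe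
      (Subgroup.centralizer_le_normalizer _)).toEquiv

theorem card_sylow_zpowers (hG : ODPattern G) {x : G} (hx : orderOf x = 139) :
    Nat.card G / Nat.card (Subgroup.normalizer (Subgroup.zpowers x : Set G)) % 139 = 1 := by
  have : Fact (Nat.Prime 139) := ⟨by norm_num⟩
  have hc : Nat.card (Subgroup.zpowers x) = 139 := by rw [Nat.card_zpowers, hx]
  let P : Sylow 139 G := (IsPGroup.of_card (n := 1) (hc.trans (pow_one _).symm)).toSylow (by
    have := Subgroup.card_mul_index (Subgroup.zpowers x)
    rw [hc, hG.card] at this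
    omega)
  have h := card_sylow_modEq_one 139 G
  have h2 : Nat.card (Sylow 139 G) = (Subgroup.normalizer (Subgroup.zpowers x : Set G)).index :=
    P.card_eq_index_normalizer
  rw [← Subgroup.card_mul_index (Subgroup.normalizer (Subgroup.zpowers x : Set G)),
    Nat.mul_div_cancel_left _ Nat.card_pos, ← h2]
  exact h

set_option synthInstance.maxHeartbeats 400000 in
set_option synthInstance.maxSize 2000 in
theorem card_centralizer_139 (hG : ODPattern G) {x : G} (hx : orderOf x = 139) {q : ℕ}
    (hq : nbrs G 139 = {q}) (hdvd : 139 * q ∣ Nat.card (Subgroup.centralizer {x})) :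
    q = 13 ∧ Nat.card (Subgroup.centralizer {x}) = 1807 ∧
    Nat.card (Subgroup.normalizer (Subgroup.zpowers x : Set G)) = 5421 := by
  have : Fact (Nat.Prime 139) := ⟨by norm_num⟩
  have hS := card_sylow_zpowers hG hx
  have hN := Subgroup.card_subgroup_dvd_card (Subgroup.normalizer (Subgroup.zpowers x : Set G))
  have hC := Subgroup.card_subgroup_dvd_card (Subgroup.centralizer {x})
  obtain ⟨t, ht, hNt⟩ := card_normalizer_dvd x hx
  rw [hNt] at hS hN ⊢
  rw [hG.card] at hC hN hS
  have hr : ∀ r, r.Prime → r ≠ 139 → r ∣ Nat.card (Subgroup.centralizer {x}) → r = q := by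
    intro r hr h h'
    have := mem_nbrs_of_dvd_centralizer (by norm_num) hr h.symm hx h'
    rwa [hq] at this
  have hq139 : q ∈ nbrs G 139 := by rw [hq]; rfl
  obtain ⟨a, ha, b, hb, c, hc, d, hd, e, he, f, hf, g, hg, hE⟩ := exists_exponents hC
  rw [hE] at hr hN hS hdvd ⊢
  have ht' : t ∈ [1, 2, 3, 6, 23, 46, 69, 138] := by
    have : t ∈ Nat.divisors 138 := by simpa using ht
    revert this
    exact (by decide : ∀ u ∈ Nat.divisors 138, u ∈ [1, 2, 3, 6, 23, 46, 69, 138]) t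
  have h2 : q ≠ 2 → a = 0 := fun h => by
    by_contra h0
    refine h (hr 2 (by norm_num) (by norm_num) ?_).symm
    exact (((((((dvd_pow_self 2 h0)).mul_right _).mul_right _).mul_right _).mul_right _).mul_right _).mul_right _
  have h3 : q ≠ 3 → b = 0 := fun h => by
    by_contra h0
    refine h (hr 3 (by norm_num) (by norm_num) ?_).symm
    exact ((((((dvd_pow_self 3 h0).mul_left _).mul_right _).mul_right _).mul_right _).mul_right _).mul_right _
  have h7 : q ≠ 7 → c = 0 := fun h => by
    by_contra h0
    refine h (hr 7 (by norm_num) (by norm_num) ?_).symm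
    exact (((((dvd_pow_self 7 h0).mul_left _).mul_right _).mul_right _).mul_right _).mul_right _
  have h11 : q ≠ 11 → d = 0 := fun h => by
    by_contra h0
    refine h (hr 11 (by norm_num) (by norm_num) ?_).symm
    exact ((((dvd_pow_self 11 h0).mul_left _).mul_right _).mul_right _).mul_right _
  have h13 : q ≠ 13 → e = 0 := fun h => by
    by_contra h0
    refine h (hr 13 (by norm_num) (by norm_num) ?_).symm
    exact (((dvd_pow_self 13 h0).mul_left _).mul_right _).mul_right _
  have h43 : q ≠ 43 → f = 0 := fun h => by
    by_contra h0
    refine h (hr 43 (by norm_num) (by norm_num) ?_).symm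
    exact ((dvd_pow_self 43 h0).mul_left _).mul_right _
  have hqc := mem_cases_of_mem_nbrs hG hq139
  have hq9 : q ≠ 139 := hq139.1.symm
  clear hr hq hq139 hx hE hG hC hNt ht
  rcases hqc with rfl | rfl | rfl | rfl | rfl | rfl | rfl
  · obtain rfl := h3 (by decide); obtain rfl := h7 (by decide); obtain rfl := h11 (by decide)
    obtain rfl := h13 (by decide); obtain rfl := h43 (by decide)
    clear h2 h3 h7 h11 h13 h43
    revert hdvd hN hS; revert ht'; revert t; revert hg; revert g; revert ha; revert a; decide
  · obtain rfl := h2 (by decide); obtain rfl := h7 (by decide); obtain rfl := h11 (by decide)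
    obtain rfl := h13 (by decide); obtain rfl := h43 (by decide)
    clear h2 h3 h7 h11 h13 h43
    revert hdvd hN hS; revert ht'; revert t; revert hg; revert g; revert hb; revert b; decide
  · obtain rfl := h2 (by decide); obtain rfl := h3 (by decide); obtain rfl := h11 (by decide)
    obtain rfl := h13 (by decide); obtain rfl := h43 (by decide)
    clear h2 h3 h7 h11 h13 h43
    revert hdvd hN hS; revert ht'; revert t; revert hg; revert g; revert hc; revert c; decide
  · obtain rfl := h2 (by decide); obtain rfl := h3 (by decide); obtain rfl := h7 (by decide)
    obtain rfl := h13 (by decide); obtain rfl := h43 (by decide)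
    clear h2 h3 h7 h11 h13 h43
    revert hdvd hN hS; revert ht'; revert t; revert hg; revert g; revert hd; revert d; decide
  · obtain rfl := h2 (by decide); obtain rfl := h3 (by decide); obtain rfl := h7 (by decide)
    obtain rfl := h11 (by decide); obtain rfl := h43 (by decide)
    clear h2 h3 h7 h11 h13 h43
    revert hdvd hN hS; revert ht'; revert t; revert hg; revert g; revert he; revert e; decide
  · obtain rfl := h2 (by decide); obtain rfl := h3 (by decide); obtain rfl := h7 (by decide)
    obtain rfl := h11 (by decide); obtain rfl := h13 (by decide)
    clear h2 h3 h7 h11 h13 h43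
    revert hdvd hN hS; revert ht'; revert t; revert hg; revert g; revert hf; revert f; decide
  · exact absurd rfl hq9

theorem exists_torus (hG : ODPattern G) : ∃ g : G, orderOf g = 1807 ∧
    Subgroup.centralizer {g ^ 13} = Subgroup.zpowers g ∧
    Nat.card (Subgroup.normalizer (Subgroup.zpowers (g ^ 13) : Set G)) = 5421 ∧
    nbrs G 139 = {13} := by
  obtain ⟨q, hq⟩ := Set.ncard_eq_one.1 ((gkDegree_eq G 139).symm.trans hG.deg139)
  have hq9 : q ∈ nbrs G 139 := by rw [hq]; rfl
  obtain ⟨g, hg, hx, hd⟩ := dvd_centralizer_of_mem_nbrs hq9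
  obtain ⟨rfl, hC, hN⟩ := card_centralizer_139 hG hx hq hd
  refine ⟨g, hg, ?_, hN, hq⟩
  refine (Subgroup.eq_of_le_of_card_ge ?_ ?_).symm
  · rw [Subgroup.zpowers_le, mem_centralizer]
    exact (Commute.refl g).pow_left _
  · rw [hC, Nat.card_zpowers, hg]

theorem nbrs_139 (hG : ODPattern G) : nbrs G 139 = {13} := by
  obtain ⟨-, -, -, -, h⟩ := exists_torus hG
  exact h

theorem nbrs_13 (hG : ODPattern G) : nbrs G 13 = {139} := by
  obtain ⟨q, hq⟩ := Set.ncard_eq_one.1 ((gkDegree_eq G 13).symm.trans hG.deg13)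
  have : 139 ∈ nbrs G 13 := nbrs_symm (by rw [nbrs_139 hG]; rfl)
  rw [hq] at this ⊢
  rw [this]

theorem mem_cases_of_mem_nbrs' (hG : ODPattern G) {p q : ℕ} (h : q ∈ nbrs G p) (h13 : p ≠ 13)
    (h139 : p ≠ 139) : q = 2 ∨ q = 3 ∨ q = 7 ∨ q = 11 ∨ q = 43 := by
  rcases mem_cases_of_mem_nbrs hG h with rfl | rfl | rfl | rfl | rfl | rfl | rfl <;> try simp
  · have := nbrs_symm h
    rw [nbrs_13 hG] at this
    exact h139 this
  · have := nbrs_symm h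
    rw [nbrs_139 hG] at this
    exact h13 this

theorem nbrs_2 (hG : ODPattern G) : nbrs G 2 = {3, 7, 11, 43} := by
  refine Set.eq_of_subset_of_ncard_le (fun q hq => ?_) ?_ (Set.toFinite _)
  · have := mem_cases_of_mem_nbrs' hG hq (by norm_num) (by norm_num)
    have h2 := hq.1
    simp only [Set.mem_insert_iff, Set.mem_singleton_iff]
    omega
  · rw [← gkDegree_eq, hG.deg2]
    rw [show ({3, 7, 11, 43} : Set ℕ) = (({3, 7, 11, 43} : Finset ℕ) : Set ℕ) by simp,
      Set.ncard_coe_finset]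
    decide

theorem nbrs_11 (hG : ODPattern G) : nbrs G 11 = {2, 3, 7, 43} := by
  refine Set.eq_of_subset_of_ncard_le (fun q hq => ?_) ?_ (Set.toFinite _)
  · have := mem_cases_of_mem_nbrs' hG hq (by norm_num) (by norm_num)
    have h2 := hq.1
    simp only [Set.mem_insert_iff, Set.mem_singleton_iff]
    omega
  · rw [← gkDegree_eq, hG.deg11]
    rw [show ({2, 3, 7, 43} : Set ℕ) = (({2, 3, 7, 43} : Finset ℕ) : Set ℕ) by simp,
      Set.ncard_coe_finset]
    decide

theorem nbrs_43 (hG : ODPattern G) : nbrs G 43 = {2, 11} := by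
  have hfin : (nbrs G 43).Finite := Set.finite_of_ncard_ne_zero (by
    rw [← gkDegree_eq, hG.deg43]; norm_num)
  refine (Set.eq_of_subset_of_ncard_le ?_ ?_ hfin).symm
  · rintro q (rfl | rfl)
    · exact nbrs_symm (by rw [nbrs_2 hG]; simp)
    · exact nbrs_symm (by rw [nbrs_11 hG]; simp)
  · rw [← gkDegree_eq, hG.deg43, Set.ncard_pair (by norm_num)]

end Basic
end U343

namespace U343

/-- A self-centralizing abelian subgroup of order `1807 = 13 * 139` with normalizer of index `3`
over it. -/
structure IsTorus {G : Type*} [Group G] (A : Subgroup G) : Prop where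
  card : Nat.card A = 1807
  comm : ∀ a ∈ A, ∀ b ∈ A, Commute a b
  cent : ∀ a ∈ A, a ≠ 1 → Subgroup.centralizer {a} = A
  card_normalizer : Nat.card (Subgroup.normalizer (A : Set G)) = 5421

section

variable {G : Type*} [Group G] [Finite G]

theorem card_centralizer_13 (hG : ODPattern G) {x : G} (hx : orderOf x = 13) :
    Nat.card (Subgroup.centralizer {x}) ∣ 1807 := by
  have hC := Subgroup.card_subgroup_dvd_card (Subgroup.centralizer {x})
  rw [hG.card] at hC
  have hr : ∀ r, r.Prime → r ≠ 13 → r ∣ Nat.card (Subgroup.centralizer {x}) → r = 139 := by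
    intro r hr h h'
    have := mem_nbrs_of_dvd_centralizer (by norm_num) hr h.symm hx h'
    rwa [nbrs_13 hG] at this
  obtain ⟨a, ha, b, hb, c, hc, d, hd, e, he, f, hf, g, hg, hE⟩ := exists_exponents hC
  rw [hE] at hr ⊢
  have h2 : a = 0 := by
    by_contra h0
    refine absurd (hr 2 (by norm_num) (by norm_num) ?_) (by norm_num)
    exact ((((((dvd_pow_self 2 h0).mul_right _).mul_right _).mul_right _).mul_right _).mul_right _).mul_right _
  have h3 : b = 0 := by
    by_contra h0
    refine absurd (hr 3 (by norm_num) (by norm_num) ?_) (by norm_num)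
    exact ((((((dvd_pow_self 3 h0).mul_left _).mul_right _).mul_right _).mul_right _).mul_right _).mul_right _
  have h7 : c = 0 := by
    by_contra h0
    refine absurd (hr 7 (by norm_num) (by norm_num) ?_) (by norm_num)
    exact (((((dvd_pow_self 7 h0).mul_left _).mul_right _).mul_right _).mul_right _).mul_right _
  have h11 : d = 0 := by
    by_contra h0
    refine absurd (hr 11 (by norm_num) (by norm_num) ?_) (by norm_num)
    exact ((((dvd_pow_self 11 h0).mul_left _).mul_right _).mul_right _).mul_right _
  have h43 : f = 0 := by
    by_contra h0
    refine absurd (hr 43 (by norm_num) (by norm_num) ?_) (by norm_num)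
    exact ((dvd_pow_self 43 h0).mul_left _).mul_right _
  subst h2 h3 h7 h11 h43
  interval_cases e <;> interval_cases g <;> norm_num

theorem mem_zpowers_of_pow {g : G} {y : G} {m k : ℕ} (hg : orderOf g = m * k)
    (hm : 0 < m) (hy : y ∈ Subgroup.zpowers g) (h : y ^ m = 1) : y ∈ Subgroup.zpowers (g ^ k) := by
  obtain ⟨j, rfl⟩ := mem_powers_iff_mem_zpowers.2 hy
  simp only at h
  obtain ⟨l, rfl⟩ : k ∣ j := by
    have : orderOf g ∣ j * m := orderOf_dvd_of_pow_eq_one (by rw [pow_mul]; exact h)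
    rw [hg, mul_comm j] at this
    exact Nat.dvd_of_mul_dvd_mul_left hm this
  exact ⟨l, by simp [pow_mul]⟩

omit [Finite G] in
theorem conj_mem_of_mem_normalizer {K : Subgroup G} {x a : G}
    (hx : x ∈ Subgroup.normalizer (K : Set G)) (ha : a ∈ K) : x * a * x⁻¹ ∈ K :=
  (Subgroup.mem_normalizer_iff.1 hx a).1 ha

theorem exists_isTorus (hG : ODPattern G) : ∃ A : Subgroup G, IsTorus A := by
  obtain ⟨g, hg, hC, hN, -⟩ := exists_torus hG
  have h139 : orderOf (g ^ 13) = 139 := orderOf_pow_of_mul (by norm_num) hg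
  have comm : ∀ a ∈ Subgroup.zpowers g, ∀ b ∈ Subgroup.zpowers g, Commute a b := by
    rintro _ ⟨m, rfl⟩ _ ⟨n, rfl⟩
    exact (Commute.refl g).zpow_zpow m n
  have hle : ∀ a ∈ Subgroup.zpowers g, Subgroup.zpowers g ≤ Subgroup.centralizer {a} :=
    fun a ha b hb => mem_centralizer.2 (comm a ha b hb)
  have cent139 : ∀ a ∈ Subgroup.zpowers g, orderOf a = 139 →
      Subgroup.centralizer {a} = Subgroup.zpowers g := by
    intro a ha h
    have h1 : a ∈ Subgroup.zpowers (g ^ 13) :=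
      mem_zpowers_of_pow (m := 139) (k := 13) hg (by norm_num) ha (by rw [← h]; exact pow_orderOf_eq_one a)
    have h2 : Subgroup.zpowers a = Subgroup.zpowers (g ^ 13) :=
      Subgroup.eq_of_le_of_card_ge (Subgroup.zpowers_le.2 h1)
        (by rw [Nat.card_zpowers, Nat.card_zpowers, h, h139])
    rw [← centralizer_zpowers, h2, centralizer_zpowers, hC]
  have cent13 : ∀ a ∈ Subgroup.zpowers g, orderOf a = 13 →
      Subgroup.centralizer {a} = Subgroup.zpowers g := by
    intro a ha h
    refine (Subgroup.eq_of_le_of_card_ge (hle a ha) ?_).symm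
    rw [Nat.card_zpowers, hg]
    exact Nat.le_of_dvd (by norm_num) (card_centralizer_13 hG h)
  refine ⟨Subgroup.zpowers g, by rw [Nat.card_zpowers, hg], comm, ?_, ?_⟩
  · intro a ha h1
    refine le_antisymm ?_ (hle a ha)
    have hne : orderOf a ≠ 1 := by rwa [Ne, orderOf_eq_one_iff]
    obtain ⟨p, hp, hpa⟩ := Nat.exists_prime_and_dvd hne
    have hb : orderOf (a ^ (orderOf a / p)) = p :=
      orderOf_pow_orderOf_div (orderOf_pos a).ne' hpa
    have hbA := Subgroup.pow_mem _ ha (orderOf a / p)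
    have hp13 : p = 13 ∨ p = 139 := by
      have h1 : p ∣ 13 * 139 := by
        have := Subgroup.orderOf_dvd_natCard _ ha
        rw [Nat.card_zpowers, hg] at this
        exact hpa.trans this
      rcases hp.dvd_mul.1 h1 with h | h
      · exact .inl ((Nat.prime_dvd_prime_iff_eq hp (by norm_num)).1 h)
      · exact .inr ((Nat.prime_dvd_prime_iff_eq hp (by norm_num)).1 h)
    have hcb : Subgroup.centralizer {a ^ (orderOf a / p)} = Subgroup.zpowers g := by
      rcases hp13 with rfl | rfl
      · exact cent13 _ hbA hb
      · exact cent139 _ hbA hb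
    rw [← hcb]
    intro x hx
    rw [mem_centralizer] at hx ⊢
    exact hx.pow_left _
  · rw [← hN]
    congr 2
    refine le_antisymm (fun x hx => ?_) (fun x hx => ?_)
    · refine Subgroup.mem_normalizer_fintype fun h hh => ?_
      have hh' : h ∈ Subgroup.zpowers g :=
        (Subgroup.zpowers_le.2 (Subgroup.npow_mem_zpowers g 13)) hh
      refine mem_zpowers_of_pow (m := 139) (k := 13) hg (by norm_num) ((conj_mem_of_mem_normalizer hx) hh') ?_
      rw [conj_pow]
      have : h ^ 139 = 1 := by
        rw [← h139, ← Nat.card_zpowers]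
        exact congrArg Subtype.val (pow_card_eq_one' (x := (⟨h, hh⟩ : Subgroup.zpowers (g ^ 13))))
      rw [this]; group
    · refine Subgroup.mem_normalizer_fintype fun h hh => ?_
      rw [SetLike.mem_coe, ← hC, mem_centralizer] at hh ⊢
      obtain ⟨j, hj⟩ := conj_mem_of_mem_normalizer (inv_mem hx) (Subgroup.mem_zpowers (g ^ 13))
      have h1 : Commute (x⁻¹ * g ^ 13 * x⁻¹⁻¹) h := by
        rw [← hj]
        exact hh.zpow_left j
      have h2 := congrArg (fun y => x * y * x⁻¹) h1.eq
      simp only [Commute, SemiconjBy] at h2 ⊢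
      group at h2 ⊢
      exact h2

namespace IsTorus

variable {A : Subgroup G} (hA : IsTorus A)

include hA

theorem mem_normalizer_of_conj {a x : G} (ha : a ∈ A) (h1 : a ≠ 1) (hx : x * a * x⁻¹ ∈ A) :
    x ∈ Subgroup.normalizer (A : Set G) := by
  refine Subgroup.mem_normalizer_fintype fun b hb => ?_
  have h1' : x * a * x⁻¹ ≠ 1 := by rwa [Ne, conj_eq_one_iff]
  rw [SetLike.mem_coe, ← hA.cent _ hx h1', mem_centralizer]
  have := hA.comm a ha b hb
  have h2 := congrArg (fun y => x * y * x⁻¹) this.eq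
  simp only [Commute, SemiconjBy] at h2 ⊢
  group at h2 ⊢
  exact h2

omit [Finite G] in
theorem mem_of_commute {a x : G} (ha : a ∈ A) (h1 : a ≠ 1) (hx : Commute a x) : x ∈ A := by
  rw [← hA.cent a ha h1, mem_centralizer]
  exact hx

theorem exists_commutator {x : G} (hx : x ∈ Subgroup.normalizer (A : Set G)) (hxA : x ∉ A) {b : G}
    (hb : b ∈ A) : ∃ a ∈ A, b = x * a * x⁻¹ * a⁻¹ := by
  have hf : ∀ a : A, x * a * x⁻¹ * (a : G)⁻¹ ∈ A := fun a =>
    A.mul_mem (conj_mem_of_mem_normalizer hx a.2) (A.inv_mem a.2)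
  have hinj : Function.Injective fun a : A => (⟨_, hf a⟩ : A) := by
    intro a a' h
    have h' : x * a * x⁻¹ * (a : G)⁻¹ = x * a' * x⁻¹ * (a' : G)⁻¹ := congrArg Subtype.val h
    by_contra hne
    refine hxA (hA.mem_of_commute (a := (a'⁻¹ * a : G)) (A.mul_mem (A.inv_mem a'.2) a.2) ?_ ?_)
    · intro h0
      exact hne (Subtype.ext (inv_mul_eq_one.1 h0).symm)
    · have h3 : (x * ((a' : G)⁻¹ * a) * x⁻¹ : G) = (a' : G)⁻¹ * a := by
        have : (x * a * x⁻¹ : G) = x * a' * x⁻¹ * (a' : G)⁻¹ * a := by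
          rw [← h']; group
        calc (x * ((a' : G)⁻¹ * a) * x⁻¹ : G) = (x * a' * x⁻¹)⁻¹ * (x * a * x⁻¹) := by group
          _ = (a' : G)⁻¹ * a := by rw [this]; group
      exact (mul_inv_eq_iff_eq_mul.1 h3).symm
  obtain ⟨a, ha⟩ := (Finite.injective_iff_surjective.1 hinj) ⟨b, hb⟩
  exact ⟨a, a.2, (congrArg Subtype.val ha).symm⟩

omit [Finite G] in
theorem pow_three_mem {x : G} (hx : x ∈ Subgroup.normalizer (A : Set G)) : x ^ 3 ∈ A := by
  have h := Subgroup.card_mul_index (A.subgroupOf (Subgroup.normalizer (A : Set G)))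
  rw [hA.card_normalizer, Nat.card_congr
    (Subgroup.subgroupOfEquivOfLe Subgroup.le_normalizer).toEquiv, hA.card] at h
  have h3 : (A.subgroupOf (Subgroup.normalizer (A : Set G))).index = 3 := by omega
  have := Subgroup.pow_index_mem (A.subgroupOf (Subgroup.normalizer (A : Set G))) ⟨x, hx⟩
  rw [h3] at this
  exact this

end IsTorus

end

end U343

namespace U343

open WedderburnChar

variable {k : Type*} [Field k]

section Twist

variable {G : Type*} [Group G] {A : Subgroup G}

/-- The conjugate of a linear character of `A` by an element of the normalizer of `A`. -/
noncomputable def twist (l : A →* kˣ) (x : Subgroup.normalizer (A : Set G)) : A →* kˣ :=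
  l.comp (A.normalizerMonoidHom x).toMonoidHom

theorem twist_apply (l : A →* kˣ) (x : Subgroup.normalizer (A : Set G)) (a : A) :
    twist l x a = l ⟨x * a * (x : G)⁻¹, conj_mem_of_mem_normalizer x.2 a.2⟩ := rfl

theorem twist_mul (l : A →* kˣ) (x y : Subgroup.normalizer (A : Set G)) :
    twist l (x * y) = twist (twist l x) y := by
  simp only [twist, map_mul]
  rfl

theorem twist_one (l : A →* kˣ) : twist l 1 = l := by
  simp only [twist, map_one]
  rfl

theorem twist_ne_one {l : A →* kˣ} (h : l ≠ 1) (x : Subgroup.normalizer (A : Set G)) :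
    twist l x ≠ 1 := by
  intro h1
  apply h
  have : twist (twist l x) x⁻¹ = 1 := by rw [h1]; rfl
  rwa [← twist_mul, mul_inv_cancel, twist_one] at this

variable [Finite G] (hA : IsTorus A)

include hA

theorem twist_eq_self_iff {l : A →* kˣ} (h : l ≠ 1) (x : Subgroup.normalizer (A : Set G)) :
    twist l x = l ↔ (x : G) ∈ A := by
  constructor
  · intro hx
    by_contra hxA
    apply h
    ext b
    obtain ⟨a, ha, hb⟩ := hA.exists_commutator x.2 hxA b.2
    have h1 := DFunLike.congr_fun hx ⟨a, ha⟩
    rw [twist_apply] at h1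
    have : b = (⟨x * a * (x : G)⁻¹, conj_mem_of_mem_normalizer x.2 ha⟩ : A) * ⟨a, ha⟩⁻¹ :=
      Subtype.ext hb
    rw [this, map_mul, h1, map_inv, mul_inv_cancel]
    rfl
  · intro hx
    ext a
    rw [twist_apply]
    congr 3
    rw [(hA.comm _ hx _ a.2).eq, mul_inv_cancel_right]

open Classical in
theorem card_twist_eq [Fintype (Subgroup.normalizer (A : Set G))]
    {l m : A →* kˣ} (h : l ≠ 1) :
    (Finset.univ.filter fun x => twist l x = m).card =
      if ∃ x, twist l x = m then 1807 else 0 := by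
  classical
  have h1 : (Finset.univ.filter fun x => twist l x = l).card = 1807 := by
    rw [← hA.card, ← Nat.card_congr (Subgroup.subgroupOfEquivOfLe
      (Subgroup.le_normalizer (H := A))).toEquiv, ← Fintype.card_subtype, Nat.card_eq_fintype_card]
    refine Fintype.card_congr (Equiv.subtypeEquivRight fun x => ?_)
    rw [twist_eq_self_iff hA h]
    rfl
  split_ifs with hx
  · obtain ⟨y, rfl⟩ := hx
    rw [← h1]
    refine Finset.card_bij (fun x _ => x * y⁻¹) ?_ ?_ ?_
    · intro x hx
      simp only [Finset.mem_filter, Finset.mem_univ, true_and] at hx ⊢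
      rw [twist_mul, hx, ← twist_mul, mul_inv_cancel, twist_one]
    · intro x _ x' _ hxx
      exact mul_right_cancel hxx
    · intro x hx
      simp only [Finset.mem_filter, Finset.mem_univ, true_and] at hx
      refine ⟨x * y, ?_, mul_inv_cancel_right x y⟩
      simp only [Finset.mem_filter, Finset.mem_univ, true_and]
      rw [twist_mul, hx]
  · rw [Finset.card_eq_zero, Finset.filter_eq_empty_iff]
    exact fun x _ h => hx ⟨x, h⟩

end Twist

section Sums

theorem sum_apply_of_ne_one {A : Type*} [Group A] [Fintype A] {l : A →* kˣ} (h : l ≠ 1) :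
    ∑ a, ((l a : kˣ) : k) = 0 := by
  refine sum_hom_units_eq_zero ((Units.coeHom k).comp l) fun h1 => h ?_
  ext a
  exact DFunLike.congr_fun h1 a

open Classical in
theorem sum_one_sub_mul {A : Type*} [Group A] [Fintype A]
    {l m : A →* kˣ} (hl : l ≠ 1) (hm : m ≠ 1) :
    ∑ a, (1 - ((l a : kˣ) : k)) * (1 - ((m a⁻¹ : kˣ) : k)) =
      Fintype.card A * (1 + if l = m then 1 else 0) := by
  have h1 : ∑ a, ((m a⁻¹ : kˣ) : k) = 0 := by
    rw [← sum_apply_of_ne_one hm]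
    exact Fintype.sum_equiv (Equiv.inv A) _ _ fun a => rfl
  have h2 : ∑ a, ((l a : kˣ) : k) * ((m a⁻¹ : kˣ) : k) = Fintype.card A * if l = m then 1 else 0 := by
    split_ifs with h
    · subst h
      simp
    · rw [mul_zero, ← sum_apply_of_ne_one (l := l * m⁻¹) (fun h' => h (mul_inv_eq_one.1 h'))]
      exact Finset.sum_congr rfl fun a _ => by simp
  simp only [sub_mul, mul_sub, one_mul, mul_one, Finset.sum_sub_distrib, h1, h2,
    sum_apply_of_ne_one hl]
  simp only [Finset.sum_const, Finset.card_univ, nsmul_eq_mul]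
  ring

end Sums

section Exceptional

variable {G : Type*} [Group G] [Fintype G] {n : ℕ} {d : Fin n → ℕ}
  (Φ : MonoidAlgebra k G ≃ₐ[k] ∀ i, Matrix (Fin (d i)) (Fin (d i)) k)
  {A : Subgroup G} [Fintype A]

/-- `∑ a, χᵢ(a) (1 - l(a)⁻¹)`, which is `|A|` times the multiplicity of `χᵢ` in the character
of `G` induced from `1 - l`. -/
noncomputable def indCoeff (i : Fin n) (l : A →* kˣ) : k :=
  ∑ a : A, chr Φ i a * (1 - ((l a⁻¹ : kˣ) : k))

theorem sum_indCoeff_mul_chr (l : A →* kˣ) [CharZero k] [IsAlgClosed k] [∀ i, NeZero (d i)] {g : G}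
    (hg : ∀ a ∈ A, a ≠ 1 → ¬ IsConj g a) : ∑ i, indCoeff Φ i l * chr Φ i g = 0 := by
  simp only [indCoeff, Finset.sum_mul]
  rw [Finset.sum_comm]
  refine Finset.sum_eq_zero fun a _ => ?_
  by_cases h1 : a = 1
  · simp [h1]
  · have := sum_chr_eq_zero Φ (g := g) (h := (a : G)⁻¹) (hg _ (A.inv_mem a.2) (by simpa using h1))
    rw [inv_inv] at this
    calc _ = (1 - ((l a⁻¹ : kˣ) : k)) * ∑ i, chr Φ i g * chr Φ i a := by
          rw [Finset.mul_sum]; exact Finset.sum_congr rfl fun i _ => by ring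
      _ = 0 := by rw [this, mul_zero]

open Classical in
theorem sum_indCoeff_mul_indCoeff (hA : IsTorus A)
    {l m : A →* kˣ} (hl : l ≠ 1) (hm : m ≠ 1) :
    ∑ i, indCoeff Φ i l * indCoeff Φ i m =
      1807 * (5421 + if ∃ x, twist l x = m then 1807 else 0) := by
  have := Fintype.ofFinite (Subgroup.normalizer (A : Set G))
  have hcA : Fintype.card A = 1807 := by rw [← hA.card, Nat.card_eq_fintype_card]
  have hcN : Fintype.card (Subgroup.normalizer (A : Set G)) = 5421 := by
    rw [← hA.card_normalizer, Nat.card_eq_fintype_card]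
  have key : ∀ x : Subgroup.normalizer (A : Set G),
      ∑ b : A, ∑ a : A, (if (a : G) * x * b = x then
        (1 - ((l a⁻¹ : kˣ) : k)) * (1 - ((m b⁻¹ : kˣ) : k)) else 0) =
      1807 * (1 + if twist l x = m then 1 else 0) := by
    intro x
    have h1 := sum_one_sub_mul (twist_ne_one hl x) hm
    rw [hcA] at h1
    refine (Finset.sum_congr rfl fun b _ => ?_).trans h1
    have h2 : ∀ a : A, (a : G) * x * b = x ↔
        a = (⟨x * b * (x : G)⁻¹, conj_mem_of_mem_normalizer x.2 b.2⟩ : A)⁻¹ := by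
      intro a
      rw [Subtype.ext_iff, InvMemClass.coe_inv]
      simp only [mul_inv_rev, inv_inv]
      rw [← mul_assoc, eq_mul_inv_iff_mul_eq, eq_mul_inv_iff_mul_eq]
    simp only [h2, Finset.sum_ite_eq', Finset.mem_univ, if_true, inv_inv, twist_apply]
  have key0 : ∀ x : G, x ∉ Subgroup.normalizer (A : Set G) →
      ∑ b : A, ∑ a : A, (if (a : G) * x * b = x then
        (1 - ((l a⁻¹ : kˣ) : k)) * (1 - ((m b⁻¹ : kˣ) : k)) else 0) = 0 := by
    intro x hx
    refine Finset.sum_eq_zero fun b _ => Finset.sum_eq_zero fun a _ => ?_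
    split_ifs with h
    · by_cases hb : b = 1
      · simp [hb]
      · refine absurd (hA.mem_normalizer_of_conj b.2 (by simpa using hb) ?_) hx
        have : x * b * x⁻¹ = (a : G)⁻¹ := by
          rw [← mul_eq_one_iff_eq_inv', mul_assoc, ← mul_assoc, ← mul_assoc, h, mul_inv_cancel]
        rw [this]
        exact A.inv_mem a.2
    · rfl
  calc _ = ∑ x : G, ∑ b : A, ∑ a : A, (if (a : G) * x * b = x then
        (1 - ((l a⁻¹ : kˣ) : k)) * (1 - ((m b⁻¹ : kˣ) : k)) else 0) := by
        have h4 : ∀ a b : A, ∑ i, chr Φ i a * (1 - ((l a⁻¹ : kˣ) : k)) *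
            (chr Φ i b * (1 - ((m b⁻¹ : kˣ) : k))) = ∑ x : G, (if (a : G) * x * b = x then
            (1 - ((l a⁻¹ : kˣ) : k)) * (1 - ((m b⁻¹ : kˣ) : k)) else 0) := fun a b => by
          have h5 := sum_chr_mul_chr Φ (a : G) (b : G)
          rw [← Finset.sum_filter, Finset.sum_const, nsmul_eq_mul, ← h5, Finset.sum_mul]
          exact Finset.sum_congr rfl fun i _ => by ring
        simp only [indCoeff, Finset.sum_mul_sum]
        rw [Finset.sum_comm]
        conv_rhs => rw [Finset.sum_comm]
        rw [Finset.sum_congr rfl fun a _ => Finset.sum_comm]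
        conv_rhs => rw [Finset.sum_congr rfl fun a _ => Finset.sum_comm]
        simp only [h4]
        exact Finset.sum_comm
    _ = ∑ x : Subgroup.normalizer (A : Set G), ∑ b : A, ∑ a : A, (if (a : G) * x * b = x then
        (1 - ((l a⁻¹ : kˣ) : k)) * (1 - ((m b⁻¹ : kˣ) : k)) else 0) := by
        rw [← Finset.sum_subset (Finset.subset_univ
          (Finset.univ.filter (· ∈ Subgroup.normalizer (A : Set G)))) fun x _ hx => key0 x (by
            simpa using hx)]
        exact Finset.sum_subtype _ (by simp) _
    _ = _ := by
      have h3 : ∑ x : Subgroup.normalizer (A : Set G), (if twist l x = m then (1 : k) else 0) =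
          ((if ∃ x, twist l x = m then 1807 else 0 : ℕ) : k) := by
        rw [Finset.sum_boole]
        convert congrArg (Nat.cast : ℕ → k) (card_twist_eq (m := m) hA hl)
      rw [Finset.sum_congr rfl fun x _ => key x, ← Finset.mul_sum, Finset.sum_add_distrib, h3]
      simp only [Finset.sum_const, Finset.card_univ, hcN]
      split_ifs <;> norm_num

end Exceptional

end U343

namespace U343

open WedderburnChar

variable {k : Type*} [Field k] [CharZero k] [IsAlgClosed k]

section

theorem card_characters {A : Type*} [Group A] [Finite A] (hA : ∀ a b : A, a * b = b * a) :
    Nat.card (A →* kˣ) = Nat.card A := by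
  let _ : CommGroup A := { (inferInstance : Group A) with mul_comm := hA }
  exact CommGroup.card_monoidHom_of_hasEnoughRootsOfUnity A k

theorem exists_int_mult {A : Type*} [Group A] [Fintype A] [Fintype (A →* kˣ)]
    (hA : ∀ a b : A, a * b = b * a) {d : ℕ} (F : A →* Matrix (Fin d) (Fin d) k) :
    ∃ v : (A →* kˣ) → ℤ, (∀ l, ∑ a, (F a).trace * (1 - ((l a⁻¹ : kˣ) : k)) =
      (Fintype.card A : k) * v l) ∧ (Fintype.card A : ℤ) ∣ d + ∑ l, v l := by
  let _ : CommGroup A := { (inferInstance : Group A) with mul_comm := hA }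
  obtain ⟨m, h1, h2⟩ := exists_nat_mult F
  refine ⟨fun l => m 1 - m l, fun l => ?_, ?_⟩
  · have h3 := h2 1
    simp only [MonoidHom.one_apply, Units.val_one, one_mul] at h3
    simp only [mul_sub, mul_one, Finset.sum_sub_distrib, h3]
    push_cast
    rw [mul_sub, mul_comm, ← mul_comm (m l : k), ← h2 l]
    congr 1
    exact Finset.sum_congr rfl fun a _ => mul_comm _ _
  · have h3 := h1 1
    simp only [map_one, Matrix.trace_one, Units.val_one, mul_one, Fintype.card_fin] at h3
    have h4 : d = ∑ l, m l := by exact_mod_cast h3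
    rw [Finset.sum_sub_distrib, Finset.sum_const, Finset.card_univ,
      ← Nat.card_eq_fintype_card (α := A →* kˣ), card_characters hA, Nat.card_eq_fintype_card, h4]
    push_cast
    simp

end

section

variable {G : Type*} [Group G] [Fintype G] {n : ℕ} {d : Fin n → ℕ}
  (Φ : MonoidAlgebra k G ≃ₐ[k] ∀ i, Matrix (Fin (d i)) (Fin (d i)) k) [∀ i, NeZero (d i)]

omit [IsAlgClosed k] [Fintype G] in
theorem exists_trivial : ∃ i, d i = 1 ∧ ∀ g, chr Φ i g = 1 := by
  obtain ⟨c, hc⟩ := exists_nat_decomp Φ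
    (MonoidAlgebra.lift k (Matrix (Fin 1) (Fin 1) k) G 1)
  simp only [MonoidAlgebra.lift_of, MonoidHom.one_apply, Matrix.trace_one, Fintype.card_fin,
    Nat.cast_one] at hc
  have h1 := hc 1
  simp only [chr_one] at h1
  have h2 : ∑ i, c i * d i = 1 := by exact_mod_cast h1.symm
  obtain ⟨i, -, hi⟩ : ∃ i ∈ Finset.univ, c i * d i ≠ 0 := by
    by_contra! h
    rw [Finset.sum_eq_zero h] at h2
    exact absurd h2 (by norm_num)
  rw [← Finset.add_sum_erase _ _ (Finset.mem_univ i)] at h2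
  have h3 : c i * d i = 1 := by omega
  have h4 : ∀ j, j ≠ i → c j = 0 := by
    intro j hj
    have : ∑ x ∈ Finset.univ.erase i, c x * d x = 0 := by omega
    rw [Finset.sum_eq_zero_iff] at this
    have := this j (by simpa using hj)
    exact (mul_eq_zero.1 this).resolve_right (NeZero.ne _)
  refine ⟨i, Nat.eq_one_of_mul_eq_one_left h3, fun g => ?_⟩
  have h5 := hc g
  rw [Finset.sum_eq_single_of_mem i (Finset.mem_univ i) fun j _ hj => by simp [h4 j hj],
    Nat.eq_one_of_mul_eq_one_right h3] at h5
  simpa using h5.symm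

open Classical in
theorem exists_family {A : Subgroup G} (hA : IsTorus A) {i0 : Fin n} (hi0 : ∀ g, chr Φ i0 g = 1) :
    ∃ U : Finset (Fin n → ℤ), 602 ≤ U.card ∧ (∀ u ∈ U, u i0 = 1) ∧
      (∀ u ∈ U, ∀ v ∈ U, ∑ i, u i * v i = if u = v then 4 else 3) ∧
      (∀ u ∈ U, ∀ g : G, (∀ a ∈ A, a ≠ 1 → ¬ IsConj g a) → ∑ i, (u i : k) * chr Φ i g = 0) ∧
      ∀ i (c : ℤ), (∀ u ∈ U, u i = c) → (1807 : ℤ) ∣ d i - c := by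
  have := Fintype.ofFinite A
  have := Fintype.ofFinite (Subgroup.normalizer (A : Set G))
  have hcA : Fintype.card A = 1807 := by rw [← hA.card, Nat.card_eq_fintype_card]
  have hcN : Fintype.card (Subgroup.normalizer (A : Set G)) = 5421 := by
    rw [← hA.card_normalizer, Nat.card_eq_fintype_card]
  have hcomm : ∀ a b : A, a * b = b * a := fun a b => Subtype.ext (hA.comm _ a.2 _ b.2)
  have hL : Nat.card (A →* kˣ) = 1807 := by rw [card_characters hcomm, hA.card]
  have : Finite (A →* kˣ) := Nat.finite_of_card_ne_zero (by rw [hL]; norm_num)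
  have := Fintype.ofFinite (A →* kˣ)
  rw [Nat.card_eq_fintype_card] at hL
  choose w hw hd using fun i => exists_int_mult hcomm ((rep Φ i).comp A.subtype)
  have hw : ∀ i l, indCoeff Φ i l = 1807 * (w i l : k) := fun i l => by
    have := hw i l
    rw [hcA] at this
    exact this
  set v : (A →* kˣ) → Fin n → ℤ := fun l i => w i l with hv
  have hip : ∀ l m, l ≠ 1 → m ≠ 1 →
      ∑ i, v l i * v m i = if ∃ x, twist l x = m then 4 else 3 := by
    intro l m hl hm
    have h1 := sum_indCoeff_mul_indCoeff Φ hA hl hm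
    simp only [hw] at h1
    have h2 : (1807 * 1807 : k) * ((∑ i, v l i * v m i : ℤ) : k) =
        1807 * 1807 * ((if ∃ x, twist l x = m then 4 else 3 : ℤ) : k) := by
      push_cast
      rw [Finset.mul_sum]
      refine (Finset.sum_congr rfl fun i _ => ?_).trans (h1.trans ?_)
      · simp only [hv]; ring
      · split_ifs <;> norm_num
    exact_mod_cast mul_left_cancel₀ (by norm_num) h2
  have hself : ∀ l, l ≠ 1 → ∑ i, v l i * v l i = 4 := fun l hl => by
    rw [hip l l hl hl, if_pos ⟨1, twist_one l⟩]
  have hiff : ∀ l m, l ≠ 1 → m ≠ 1 → (v l = v m ↔ ∃ x, twist l x = m) := by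
    intro l m hl hm
    constructor
    · intro h
      by_contra h'
      have h1 := hip l m hl hm
      rw [if_neg h', ← h, hself l hl] at h1
      norm_num at h1
    · intro h
      have h1 := hip l m hl hm
      rw [if_pos h] at h1
      have h2 : ∑ i, (v l i - v m i) * (v l i - v m i) = 0 := by
        calc _ = ∑ i, v l i * v l i - 2 * ∑ i, v l i * v m i + ∑ i, v m i * v m i := by
              rw [Finset.mul_sum, ← Finset.sum_sub_distrib, ← Finset.sum_add_distrib]
              exact Finset.sum_congr rfl fun i _ => by ring
          _ = 0 := by rw [hself l hl, hself m hm, h1]; norm_num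
      rw [Finset.sum_eq_zero_iff_of_nonneg fun i _ => mul_self_nonneg _] at h2
      funext i
      have := h2 i (Finset.mem_univ i)
      exact sub_eq_zero.1 (mul_self_eq_zero.1 this)
  have hv1 : v 1 = 0 := by
    funext i
    have := hw i 1
    simp only [indCoeff, MonoidHom.one_apply, Units.val_one, sub_self, mul_zero,
      Finset.sum_const_zero] at this
    have := this.symm
    simpa [hv] using this
  set S : Finset (A →* kˣ) := Finset.univ.filter (· ≠ 1) with hS
  have hSc : S.card = 1806 := by
    rw [hS, Finset.filter_ne', Finset.card_erase_of_mem (Finset.mem_univ _), Finset.card_univ, hL]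
  refine ⟨S.image v, ?_, ?_, ?_, ?_, ?_⟩
  · have h1 : S.card ≤ 3 * (S.image v).card := by
      refine Finset.card_le_mul_card_image S 3 fun u hu => ?_
      obtain ⟨l, hl, rfl⟩ := Finset.mem_image.1 hu
      have hl1 : l ≠ 1 := by simpa [hS] using hl
      have h2 : ∀ m ∈ S.filter (fun m => v m = v l),
          1807 ≤ (Finset.univ.filter fun x => twist l x = m).card := by
        intro m hm
        simp only [hS, Finset.mem_filter, Finset.mem_univ, true_and] at hm
        have := card_twist_eq (m := m) hA hl1
        rw [if_pos ((hiff l m hl1 hm.1).1 hm.2.symm)] at this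
        refine le_of_eq ?_
        convert this.symm
      have h3 := Finset.card_nsmul_le_sum _ _ _ h2
      have h4 := Finset.card_eq_sum_card_fiberwise (f := fun x => twist l x)
        (s := (Finset.univ : Finset (Subgroup.normalizer (A : Set G))))
        (t := (Finset.univ : Finset (A →* kˣ))) (by simp)
      have h5 := h3.trans (Finset.sum_le_sum_of_subset (Finset.subset_univ _))
      rw [← h4, Finset.card_univ, hcN, smul_eq_mul] at h5
      omega
    omega
  · intro u hu
    obtain ⟨l, hl, rfl⟩ := Finset.mem_image.1 hu
    have hl0 : l ≠ 1 := by simpa [hS] using hl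
    have hl1 : l⁻¹ ≠ 1 := fun h => hl0 (by
      ext a
      have h2 := DFunLike.congr_fun h a
      rw [MonoidHom.inv_apply, MonoidHom.one_apply, inv_eq_one] at h2
      rw [h2, MonoidHom.one_apply])
    have h1 := hw i0 l
    simp only [indCoeff, hi0, one_mul, Finset.sum_sub_distrib] at h1
    have h2 := sum_apply_of_ne_one hl1
    simp only [MonoidHom.inv_apply, ← map_inv] at h2
    rw [h2, Finset.sum_const, Finset.card_univ, hcA] at h1
    have h3 : (1807 : k) * ((1 : ℤ) : k) = 1807 * (v l i0 : k) := by simpa using h1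
    exact_mod_cast (mul_left_cancel₀ (by norm_num) h3).symm
  · intro u hu u' hu'
    obtain ⟨l, hl, rfl⟩ := Finset.mem_image.1 hu
    obtain ⟨m, hm, rfl⟩ := Finset.mem_image.1 hu'
    have hl1 : l ≠ 1 := by simpa [hS] using hl
    have hm1 : m ≠ 1 := by simpa [hS] using hm
    rw [hip l m hl1 hm1]
    simp only [hiff l m hl1 hm1]
  · intro u hu g hg
    obtain ⟨l, hl, rfl⟩ := Finset.mem_image.1 hu
    have h1 := sum_indCoeff_mul_chr Φ l hg
    simp only [hw, mul_assoc] at h1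
    rw [← Finset.mul_sum] at h1
    exact (mul_eq_zero.1 h1).resolve_left (by norm_num)
  · intro i c hc
    have h1 := hd i
    have h2 : ∑ l, w i l = 1806 * c := by
      have h3 : ∑ l, w i l = ∑ l ∈ S, w i l := by
        symm
        refine Finset.sum_subset (Finset.subset_univ _) fun l _ hl => ?_
        have : l = 1 := by simpa [hS] using hl
        rw [this]
        exact congrFun hv1 i
      rw [h3, Finset.sum_congr rfl fun l hl => hc (v l) (Finset.mem_image_of_mem v hl),
        Finset.sum_const, hSc]
      simp
    rw [h2, hcA] at h1
    have h3 : (d i : ℤ) - c = (d i + 1806 * c) - 1807 * c := by ring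
    rw [h3]
    exact dvd_sub (by exact_mod_cast h1) (dvd_mul_right _ _)

end

end U343

namespace U343

section Combinatorics

theorem exists_common_pair {α : Type*} [DecidableEq α] {F : Finset (Finset α)} (hc : 5 ≤ F.card)
    (h3 : ∀ A ∈ F, A.card = 3) (h2 : ∀ A ∈ F, ∀ B ∈ F, A ≠ B → (A ∩ B).card = 2) :
    ∃ P : Finset α, P.card = 2 ∧ ∀ A ∈ F, P ⊆ A := by
  obtain ⟨A, hA, B, hB, hAB⟩ := Finset.one_lt_card.1 (show 1 < F.card by omega)
  refine ⟨A ∩ B, h2 A hA B hB hAB, ?_⟩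
  by_contra! ⟨C, hC, hPC⟩
  have hQ : (A ∪ B).card = 4 := by
    have := Finset.card_union_add_card_inter A B
    rw [h3 A hA, h3 B hB, h2 A hA B hB hAB] at this
    omega
  have key : ∀ D ∈ F, ¬ A ∩ B ⊆ D → D ⊆ A ∪ B := by
    intro D hD h
    have hDA : D ≠ A := by rintro rfl; exact h Finset.inter_subset_left
    have hDB : D ≠ B := by rintro rfl; exact h Finset.inter_subset_right
    have h4 : (D ∩ (A ∩ B)).card < 2 := by
      rw [← h2 A hA B hB hAB]
      refine Finset.card_lt_card (Finset.ssubset_iff_subset_ne.2 ⟨Finset.inter_subset_right, ?_⟩)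
      exact fun h' => h (Finset.inter_eq_right.1 h')
    have h5 := Finset.card_union_add_card_inter (D ∩ A) (D ∩ B)
    rw [h2 D hD A hA hDA, h2 D hD B hB hDB, ← Finset.inter_union_distrib_left,
      ← Finset.inter_inter_distrib_left] at h5
    have h6 : (D ∩ (A ∪ B)).card ≤ D.card := Finset.card_le_card Finset.inter_subset_left
    rw [h3 D hD] at h6
    exact Finset.inter_eq_left.1 (Finset.eq_of_subset_of_card_le Finset.inter_subset_left
      (by rw [h3 D hD]; omega))
  have hall : F ⊆ Finset.powersetCard 3 (A ∪ B) := by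
    intro D hD
    rw [Finset.mem_powersetCard]
    refine ⟨?_, h3 D hD⟩
    by_cases h : A ∩ B ⊆ D
    · have hDC : D ≠ C := by rintro rfl; exact hPC h
      by_contra hDQ
      have h4 : D ∩ (A ∪ B) ⊆ A ∩ B := by
        refine (Finset.eq_of_subset_of_card_le (Finset.subset_inter h ?_) ?_).symm.subset
        · exact Finset.inter_subset_left.trans Finset.subset_union_left
        · rw [h2 A hA B hB hAB]
          have : (D ∩ (A ∪ B)).card < D.card := Finset.card_lt_card
            (Finset.ssubset_iff_subset_ne.2 ⟨Finset.inter_subset_left,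
              fun h' => hDQ (Finset.inter_eq_left.1 h')⟩)
          rw [h3 D hD] at this
          omega
      have h5 : A ∩ B ⊆ C := by
        have h6 : D ∩ C ⊆ A ∩ B := fun x hx => h4 (Finset.mem_inter.2
          ⟨(Finset.mem_inter.1 hx).1, key C hC hPC (Finset.mem_inter.1 hx).2⟩)
        rw [← Finset.eq_of_subset_of_card_le h6 (by
          rw [h2 A hA B hB hAB, h2 D hD C hC hDC])]
        exact Finset.inter_subset_right
      exact hPC h5
    · exact key D hD h
  have := Finset.card_le_card hall
  rw [Finset.card_powersetCard, hQ] at this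
  norm_num [Nat.choose] at this
  omega

theorem exists_exceptional {ι : Type*} [Fintype ι] [DecidableEq ι] {i0 : ι}
    {U : Finset (ι → ℤ)} (hc : 5 ≤ U.card) (h0 : ∀ u ∈ U, u i0 = 1)
    (hip : ∀ u ∈ U, ∀ v ∈ U, ∑ i, u i * v i = if u = v then 4 else 3) :
    ∃ (X Y : ι) (a b : ℤ) (ψ : (ι → ℤ) → ι), X ≠ i0 ∧ Y ≠ i0 ∧ X ≠ Y ∧ (a = 1 ∨ a = -1) ∧
      (b = 1 ∨ b = -1) ∧ Set.InjOn ψ U ∧ ∀ u ∈ U, ψ u ≠ i0 ∧ ψ u ≠ X ∧ ψ u ≠ Y ∧ u X = a ∧ u Y = b ∧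
        (u (ψ u) = 1 ∨ u (ψ u) = -1) ∧ ∀ i, i ≠ i0 → i ≠ X → i ≠ Y → i ≠ ψ u → u i = 0 := by
  set S : (ι → ℤ) → Finset ι := fun u => (Finset.univ.erase i0).filter fun i => u i ≠ 0 with hS
  have hsum : ∀ u ∈ U, ∀ v ∈ U,
      ∑ i ∈ Finset.univ.erase i0, u i * v i = if u = v then 3 else 2 := by
    intro u hu v hv
    have h1 := hip u hu v hv
    rw [← Finset.add_sum_erase _ _ (Finset.mem_univ i0), h0 u hu, h0 v hv] at h1
    split_ifs at h1 ⊢ <;> linarith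
  have hle : ∀ u ∈ U, ∀ i, i ≠ i0 → u i = 0 ∨ u i = 1 ∨ u i = -1 := by
    intro u hu i hi
    have h1 := hsum u hu u hu
    rw [if_pos rfl] at h1
    have h2 : u i * u i ≤ 3 := by
      rw [← h1]
      exact Finset.single_le_sum (f := fun i => u i * u i) (fun j _ => mul_self_nonneg _)
        (Finset.mem_erase.2 ⟨hi, Finset.mem_univ i⟩)
    have h3 : -2 < u i := by nlinarith
    have h4 : u i < 2 := by nlinarith
    omega
  have hsumS : ∀ u ∈ U, ∀ v ∈ U,
      ∑ i ∈ S u ∩ S v, u i * v i = if u = v then 3 else 2 := by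
    intro u hu v hv
    rw [← hsum u hu v hv]
    refine Finset.sum_subset (fun i hi => (Finset.mem_filter.1 (Finset.mem_inter.1 hi).1).1) ?_
    intro i hi hi'
    by_contra h
    refine hi' (Finset.mem_inter.2 ⟨Finset.mem_filter.2 ⟨hi, ?_⟩, Finset.mem_filter.2 ⟨hi, ?_⟩⟩)
    · exact left_ne_zero_of_mul h
    · exact right_ne_zero_of_mul h
  have hmemS : ∀ u i, i ∈ S u ↔ i ≠ i0 ∧ u i ≠ 0 := by
    intro u i
    simp [hS]
  have hcard : ∀ u ∈ U, (S u).card = 3 := by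
    intro u hu
    have h1 := hsumS u hu u hu
    rw [if_pos rfl, Finset.inter_self, Finset.sum_congr rfl (g := fun _ => (1 : ℤ))] at h1
    · rw [Finset.sum_const, nsmul_eq_mul, mul_one] at h1
      exact_mod_cast h1
    · intro i hi
      rw [hmemS] at hi
      rcases hle u hu i hi.1 with h | h | h
      · exact absurd h hi.2
      · rw [h]; norm_num
      · rw [h]; norm_num
  have hpair : ∀ u ∈ U, ∀ v ∈ U, u ≠ v → (S u ∩ S v).card = 2 ∧ ∀ i ∈ S u ∩ S v, u i = v i := by
    intro u hu v hv huv
    have h1 := hsumS u hu v hv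
    rw [if_neg huv] at h1
    have h2 : ∀ i ∈ S u ∩ S v, 1 - u i * v i = 0 ∨ 1 - u i * v i = 2 := by
      intro i hi
      rw [Finset.mem_inter, hmemS, hmemS] at hi
      rcases hle u hu i hi.1.1 with h | h | h <;> rcases hle v hv i hi.1.1 with h' | h' | h' <;>
        simp_all
    have h3 : ∑ i ∈ S u ∩ S v, (1 - u i * v i) = (S u ∩ S v).card - 2 := by
      rw [Finset.sum_sub_distrib, h1]
      simp
    have h4 : (2 : ℤ) ∣ ∑ i ∈ S u ∩ S v, (1 - u i * v i) :=
      Finset.dvd_sum fun i hi => by rcases h2 i hi with h | h <;> norm_num [h]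
    have h5 : 0 ≤ ∑ i ∈ S u ∩ S v, (1 - u i * v i) :=
      Finset.sum_nonneg fun i hi => by rcases h2 i hi with h | h <;> rw [h]; norm_num
    have h6 : (S u ∩ S v).card ≤ 3 := by
      rw [← hcard u hu]
      exact Finset.card_le_card Finset.inter_subset_left
    have h7 : (S u ∩ S v).card = 2 := by omega
    refine ⟨h7, fun i hi => ?_⟩
    rw [h7, Nat.cast_ofNat, sub_self, Finset.sum_eq_zero_iff_of_nonneg (fun i hi => by
      rcases h2 i hi with h | h <;> simp [h])] at h3
    have h8 := h3 i hi
    rw [Finset.mem_inter, hmemS, hmemS] at hi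
    rcases hle u hu i hi.1.1 with h | h | h <;> rcases hle v hv i hi.1.1 with h' | h' | h' <;>
        simp_all
  have hinj : Set.InjOn S U := by
    intro u hu v hv huv
    by_contra h
    have h1 := (hpair u hu v hv h).1
    rw [huv, Finset.inter_self, hcard v hv] at h1
    norm_num at h1
  obtain ⟨P, hP, hPS⟩ := exists_common_pair (F := U.image S)
    (by rwa [Finset.card_image_of_injOn hinj])
    (by
      intro A hA
      obtain ⟨u, hu, rfl⟩ := Finset.mem_image.1 hA
      exact hcard u hu)
    (by
      intro A hA B hB hAB
      obtain ⟨u, hu, rfl⟩ := Finset.mem_image.1 hA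
      obtain ⟨v, hv, rfl⟩ := Finset.mem_image.1 hB
      exact (hpair u hu v hv fun h => hAB (by rw [h])).1)
  replace hPS : ∀ u ∈ U, P ⊆ S u := fun u hu => hPS _ (Finset.mem_image_of_mem S hu)
  obtain ⟨X, Y, hXY, rfl⟩ := Finset.card_eq_two.1 hP
  obtain ⟨u0, hu0⟩ : U.Nonempty := Finset.card_pos.1 (by omega)
  have hsd : ∀ u ∈ U, ∃ i, S u \ {X, Y} = {i} := by
    intro u hu
    rw [← Finset.card_eq_one, Finset.card_sdiff_of_subset (hPS u hu), hcard u hu, hP]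
  have heq : ∀ u ∈ U, ∀ i ∈ ({X, Y} : Finset ι), u i = u0 i := by
    intro u hu i hi
    by_cases h : u = u0
    · rw [h]
    · exact (hpair u hu u0 hu0 h).2 i (Finset.mem_inter.2 ⟨hPS u hu hi, hPS u0 hu0 hi⟩)
  have hX : X ∈ ({X, Y} : Finset ι) := by simp
  have hY : Y ∈ ({X, Y} : Finset ι) := by simp
  have : ∀ u, ∃ i, u ∈ U → S u \ {X, Y} = {i} := fun u => by
    by_cases h : u ∈ U
    · obtain ⟨i, hi⟩ := hsd u h
      exact ⟨i, fun _ => hi⟩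
    · exact ⟨i0, fun h' => absurd h' h⟩
  choose ψ hψ using this
  have hX0 := (hmemS u0 X).1 (hPS u0 hu0 hX)
  have hY0 := (hmemS u0 Y).1 (hPS u0 hu0 hY)
  refine ⟨X, Y, u0 X, u0 Y, ψ, hX0.1, hY0.1, hXY, (hle u0 hu0 X hX0.1).resolve_left hX0.2,
    (hle u0 hu0 Y hY0.1).resolve_left hY0.2, ?_, fun u hu => ?_⟩
  · intro u hu v hv huv
    refine hinj hu hv ?_
    rw [← Finset.sdiff_union_of_subset (hPS u hu), ← Finset.sdiff_union_of_subset (hPS v hv),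
      hψ u hu, hψ v hv, huv]
  · have h1 : ψ u ∈ S u \ {X, Y} := by rw [hψ u hu]; simp
    rw [Finset.mem_sdiff, hmemS] at h1
    simp only [Finset.mem_insert, Finset.mem_singleton, not_or] at h1
    refine ⟨h1.1.1, h1.2.1, h1.2.2, heq u hu X hX, heq u hu Y hY,
      (hle u hu _ h1.1.1).resolve_left h1.1.2, fun i hi hiX hiY hiψ => ?_⟩
    by_contra h
    have h2 : i ∈ S u \ {X, Y} := by
      rw [Finset.mem_sdiff, hmemS]
      exact ⟨⟨hi, h⟩, by simp [hiX, hiY]⟩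
    rw [hψ u hu, Finset.mem_singleton] at h2
    exact hiψ h2

end Combinatorics

end U343

namespace U343

open WedderburnChar

section Degrees

set_option synthInstance.maxHeartbeats 400000 in
set_option synthInstance.maxSize 2000 in
theorem degree_residue_aux : ∀ a < 6, ∀ b < 2, ∀ c < 2, ∀ d < 3, ∀ e < 2, ∀ f < 4, ∀ g < 2,
    (fun x => decide (x ^ 2 ≤ 2^5 * 3 * 7 * 11^2 * 13 * 43^3 * 139 → x % 1807 ∈ [1, 1806] →
      x ∈ [1, 1806, 27104, 79507]))
    (2 ^ a * 3 ^ b * 7 ^ c * 11 ^ d * 13 ^ e * 43 ^ f * 139 ^ g) = true := by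
  decide +kernel

theorem degree_cases {x : ℕ} {a : ℤ} (hx : x ∣ 2^5 * 3 * 7 * 11^2 * 13 * 43^3 * 139)
    (hx2 : x ^ 2 ≤ 2^5 * 3 * 7 * 11^2 * 13 * 43^3 * 139) (ha : a = 1 ∨ a = -1)
    (hd : (1807 : ℤ) ∣ x - a) :
    (x = 1 ∧ a = 1) ∨ ((x = 1806 ∨ x = 27104 ∨ x = 79507) ∧ a = -1) := by
  have h1 : x % 1807 ∈ [1, 1806] := by
    simp only [List.mem_cons, List.not_mem_nil, or_false]
    rcases ha with rfl | rfl <;> omega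
  obtain ⟨a', ha', b, hb, c, hc, d, hd', e, he, f, hf, g, hg, rfl⟩ := exists_exponents hx
  have h2 := degree_residue_aux a' ha' b hb c hc d hd' e he f hf g hg
  simp only [decide_eq_true_eq] at h2
  replace h2 := h2 hx2 h1
  generalize 2 ^ a' * 3 ^ b * 7 ^ c * 11 ^ d * 13 ^ e * 43 ^ f * 139 ^ g = x at *
  simp only [List.mem_cons, List.not_mem_nil, or_false] at h2
  rcases ha with rfl | rfl <;> omega

theorem degree_triple {x y D : ℕ} {a b : ℤ} (hx : x ∣ 2^5 * 3 * 7 * 11^2 * 13 * 43^3 * 139)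
    (hy : y ∣ 2^5 * 3 * 7 * 11^2 * 13 * 43^3 * 139)
    (hD : D ∣ 2^5 * 3 * 7 * 11^2 * 13 * 43^3 * 139)
    (hle : 1 + x ^ 2 + y ^ 2 + 602 * D ^ 2 ≤ 2^5 * 3 * 7 * 11^2 * 13 * 43^3 * 139)
    (ha : a = 1 ∨ a = -1) (hb : b = 1 ∨ b = -1)
    (hdx : (1807 : ℤ) ∣ x - a) (hdy : (1807 : ℤ) ∣ y - b) {δ : ℤ} (hδ : δ = 1 ∨ δ = -1)
    (h : 1 + a * x + b * y + δ * D = 0) :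
    (x = 1 ∧ y = 1 ∧ D = 3 ∧ a = 1 ∧ b = 1 ∧ δ = -1) ∨
      (a = -1 ∧ b = -1 ∧ δ = 1 ∧ D = 81312 ∧
        ((x = 1806 ∧ y = 79507) ∨ (x = 79507 ∧ y = 1806))) := by
  have hDe : D = (1 + a * x + b * y).natAbs := by
    rcases hδ with rfl | rfl <;> omega
  rcases degree_cases hx (by omega) ha hdx with ⟨rfl, rfl⟩ | ⟨rfl | rfl | rfl, rfl⟩ <;>
  rcases degree_cases hy (by omega) hb hdy with ⟨rfl, rfl⟩ | ⟨rfl | rfl | rfl, rfl⟩ <;>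
  norm_num at hDe <;> subst hDe <;> first | (exfalso; revert hD; norm_num; done) | skip
  all_goals rcases hδ with rfl | rfl <;> simp at h ⊢

end Degrees

section

variable {k : Type*} [Field k] [CharZero k] [IsAlgClosed k] {G : Type*} [Group G] [Fintype G]
  {n : ℕ} {d : Fin n → ℕ} (Φ : MonoidAlgebra k G ≃ₐ[k] ∀ i, Matrix (Fin (d i)) (Fin (d i)) k)
  [∀ i, NeZero (d i)]

open Classical in
/-- The exceptional characters of a group with a self-centralizing torus of order `1807`. -/
theorem exists_exceptional_chr (hG : Nat.card G = 2^5 * 3 * 7 * 11^2 * 13 * 43^3 * 139)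
    {A : Subgroup G} (hA : IsTorus A) :
    (∃ X Y i, d X = 1 ∧ d Y = 1 ∧ d i = 3 ∧ ∀ g, (∀ a ∈ A, a ≠ 1 → ¬ IsConj g a) →
      chr Φ i g = 1 + chr Φ X g + chr Φ Y g) ∨
    ∃ i0 X S : Fin n, ∃ Ψ : Finset (Fin n), i0 ∉ Ψ ∧ X ∉ Ψ ∧ S ∉ Ψ ∧ X ≠ i0 ∧ S ≠ i0 ∧ X ≠ S ∧
      d i0 = 1 ∧ (∀ g, chr Φ i0 g = 1) ∧ d X = 1806 ∧ d S = 79507 ∧ 602 ≤ Ψ.card ∧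
      (∀ i ∈ Ψ, d i = 81312 ∧ ∀ g, (∀ a ∈ A, a ≠ 1 → ¬ IsConj g a) →
        chr Φ i g = chr Φ X g + chr Φ S g - 1) ∧
      ∀ i, i ≠ i0 → i ≠ X → i ≠ S → i ∉ Ψ → 1807 ∣ d i := by
  obtain ⟨i0, hd0, hi0⟩ := exists_trivial Φ
  obtain ⟨U, hU, hU0, hip, hUg, hUd⟩ := exists_family Φ hA hi0
  obtain ⟨X, Y, a, b, ψ, hX0, hY0, hXY, ha, hb, hψ, hu⟩ :=
    exists_exceptional (by omega) hU0 hip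
  have hdvd : ∀ i, d i ∣ 2^5 * 3 * 7 * 11^2 * 13 * 43^3 * 139 := fun i => by
    rw [← hG, Nat.card_eq_fintype_card]
    exact degree_dvd_card Φ i
  have hrel : ∀ u ∈ U, ∀ g, (∀ a ∈ A, a ≠ 1 → ¬ IsConj g a) →
      1 + (a : k) * chr Φ X g + b * chr Φ Y g + u (ψ u) * chr Φ (ψ u) g = 0 := by
    intro u hu' g hg
    obtain ⟨h1, h2, h3, h4, h5, -, h6⟩ := hu u hu'
    rw [← hUg u hu' g hg, ← Finset.sum_subset (Finset.subset_univ {i0, X, Y, ψ u}),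
      Finset.sum_insert, Finset.sum_insert, Finset.sum_insert, Finset.sum_singleton, hU0 u hu',
      h4, h5, hi0]
    · push_cast; ring
    · simpa using h3.symm
    · simp [hXY, h2.symm]
    · simp [hX0.symm, hY0.symm, h1.symm]
    · intro i _ hi
      simp only [Finset.mem_insert, Finset.mem_singleton, not_or] at hi
      rw [h6 i hi.1 hi.2.1 hi.2.2.1 hi.2.2.2]
      simp
  have hrel1 : ∀ u ∈ U, 1 + a * d X + b * d Y + u (ψ u) * d (ψ u) = 0 := by
    intro u hu'
    have := hrel u hu' 1 fun a _ ha h => ha (isConj_one_right.1 h)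
    simp only [chr_one] at this
    exact_mod_cast this
  have hsum : ∑ i, d i ^ 2 = 2^5 * 3 * 7 * 11^2 * 13 * 43^3 * 139 := by
    have h1 := card_centralizer Φ (1 : G)
    simp only [inv_one, chr_one] at h1
    have h2 : Nat.card (Subgroup.centralizer {(1 : G)}) = Nat.card G := by
      rw [← Subgroup.card_top (G := G)]
      congr 1
      rw [Subgroup.centralizer_eq_top_iff_subset.2 (by simp)]
    rw [h2, hG] at h1
    simp only [pow_two]
    exact_mod_cast h1
  obtain ⟨u0, hu0⟩ : U.Nonempty := Finset.card_pos.1 (by omega)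
  have hD : ∀ u ∈ U, d (ψ u) = d (ψ u0) := by
    intro u hu'
    have h1 := hrel1 u hu'
    have h2 := hrel1 u0 hu0
    have h3 : (u (ψ u) * d (ψ u)).natAbs = (u0 (ψ u0) * d (ψ u0)).natAbs := by
      congr 1; linarith
    rw [Int.natAbs_mul, Int.natAbs_mul] at h3
    rcases (hu u hu').2.2.2.2.2.1 with h | h <;> rcases (hu u0 hu0).2.2.2.2.2.1 with h' | h' <;>
      simpa [h, h'] using h3
  have hle : 1 + d X ^ 2 + d Y ^ 2 + 602 * d (ψ u0) ^ 2 ≤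
      2^5 * 3 * 7 * 11^2 * 13 * 43^3 * 139 := by
    rw [← hsum, ← Finset.add_sum_erase _ _ (Finset.mem_univ i0),
      ← Finset.add_sum_erase _ _ (Finset.mem_erase.2 ⟨hX0, Finset.mem_univ X⟩),
      ← Finset.add_sum_erase _ _ (Finset.mem_erase.2 ⟨hXY.symm, Finset.mem_erase.2
        ⟨hY0, Finset.mem_univ Y⟩⟩), hd0, one_pow, ← add_assoc, ← add_assoc]
    refine Nat.add_le_add_left ?_ _
    have h1 : U.image ψ ⊆ ((Finset.univ.erase i0).erase X).erase Y := by
      intro i hi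
      obtain ⟨u, hu', rfl⟩ := Finset.mem_image.1 hi
      obtain ⟨h1, h2, h3, -⟩ := hu u hu'
      simp [h1, h2, h3]
    refine le_trans ?_ (Finset.sum_le_sum_of_subset h1)
    rw [Finset.sum_image hψ, Finset.sum_congr rfl fun u hu' => by rw [hD u hu'],
      Finset.sum_const, smul_eq_mul]
    exact Nat.mul_le_mul_right _ hU
  have hu0' := hu u0 hu0
  have hdX := hUd X a fun u hu' => (hu u hu').2.2.2.1
  have hdY := hUd Y b fun u hu' => (hu u hu').2.2.2.2.1
  rcases degree_triple (hdvd X) (hdvd Y) (hdvd (ψ u0)) hle ha hb hdX hdY hu0'.2.2.2.2.2.1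
    (hrel1 u0 hu0) with ⟨h1, h2, h3, rfl, rfl, h4⟩ | ⟨rfl, rfl, h4, h5, h6⟩
  · refine Or.inl ⟨X, Y, ψ u0, h1, h2, h3, fun g hg => ?_⟩
    have := hrel u0 hu0 g hg
    rw [h4] at this
    push_cast at this
    linear_combination -this
  · right
    have hδ : ∀ u ∈ U, u (ψ u) = 1 := by
      intro u hu'
      have h7 := hrel1 u hu'
      rw [hD u hu', h5] at h7
      rcases (hu u hu').2.2.2.2.2.1 with h | h
      · exact h
      · rw [h] at h7; omega
    have hΨ : 602 ≤ (U.image ψ).card := by rwa [Finset.card_image_of_injOn hψ]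
    have hrel2 : ∀ i ∈ U.image ψ, d i = 81312 ∧ ∀ g, (∀ a ∈ A, a ≠ 1 → ¬ IsConj g a) →
        chr Φ i g = chr Φ X g + chr Φ Y g - 1 := by
      intro i hi
      obtain ⟨u, hu', rfl⟩ := Finset.mem_image.1 hi
      refine ⟨by rw [hD u hu', h5], fun g hg => ?_⟩
      have := hrel u hu' g hg
      rw [hδ u hu'] at this
      push_cast at this
      linear_combination this
    have hnot : ∀ u ∈ U, ψ u ≠ i0 ∧ ψ u ≠ X ∧ ψ u ≠ Y := fun u hu' =>
      ⟨(hu u hu').1, (hu u hu').2.1, (hu u hu').2.2.1⟩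
    have hi0Ψ : i0 ∉ U.image ψ := by
      intro h
      obtain ⟨u, hu', h⟩ := Finset.mem_image.1 h
      exact (hnot u hu').1 h
    have hXΨ : X ∉ U.image ψ := by
      intro h
      obtain ⟨u, hu', h⟩ := Finset.mem_image.1 h
      exact (hnot u hu').2.1 h
    have hYΨ : Y ∉ U.image ψ := by
      intro h
      obtain ⟨u, hu', h⟩ := Finset.mem_image.1 h
      exact (hnot u hu').2.2 h
    have hrest : ∀ i, i ≠ i0 → i ≠ X → i ≠ Y → i ∉ U.image ψ → 1807 ∣ d i := by
      intro i h1 h2 h3 h4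
      have := hUd i 0 fun u hu' => (hu u hu').2.2.2.2.2.2 i h1 h2 h3 fun h =>
        h4 (Finset.mem_image.2 ⟨u, hu', h.symm⟩)
      rw [sub_zero] at this
      exact_mod_cast this
    rcases h6 with ⟨hx, hy⟩ | ⟨hx, hy⟩
    · exact ⟨i0, X, Y, U.image ψ, hi0Ψ, hXΨ, hYΨ, hX0, hY0, hXY, hd0, hi0, hx, hy, hΨ, hrel2, hrest⟩
    · refine ⟨i0, Y, X, U.image ψ, hi0Ψ, hYΨ, hXΨ, hY0, hX0, hXY.symm, hd0, hi0, hy, hx, hΨ, ?_,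
        fun i h1 h2 h3 h4 => hrest i h1 h3 h2 h4⟩
      intro i hi
      refine ⟨(hrel2 i hi).1, fun g hg => ?_⟩
      rw [(hrel2 i hi).2 g hg, add_comm (chr Φ X g)]

end

end U343

namespace U343

open WedderburnChar

section Sylow

variable {G : Type*} [Group G] [Finite G] {p : ℕ} [hp : Fact p.Prime]

theorem factorization_eq_one (hp2 : ¬ p ^ 2 ∣ Nat.card G) {x : G} (hx : orderOf x = p) :
    (Nat.card G).factorization p = 1 := by
  have h1 : p ∣ Nat.card G := hx ▸ orderOf_dvd_natCard x
  have h2 := (hp.out.dvd_iff_one_le_factorization Nat.card_pos.ne').1 h1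
  have h3 := mt (hp.out.pow_dvd_iff_le_factorization Nat.card_pos.ne').2 hp2
  omega

theorem exists_sylow_eq_zpowers (hp2 : ¬ p ^ 2 ∣ Nat.card G) {x : G} (hx : orderOf x = p) :
    ∃ P : Sylow p G, (P : Subgroup G) = Subgroup.zpowers x :=
  ⟨Sylow.ofCard (Subgroup.zpowers x) (by
    rw [factorization_eq_one hp2 hx, pow_one, Nat.card_zpowers, hx]), rfl⟩

theorem normalizer_zpowers_sup_eq_top (hp2 : ¬ p ^ 2 ∣ Nat.card G) {x : G} (hx : orderOf x = p)
    {K : Subgroup G} [K.Normal] (hxK : x ∈ K) :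
    Subgroup.normalizer (Subgroup.zpowers x : Set G) ⊔ K = ⊤ := by
  obtain ⟨P, hP⟩ := exists_sylow_eq_zpowers hp2 hx
  have hPK : (P : Subgroup G) ≤ K := by rwa [hP, Subgroup.zpowers_le]
  have := Sylow.normalizer_sup_eq_top' P hPK
  rwa [← hP]

theorem exists_conj_mem_zpowers (hp2 : ¬ p ^ 2 ∣ Nat.card G) {x y : G} (hx : orderOf x = p)
    (hy : orderOf y = p) : ∃ g : G, g * y * g⁻¹ ∈ Subgroup.zpowers x := by
  obtain ⟨P, hP⟩ := exists_sylow_eq_zpowers hp2 hx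
  obtain ⟨Q, hQ⟩ := exists_sylow_eq_zpowers hp2 hy
  obtain ⟨g, hg⟩ := MulAction.exists_smul_eq G Q P
  refine ⟨g, ?_⟩
  rw [← hP, ← hg]
  have hyQ : y ∈ (Q : Subgroup G) := by
    rw [hQ]
    exact Subgroup.mem_zpowers y
  exact Subgroup.smul_mem_pointwise_smul y (MulAut.conj g) _ hyQ

end Sylow

section Trace

variable {k : Type*} [Field k]

theorem eq_one_of_isIdempotent [CharZero k] {d : ℕ} {E : Matrix (Fin d) (Fin d) k} (h : E * E = E)
    (ht : E.trace = d) : E = 1 := by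
  have h' : IsIdempotentElem (Matrix.toLin' E) := by
    rw [IsIdempotentElem, Module.End.mul_eq_comp, ← Matrix.toLin'_mul, h]
  have h1 := (LinearMap.IsIdempotentElem.isProj_range _ h').trace
  rw [Matrix.trace_toLin'_eq, ht] at h1
  have h2 : LinearMap.range (Matrix.toLin' E) = ⊤ := by
    apply Submodule.eq_top_of_finrank_eq
    rw [Module.finrank_fin_fun]
    exact_mod_cast h1.symm
  apply Matrix.toLin'.injective
  rw [Matrix.toLin'_one]
  refine LinearMap.ext fun v => ?_
  obtain ⟨w, rfl⟩ : v ∈ LinearMap.range (Matrix.toLin' E) := h2 ▸ Submodule.mem_top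
  exact LinearMap.congr_fun h' w

theorem trace_mul_of_eq_one {d : ℕ} (hd : d = 1) (M N : Matrix (Fin d) (Fin d) k) :
    (M * N).trace = M.trace * N.trace := by
  subst hd
  simp [Matrix.trace, Matrix.mul_apply]

theorem eq_one_of_trace_eq [CharZero k] {C : Type*} [Group C] [Finite C] {d : ℕ}
    (F : C →* Matrix (Fin d) (Fin d) k) (h : ∀ c, (F c).trace = d) (c : C) : F c = 1 := by
  have := Fintype.ofFinite C
  have hC : (Fintype.card C : k) ≠ 0 := by simp
  set S : Matrix (Fin d) (Fin d) k := (Fintype.card C : k)⁻¹ • ∑ c, F c with hS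
  have h1 : ∀ b, F b * S = S := by
    intro b
    rw [hS, Matrix.mul_smul, Finset.mul_sum]
    congr 1
    exact Fintype.sum_equiv (Equiv.mulLeft b) _ _ fun a => by simp
  have h2 : S * S = S := by
    conv_lhs => lhs; rw [hS]
    rw [Matrix.smul_mul, Finset.sum_mul, Finset.sum_congr rfl fun b _ => h1 b, Finset.sum_const,
      Finset.card_univ, ← Nat.cast_smul_eq_nsmul k, smul_smul, inv_mul_cancel₀ hC, one_smul]
  have h3 : S = 1 := eq_one_of_isIdempotent h2 (by
    rw [hS, Matrix.trace_smul, Matrix.trace_sum, Finset.sum_congr rfl fun b _ => h b,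
      Finset.sum_const, Finset.card_univ, nsmul_eq_mul, smul_eq_mul, inv_mul_cancel_left₀ hC])
  have h4 := h1 c
  rwa [h3, mul_one] at h4

end Trace

theorem not_isConj_of_pow_eq_one {G : Type*} [Group G] {A : Subgroup G}
    (hA : IsTorus A) {g : G} {m : ℕ} (hm : m.Coprime 1807) (h : g ^ m = 1) {a : G} (ha : a ∈ A)
    (ha1 : a ≠ 1) : ¬ IsConj g a := by
  intro hc
  obtain ⟨c, hc⟩ := isConj_iff.1 hc
  have h1 : a ^ m = 1 := by rw [← hc, conj_pow, h, mul_one, mul_inv_cancel]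
  have h2 : a ^ 1807 = 1 := by
    have := pow_card_eq_one' (x := (⟨a, ha⟩ : A))
    rw [hA.card] at this
    exact congrArg Subtype.val this
  exact ha1 (by simpa [hm.gcd_eq_one] using pow_gcd_eq_one.2 ⟨h1, h2⟩)

section

variable {G : Type*} [Group G] [Finite G]

omit [Finite G] in
theorem not_sq_dvd_card (hG : ODPattern G) {p : ℕ} (hp : p = 7 ∨ p = 13 ∨ p = 139) :
    ¬ p ^ 2 ∣ Nat.card G := by
  rw [hG.card]
  rcases hp with rfl | rfl | rfl <;> norm_num

theorem IsTorus.exists_orderOf {A : Subgroup G} (hA : IsTorus A) {p : ℕ}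
    (hp : p = 13 ∨ p = 139) : ∃ a ∈ A, orderOf a = p := by
  have : Fact p.Prime := ⟨by rcases hp with rfl | rfl <;> norm_num⟩
  obtain ⟨a, ha⟩ := exists_prime_orderOf_dvd_card' (G := A) p (by
    rw [hA.card]; rcases hp with rfl | rfl <;> norm_num)
  exact ⟨a, a.2, by rw [Subgroup.orderOf_coe, ha]⟩

theorem IsTorus.map_eq_one {A : Subgroup G} (hA : IsTorus A) {M : Type*} [CommGroup M] (l : G →* M)
    {b : G} (hb : b ∈ A) : l b = 1 := by
  obtain ⟨x, hx, hxA⟩ : ∃ x ∈ Subgroup.normalizer (A : Set G), x ∉ A := by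
    by_contra! h
    have := Subgroup.card_le_of_le (K := A) h
    rw [hA.card, hA.card_normalizer] at this
    norm_num at this
  obtain ⟨c, -, rfl⟩ := hA.exists_commutator hx hxA hb
  rw [map_mul, map_mul, map_mul, map_inv, map_inv, mul_comm (l x), mul_inv_cancel_right,
    mul_inv_cancel]

theorem map_pow_three (hG : ODPattern G) {A : Subgroup G} (hA : IsTorus A) {M : Type*} [CommGroup M] (l : G →* M)
    (g : G) : l g ^ 3 = 1 := by
  have : Fact (Nat.Prime 139) := ⟨by norm_num⟩
  obtain ⟨a, haA, ha⟩ := hA.exists_orderOf (Or.inr rfl)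
  have ha1 : a ≠ 1 := by rintro rfl; simp at ha
  have htop := normalizer_zpowers_sup_eq_top (not_sq_dvd_card hG (by simp)) ha
    (K := l.ker) (hA.map_eq_one l haA)
  obtain ⟨x, hx, y, hy, rfl⟩ := Subgroup.mem_sup_of_normal_right.1
    (show g ∈ _ ⊔ l.ker from htop ▸ Subgroup.mem_top g)
  have hxA : x ∈ Subgroup.normalizer (A : Set G) := by
    refine hA.mem_normalizer_of_conj haA ha1 ?_
    exact (Subgroup.zpowers_le.2 haA) (conj_mem_of_mem_normalizer hx (Subgroup.mem_zpowers a))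
  rw [map_mul, MonoidHom.mem_ker.1 hy, mul_one, ← map_pow, hA.map_eq_one l (hA.pow_three_mem hxA)]

end

section Exclude

variable {k : Type*} [Field k] [CharZero k] [IsAlgClosed k] {G : Type*} [Group G] [Fintype G]
  {n : ℕ} {d : Fin n → ℕ} (Φ : MonoidAlgebra k G ≃ₐ[k] ∀ i, Matrix (Fin (d i)) (Fin (d i)) k)

/-- The homomorphism to `kˣ` afforded by a linear character. -/
noncomputable def linearHom {i : Fin n} (hi : d i = 1) : G →* kˣ :=
  MonoidHom.toHomUnits
    { toFun := chr Φ i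
      map_one' := by rw [chr_one, hi, Nat.cast_one]
      map_mul' := fun g h => by
        simp only [chr, map_mul]
        exact trace_mul_of_eq_one hi _ _ }

omit [CharZero k] [IsAlgClosed k] [Fintype G] in
theorem linearHom_apply {i : Fin n} (hi : d i = 1) (g : G) :
    ((linearHom Φ hi g : kˣ) : k) = chr Φ i g := rfl

omit [IsAlgClosed k] in
theorem not_linear_case [∀ i, NeZero (d i)] (hG : ODPattern G) {A : Subgroup G} (hA : IsTorus A) :
    ¬ ∃ X Y i, d X = 1 ∧ d Y = 1 ∧ d i = 3 ∧ ∀ g, (∀ a ∈ A, a ≠ 1 → ¬ IsConj g a) →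
      chr Φ i g = 1 + chr Φ X g + chr Φ Y g := by
  rintro ⟨X, Y, i, hX, hY, hi, h⟩
  have : Fact (Nat.Prime 7) := ⟨by norm_num⟩
  have hlin : ∀ {j} (hj : d j = 1) g, g ^ 7 = 1 → chr Φ j g = 1 := by
    intro j hj g hg
    rw [← linearHom_apply Φ hj, Units.val_eq_one]
    have h1 := map_pow_three hG hA (linearHom Φ hj) g
    have h2 : linearHom Φ hj g ^ 7 = 1 := by rw [← map_pow, hg, map_one]
    simpa using pow_gcd_eq_one.2 ⟨h1, h2⟩
  obtain ⟨r, hr⟩ := exists_prime_orderOf_dvd_card' (G := G) 7 (by rw [hG.card]; norm_num)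
  set K := (rep Φ i).ker with hK
  have hrK : r ∈ K := by
    rw [hK, MonoidHom.mem_ker]
    refine eq_one_of_trace_eq ((rep Φ i).comp (Subgroup.zpowers r).subtype) (fun c => ?_)
      ⟨r, Subgroup.mem_zpowers r⟩
    have hc : (c : G) ^ 7 = 1 := by
      have := pow_card_eq_one' (x := c)
      rw [Nat.card_zpowers, hr] at this
      exact congrArg Subtype.val this
    have h1 := h c fun a ha ha1 => not_isConj_of_pow_eq_one hA (by norm_num) hc ha ha1
    rw [hlin hX _ hc, hlin hY _ hc] at h1
    refine h1.trans ?_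
    simp only [hi]
    norm_num
  have hAK : ¬ A ≤ K := by
    intro hAK
    obtain ⟨i0, hd0, hi0⟩ := exists_trivial Φ
    have hker : ∀ g ∈ K, chr Φ i g = 3 := by
      intro g hg
      rw [chr, MonoidHom.mem_ker.1 hg, Matrix.trace_one, Fintype.card_fin, hi]
      norm_num
    have hAl : ∀ {j} (hj : d j = 1), ∀ a ∈ A, chr Φ j a = 1 := by
      intro j hj a ha
      rw [← linearHom_apply Φ hj, hA.map_eq_one _ ha, Units.val_one]
    have h1 : ∀ g, chr Φ i g = 1 + chr Φ X g + chr Φ Y g := by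
      intro g
      by_cases hg : ∀ a ∈ A, a ≠ 1 → ¬ IsConj g a
      · exact h g hg
      · push Not at hg
        obtain ⟨a, ha, -, hga⟩ := hg
        obtain ⟨c, hc⟩ := isConj_iff.1 hga.symm
        have h2 : ∀ j, chr Φ j g = chr Φ j a := fun j => by
          rw [← hc]
          simpa using chr_conj Φ j a c⁻¹
        rw [h2, h2, h2, hker a (hAK ha), hAl hX a ha, hAl hY a ha]
        norm_num
    have h2 := linearIndependent_chr Φ (fun j => (if j = i then 1 else 0) -
      (if j = i0 then 1 else 0) - (if j = X then 1 else 0) - (if j = Y then 1 else 0))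
      (fun g => by
        simp only [sub_mul, Finset.sum_sub_distrib, ite_mul, one_mul, zero_mul, Finset.sum_ite_eq',
          Finset.mem_univ, if_true, h1, hi0]
        ring) i
    have hne : i ≠ i0 ∧ i ≠ X ∧ i ≠ Y := by
      refine ⟨?_, ?_, ?_⟩ <;> rintro rfl <;> omega
    simp [hne] at h2
  obtain ⟨p, hp, hpA⟩ : ∃ p, (p = 13 ∨ p = 139) ∧ ∀ a ∈ A, orderOf a = p → a ∉ K := by
    by_contra! hcon
    obtain ⟨a, haA, ha, haK⟩ := hcon 13 (Or.inl rfl)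
    obtain ⟨b, hbA, hb, hbK⟩ := hcon 139 (Or.inr rfl)
    have h13 : 13 ∣ Nat.card (A ⊓ K : Subgroup G) := by
      rw [← ha, ← Subgroup.orderOf_mk a (show a ∈ A ⊓ K from ⟨haA, haK⟩)]
      exact orderOf_dvd_natCard _
    have h139 : 139 ∣ Nat.card (A ⊓ K : Subgroup G) := by
      rw [← hb, ← Subgroup.orderOf_mk b (show b ∈ A ⊓ K from ⟨hbA, hbK⟩)]
      exact orderOf_dvd_natCard _
    have h1 := Nat.Coprime.mul_dvd_of_dvd_of_dvd (by norm_num) h13 h139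
    have h2 := Subgroup.eq_of_le_of_card_ge (inf_le_left : A ⊓ K ≤ A) (by
      rw [hA.card]
      exact Nat.le_of_dvd Nat.card_pos h1)
    exact hAK (inf_eq_left.1 h2)
  have hpp : Fact p.Prime := ⟨by rcases hp with rfl | rfl <;> norm_num⟩
  have hp2 := not_sq_dvd_card hG (Or.inr hp)
  have hpK : ¬ p ∣ Nat.card K := by
    intro hdvd
    obtain ⟨y, hy⟩ := exists_prime_orderOf_dvd_card' (G := K) p hdvd
    rw [← Subgroup.orderOf_coe] at hy
    obtain ⟨a, haA, ha⟩ := hA.exists_orderOf hp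
    obtain ⟨g, hg⟩ := exists_conj_mem_zpowers hp2 ha hy
    refine hpA _ ((Subgroup.zpowers_le.2 haA) hg) ?_ ((inferInstance : K.Normal).conj_mem _ y.2 g)
    rw [← hy]
    exact (orderOf_injective (MulAut.conj g).toMonoidHom (MulAut.conj g).injective y)
  have htop := normalizer_zpowers_sup_eq_top (not_sq_dvd_card hG (by simp)) hr hrK
  have hpN : p ∣ Nat.card (Subgroup.normalizer (Subgroup.zpowers r : Set G)) := by
    refine dvd_trans ?_ (K.relIndex_dvd_card _)
    rw [← Subgroup.relIndex_sup_right, htop, Subgroup.relIndex_top_right]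
    have h1 : p ∣ K.index * Nat.card K := by
      rw [K.index_mul_card, hG.card]
      rcases hp with rfl | rfl <;> norm_num
    exact (hpp.out.dvd_mul.1 h1).resolve_right hpK
  obtain ⟨e, he, hN⟩ := card_normalizer_dvd r hr
  rw [hN] at hpN
  have hpC := (hpp.out.dvd_mul.1 hpN).resolve_right fun hpe => by
    have := hpe.trans he
    rcases hp with rfl | rfl <;> norm_num at this
  have h7 := mem_nbrs_of_dvd_centralizer (by norm_num) hpp.out
    (by rcases hp with rfl | rfl <;> norm_num) hr hpC
  replace h7 := nbrs_symm h7
  rcases hp with rfl | rfl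
  · rw [nbrs_13 hG] at h7; norm_num at h7
  · rw [nbrs_139 hG] at h7; norm_num at h7

end Exclude

end U343

namespace U343

open WedderburnChar

theorem exists_characters {G : Type*} [Group G] [Finite G] (hG : ODPattern G) :
    ∃ X S : G → ℤ, X 1 = 1806 ∧
      (∀ (P : Subgroup G) [Fintype P] (l : P →* (AlgebraicClosure ℚ)ˣ),
        ∃ m : ℕ, ∑ a, ((l a⁻¹ : (AlgebraicClosure ℚ)ˣ) : AlgebraicClosure ℚ) * X a =
          m * Fintype.card P) ∧
      ∀ y : G, y ^ 43 ^ 3 = 1 →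
        1 + X y ^ 2 + S y ^ 2 + 602 * (X y + S y - 1) ^ 2 ≤
          Nat.card (Subgroup.centralizer {y}) ∧
        (Nat.card (Subgroup.centralizer {y}) : ℤ) ∣ 1807 * 43 ^ 3 * (X y + S y - 1) ∧
        (Nat.card (Subgroup.centralizer {y}) : ℤ) ∣ 81312 * 1807 * S y ∧ 43 ∣ X y := by
  classical
  have := Fintype.ofFinite G
  have : Fact (Nat.Prime 43) := ⟨by norm_num⟩
  have : Algebra.IsAlgebraic ℚ (AlgebraicClosure ℚ) := AlgebraicClosure.isAlgebraic ℚ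
  obtain ⟨n, d, hd, ⟨Φ⟩⟩ := exists_wedderburn G
  obtain ⟨A, hA⟩ := exists_isTorus hG
  obtain ⟨i0, X, S, Ψ, h0Ψ, hXΨ, hSΨ, hX0, hS0, hXS, hd0, hi0, hdX, hdS, hΨ, hψ, hdvd⟩ :=
    (exists_exceptional_chr Φ hG.card hA).resolve_left (not_linear_case Φ hG hA)
  have huX : ∀ j, d j = d X → j = X := by
    intro j hj
    by_contra hjX
    by_cases h0 : j = i0
    · subst h0; omega
    by_cases hS : j = S
    · subst hS; omega
    by_cases hj2 : j ∈ Ψ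
    · have := (hψ j hj2).1; omega
    · have := hdvd j h0 hjX hS hj2; omega
  have huS : ∀ j, d j = d S → j = S := by
    intro j hj
    by_contra hjS
    by_cases h0 : j = i0
    · subst h0; omega
    by_cases hX : j = X
    · subst hX; omega
    by_cases hj2 : j ∈ Ψ
    · have := (hψ j hj2).1; omega
    · have := hdvd j h0 hX hjS hj2; omega
  choose x hx using exists_int_of_unique_degree Φ huX
  choose s hs using exists_int_of_unique_degree Φ huS
  have hcard : (Fintype.card G : ℤ) = 2^5 * 3 * 7 * 11^2 * 13 * 43^3 * 139 := by
    rw [← Nat.card_eq_fintype_card, hG.card]; norm_num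
  obtain ⟨ψ, hψΨ⟩ : Ψ.Nonempty := Finset.card_pos.1 (by omega)
  refine ⟨x, s, ?_, ?_, ?_⟩
  · have := hx 1
    rw [chr_one, hdX] at this
    exact_mod_cast this.symm
  · intro P _ l
    obtain ⟨m, hm⟩ := exists_nat_sum_hom ((rep Φ X).comp P.subtype) l
    refine ⟨m, hm ▸ Finset.sum_congr rfl fun a _ => ?_⟩
    rw [← hx]
    rfl
  · intro y hy
    have hna : ∀ a ∈ A, a ≠ 1 → ¬ IsConj y a := fun a ha ha1 =>
      not_isConj_of_pow_eq_one hA (by norm_num) hy ha ha1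
    have hψy : ∀ i ∈ Ψ, chr Φ i y = ((x y + s y - 1 : ℤ) : AlgebraicClosure ℚ) := by
      intro i hi
      rw [(hψ i hi).2 y hna, hx, hs]
      push_cast
      ring
    refine ⟨?_, ?_, ?_, ?_⟩
    · let t : Fin n → ℤ := fun i => if i = i0 then 1 else if i = X then x y else
        if i = S then s y else x y + s y - 1
      have h1 := sum_sq_le_centralizer Φ
        (IsAlgClosed.lift (R := ℚ) (S := AlgebraicClosure ℚ) (M := ℂ)).toRingHom y
        (insert i0 (insert X (insert S Ψ))) t (by
          intro i hi
          simp only [t]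
          split_ifs with h1 h2 h3
          · rw [h1, hi0]; simp
          · rw [h2, hx]
          · rw [h3, hs]
          · exact hψy i (by simpa [h1, h2, h3] using hi))
      rw [Finset.sum_insert (by simp [hX0.symm, hS0.symm, h0Ψ]),
        Finset.sum_insert (by simp [hXS, hXΨ]), Finset.sum_insert hSΨ,
        Finset.sum_congr (s₁ := Ψ) rfl (g := fun _ => (x y + s y - 1) ^ 2)] at h1
      · simp only [t, if_true, if_neg hX0, if_neg hS0, if_neg hXS.symm, Finset.sum_const,
          nsmul_eq_mul] at h1
        have h2 : (602 : ℤ) ≤ Ψ.card := by exact_mod_cast hΨ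
        nlinarith [sq_nonneg (x y + s y - 1)]
      · intro i hi
        simp only [t]
        rw [if_neg (by rintro rfl; exact h0Ψ hi), if_neg (by rintro rfl; exact hXΨ hi),
          if_neg (by rintro rfl; exact hSΨ hi)]
    · have := degree_mul_centralizer_dvd Φ (hψy ψ hψΨ)
      rw [(hψ ψ hψΨ).1, hcard, Nat.cast_ofNat] at this
      refine (mul_dvd_mul_iff_left (a := (81312 : ℤ)) (by norm_num)).1 ?_
      refine this.trans (dvd_of_eq ?_)
      ring
    · have := degree_mul_centralizer_dvd Φ (hs y)
      rw [hdS, hcard, Nat.cast_ofNat] at this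
      refine (mul_dvd_mul_iff_left (a := (79507 : ℤ)) (by norm_num)).1 ?_
      refine this.trans (dvd_of_eq ?_)
      ring
    · have := dvd_trace_sub (rep Φ X) (p := 43) (e := 3) hy (hx y)
      rw [hdX] at this
      push_cast at this
      omega

end U343

namespace U343

open WedderburnChar

theorem eq_of_local_bounds {c : ℕ} (hc : c ∣ 2 ^ 5 * 11 ^ 2 * 43 ^ 3) (h43 : 43 ∣ c) {X S : ℤ}
    (h1 : 1 + X ^ 2 + S ^ 2 + 602 * (X + S - 1) ^ 2 ≤ c)
    (h2 : (c : ℤ) ∣ 1807 * 43 ^ 3 * (X + S - 1)) (h3 : (c : ℤ) ∣ 81312 * 1807 * S)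
    (h4 : 43 ∣ X) :
    (X = 0 ∧ (c = 43 ^ 2 ∨ c = 43 ^ 3)) ∨ (X = -43 ∧ (c = 43 ^ 3 * 22 ∨ c = 43 ^ 3 * 44)) := by
  obtain ⟨m, q, hm, hq, rfl⟩ := (Nat.dvd_mul (k := c)).1 hc
  obtain ⟨f, hf, rfl⟩ := (Nat.dvd_prime_pow (by norm_num)).1 hq
  have hf0 : f ≠ 0 := by
    rintro rfl
    have := h43.trans (by simpa using hm)
    norm_num at this
  have hm0 : 0 < m := Nat.pos_of_dvd_of_pos hm (by norm_num)
  push_cast at h1 h2 h3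
  have hme : (m : ℤ) ∣ X + S - 1 := by
    refine IsCoprime.dvd_of_dvd_mul_left ?_ ((dvd_mul_right _ _).trans h2)
    exact Nat.isCoprime_iff_coprime.2
      (Nat.Coprime.of_dvd_left hm (by norm_num : Nat.Coprime (2 ^ 5 * 11 ^ 2) 143669149))
  have hfS : (43 : ℤ) ^ f ∣ S := by
    refine IsCoprime.dvd_of_dvd_mul_left ?_ ((dvd_mul_left _ _).trans h3)
    exact IsCoprime.pow_left (by norm_num)
  have h43S : (43 : ℤ) ∣ S := (dvd_pow_self _ hf0).trans hfS
  have hm1 : (1 : ℤ) ≤ m := by exact_mod_cast hm0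
  have hS : S = 0 := by
    by_contra hS
    have he : X + S - 1 ≠ 0 := by omega
    have h5 : (m : ℤ) ^ 2 ≤ (X + S - 1) ^ 2 := by
      rw [sq_le_sq]
      exact Int.le_of_dvd (abs_pos.2 he) ((dvd_abs _ _).2 hme) |>.trans' (by simp)
    have h6 : ((43 : ℤ) ^ f) ^ 2 ≤ S ^ 2 := by
      rw [sq_le_sq]
      exact Int.le_of_dvd (abs_pos.2 hS) ((dvd_abs _ _).2 hfS) |>.trans' (by simp [abs_of_pos])
    nlinarith [sq_nonneg ((43 : ℤ) ^ f - m)]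
  subst hS
  obtain ⟨k, rfl⟩ := h4
  simp only [add_zero] at *
  have hf3 : (43 : ℤ) ^ f ≤ 79507 := by
    have := pow_le_pow_right₀ (a := (43 : ℤ)) (by norm_num) hf
    norm_num at this ⊢
    exact this
  have he0 : 43 * k - 1 ≠ 0 := by omega
  have hle : (m : ℤ) ≤ |43 * k - 1| := Int.le_of_dvd (abs_pos.2 he0) ((dvd_abs _ _).2 hme)
  have habs : |43 * k - 1| ≤ 132 := by
    have h5 : |43 * k - 1| ^ 2 = (43 * k - 1) ^ 2 := sq_abs _
    by_contra! h6
    nlinarith [sq_nonneg k, mul_le_mul_of_nonneg_left hf3 (by omega : (0 : ℤ) ≤ m)]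
  rw [abs_le] at habs
  have hmd : m ∣ Nat.gcd (2 ^ 5 * 11 ^ 2) (43 * k - 1).natAbs :=
    Nat.dvd_gcd hm (Int.natCast_dvd.1 hme)
  have hk1 : -3 ≤ k := by omega
  have hk2 : k ≤ 3 := by omega
  obtain rfl | rfl | rfl : f = 1 ∨ f = 2 ∨ f = 3 := by omega
  all_goals
    interval_cases k <;> norm_num at hmd h1 <;>
    first
    | omega
    | (have := Nat.le_of_dvd (by norm_num) hmd; omega)
    | skip
  have h7 := Nat.le_of_dvd (by norm_num) hmd
  have h8 : 15 ≤ m := by omega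
  interval_cases m <;> omega

section Local

variable {G : Type*} [Group G] [Finite G]

theorem card_centralizer_dvd_of_orderOf (hG : ODPattern G) {y : G} (hy : orderOf y = 43) :
    Nat.card (Subgroup.centralizer {y}) ∣ 2 ^ 5 * 11 ^ 2 * 43 ^ 3 := by
  have h1 : Nat.card (Subgroup.centralizer {y}) ∣ 2^5 * 3 * 7 * 11^2 * 13 * 43^3 * 139 :=
    hG.card ▸ Subgroup.card_subgroup_dvd_card _
  have key : ∀ q, q.Prime → q ≠ 43 → q ≠ 2 → q ≠ 11 →
      ¬ q ∣ Nat.card (Subgroup.centralizer {y}) := by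
    intro q hq h43 h2 h11 h
    have := mem_nbrs_of_dvd_centralizer (by norm_num) hq (Ne.symm h43) hy h
    rw [nbrs_43 hG] at this
    simp [h2, h11] at this
  have key2 : ∀ q, q.Prime → q ≠ 43 → q ≠ 2 → q ≠ 11 →
      Nat.Coprime (Nat.card (Subgroup.centralizer {y})) q := fun q hq h43 h2 h11 =>
    ((Nat.Prime.coprime_iff_not_dvd hq).2 (key q hq h43 h2 h11)).symm
  have h3 := key2 3 (by norm_num) (by norm_num) (by norm_num) (by norm_num)
  have h7 := key2 7 (by norm_num) (by norm_num) (by norm_num) (by norm_num)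
  have h13 := key2 13 (by norm_num) (by norm_num) (by norm_num) (by norm_num)
  have h139 := key2 139 (by norm_num) (by norm_num) (by norm_num) (by norm_num)
  refine Nat.Coprime.dvd_of_dvd_mul_left (((h3.mul_right h7).mul_right h13).mul_right h139)
    (h1.trans (dvd_of_eq ?_))
  norm_num

omit [Finite G] in
theorem exists_pow_orderOf {y : G} (hy : y ^ 43 ^ 3 = 1) (hy1 : y ≠ 1) :
    ∃ j, orderOf (y ^ j) = 43 := by
  have : Fact (Nat.Prime 43) := ⟨by norm_num⟩
  obtain ⟨k, hk, hk2⟩ := (Nat.dvd_prime_pow (by norm_num)).1 (orderOf_dvd_of_pow_eq_one hy)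
  have hk0 : k ≠ 0 := by
    rintro rfl
    rw [pow_zero, orderOf_eq_one_iff] at hk2
    exact hy1 hk2
  refine ⟨43 ^ (k - 1), orderOf_pow_of_mul (by norm_num) ?_⟩
  rw [hk2, ← pow_succ', Nat.sub_add_cancel (Nat.pos_of_ne_zero hk0)]

omit [Finite G] in
theorem centralizer_le_centralizer_pow (y : G) (j : ℕ) :
    Subgroup.centralizer {y} ≤ Subgroup.centralizer {y ^ j} := fun _ h =>
  mem_centralizer.2 ((mem_centralizer.1 h).pow_left j)

theorem exists_local_character (hG : ODPattern G) : ∃ X : G → ℤ, X 1 = 1806 ∧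
    (∀ (P : Subgroup G) [Fintype P] (l : P →* (AlgebraicClosure ℚ)ˣ),
      ∃ m : ℕ, ∑ a, ((l a⁻¹ : (AlgebraicClosure ℚ)ˣ) : AlgebraicClosure ℚ) * X a =
        m * Fintype.card P) ∧
    ∀ y : G, y ^ 43 ^ 3 = 1 → y ≠ 1 →
      (X y = 0 ∧ (Nat.card (Subgroup.centralizer {y}) = 43 ^ 2 ∨
        Nat.card (Subgroup.centralizer {y}) = 43 ^ 3)) ∨
      (X y = -43 ∧ (Nat.card (Subgroup.centralizer {y}) = 43 ^ 3 * 22 ∨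
        Nat.card (Subgroup.centralizer {y}) = 43 ^ 3 * 44)) := by
  obtain ⟨X, S, hX1, hX, h⟩ := exists_characters hG
  refine ⟨X, hX1, hX, fun y hy hy1 => ?_⟩
  obtain ⟨h1, h2, h3, h4⟩ := h y hy
  obtain ⟨j, hj⟩ := exists_pow_orderOf hy hy1
  refine eq_of_local_bounds ((Subgroup.card_dvd_of_le (centralizer_le_centralizer_pow y j)).trans
    (card_centralizer_dvd_of_orderOf hG hj)) ?_ h1 h2 h3 h4
  refine (dvd_trans ?_ (orderOf_pow_dvd (x := y) j)).trans
    (b := orderOf y) ?_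
  · rw [hj]
  · rw [← Nat.card_zpowers]
    refine Subgroup.card_dvd_of_le ?_
    rw [Subgroup.zpowers_le]
    exact mem_centralizer.2 (Commute.refl y)

end Local

end U343

namespace U343

open WedderburnChar
open scoped Pointwise

section

variable {G : Type*} [Group G] [Finite G]

theorem exists_sylow_of_centralizer {y : G} (hy : orderOf y = 43) {m : ℕ} (hm : ¬ 43 ∣ m)
    (hc : Nat.card (Subgroup.centralizer {y}) = 43 ^ 3 * m) :
    ∃ P : Subgroup G, P ≤ Subgroup.centralizer {y} ∧ y ∈ P ∧ Nat.card P = 43 ^ 3 := by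
  have : Fact (Nat.Prime 43) := ⟨by norm_num⟩
  have hyC : y ∈ Subgroup.centralizer {y} := mem_centralizer.2 (Commute.refl y)
  let y' : Subgroup.centralizer {y} := ⟨y, hyC⟩
  have hy' : orderOf y' = 43 := by rw [← hy]; exact (Subgroup.orderOf_coe y').symm
  have hZ : IsPGroup 43 (Subgroup.zpowers y') :=
    IsPGroup.of_card (n := 1) (by rw [Nat.card_zpowers, hy', pow_one])
  obtain ⟨Q, hQ⟩ := hZ.exists_le_sylow
  refine ⟨(Q : Subgroup (Subgroup.centralizer {y})).map (Subgroup.subtype _), ?_, ?_, ?_⟩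
  · rintro _ ⟨q, -, rfl⟩
    exact q.2
  · exact ⟨y', hQ (Subgroup.mem_zpowers y'), rfl⟩
  · rw [Nat.card_congr (Subgroup.equivMapOfInjective _ _ (Subgroup.subtype_injective _)).toEquiv.symm,
      Sylow.card_eq_multiplicity, hc, Nat.factorization_mul (by norm_num) (by rintro rfl; simp at hm),
      Nat.Prime.factorization_pow (by norm_num)]
    simp [Nat.factorization_eq_zero_of_not_dvd hm]

theorem card_centralizer_of_mem_zpowers {y z : G} (hy : orderOf y = 43)
    (hz : z ∈ Subgroup.zpowers y) (hz1 : z ≠ 1) :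
    Subgroup.centralizer {z} = Subgroup.centralizer {y} := by
  have h1 : Subgroup.zpowers z = Subgroup.zpowers y := by
    refine Subgroup.eq_of_le_of_card_ge ((Subgroup.zpowers_le).2 hz) ?_
    have h2 : orderOf z ∣ 43 := hy ▸ orderOf_dvd_of_mem_zpowers hz
    rw [Nat.card_zpowers, Nat.card_zpowers, hy]
    rcases (Nat.dvd_prime (by norm_num)).1 h2 with h | h
    · exact absurd (orderOf_eq_one_iff.1 h) hz1
    · exact h.ge
  rw [← centralizer_zpowers, h1, centralizer_zpowers]

theorem mem_zpowers_of_character_eq {P : Subgroup G} {y : G} (hyP : y ∈ P)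
    (hy : orderOf y = 43) {X : G → ℤ} (hX1 : X 1 = 1806)
    (hX : ∀ x ∈ P, x ≠ 1 → X x = 0 ∨ X x = -43)
    (hZ : ∀ z ∈ Subgroup.zpowers y, z ≠ 1 → X z = -43)
    (hsum : ∀ [Fintype P], ∃ m : ℕ, ∑ a : P, X a = m * 43 ^ 3) {x : G} (hx : x ∈ P)
    (hx2 : X x = -43) : x ∈ Subgroup.zpowers y := by
  classical
  have := Fintype.ofFinite P
  obtain ⟨m, hm⟩ := hsum
  set T : Finset P := Finset.univ.filter fun a => X a = -43 with hT
  let W : Finset P := Finset.univ.filter fun a => (a : G) ∈ Subgroup.zpowers y ∧ a ≠ 1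
  have hWT : W ⊆ T := fun a ha => by
    simp only [W, T, Finset.mem_filter, Finset.mem_univ, true_and] at ha ⊢
    exact hZ a ha.1 (by simpa using ha.2)
  have hWcard : W.card = 42 := by
    have h1 : insert 1 W = Finset.univ.filter fun a : P => (a : G) ∈ Subgroup.zpowers y := by
      ext a
      by_cases ha : a = 1
      · simp [W, ha]
      · simp [W, ha]
    have h2 : (insert 1 W).card = 43 := by
      rw [h1, ← Fintype.card_subtype, ← Nat.card_eq_fintype_card, ← hy, ← Nat.card_zpowers]
      exact Nat.card_congr ((Subgroup.subgroupOfEquivOfLe ((Subgroup.zpowers_le).2 hyP)).toEquiv)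
    rw [Finset.card_insert_of_notMem (by simp [W])] at h2
    omega
  have hS : ∑ a : P, X a = 1806 - 43 * T.card := by
    have h1 : ∀ a : P, X a = (if a = 1 then 1806 else 0) + (if X a = -43 then -43 else 0) := by
      intro a
      by_cases ha : a = 1
      · simp [ha, hX1]
      · rcases hX a a.2 (by simpa using ha) with h | h <;> simp [ha, h]
    rw [Finset.sum_congr rfl fun a _ => h1 a, Finset.sum_add_distrib, Finset.sum_ite_eq' Finset.univ,
      ← Finset.sum_filter, Finset.sum_const, nsmul_eq_mul]
    simp only [Finset.mem_univ, if_true, ← hT]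
    ring
  have h3 := Finset.card_le_card hWT
  have hWeq : W = T := Finset.eq_of_subset_of_card_le hWT (by omega)
  have : (⟨x, hx⟩ : P) ∈ T := by simp [T, hx2]
  rw [← hWeq] at this
  simp only [W, Finset.mem_filter] at this
  exact this.2.1

theorem exists_not_commute {P : Subgroup G} (hP : Nat.card P = 43 ^ 3) {y : G} (hyP : y ∈ P)
    (hy : orderOf y = 43) {X : G → ℤ} (hX1 : X 1 = 1806)
    (hX : ∀ x ∈ P, x ∉ Subgroup.zpowers y → X x = 0)
    (hZ : ∀ z ∈ Subgroup.zpowers y, z ≠ 1 → X z = -43)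
    (hsum : ∀ [Fintype P] (l : P →* (AlgebraicClosure ℚ)ˣ), ∃ m : ℕ,
      ∑ a, ((l a⁻¹ : (AlgebraicClosure ℚ)ˣ) : AlgebraicClosure ℚ) * X a = m * Fintype.card P) :
    ∃ a ∈ P, ∃ b ∈ P, ¬ Commute a b := by
  classical
  by_contra! hcom
  have := Fintype.ofFinite P
  let _ : CommGroup P := { mul_comm := fun a b => Subtype.ext (hcom a a.2 b b.2) }
  let y' : P := ⟨y, hyP⟩
  have hy1 : y' ≠ 1 := by
    intro h
    have : y = 1 := congrArg Subtype.val h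
    rw [this, orderOf_one] at hy
    norm_num at hy
  have : NeZero (Monoid.exponent P : AlgebraicClosure ℚ) :=
    ⟨by exact_mod_cast Monoid.exponent_ne_zero_of_finite⟩
  obtain ⟨l, hl⟩ := CommGroup.exists_apply_ne_one_of_hasEnoughRootsOfUnity P
    (AlgebraicClosure ℚ) hy1
  obtain ⟨m, hm⟩ := hsum l
  let Z : Subgroup P := (Subgroup.zpowers y).subgroupOf P
  let f : Z →* AlgebraicClosure ℚ :=
    ((Units.coeHom _).comp (l.comp (MulEquiv.inv P).toMonoidHom)).comp Z.subtype
  have hf : f ≠ 1 := by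
    intro h
    have := DFunLike.congr_fun h (⟨y', Subgroup.mem_zpowers y⟩ : Z)
    apply hl
    have h2 : l y'⁻¹ = 1 := Units.ext (by simpa [f] using this)
    rwa [map_inv, inv_eq_one] at h2
  have hf0 := sum_hom_units_eq_zero f hf
  have h1 : ∀ a : P, ((l a⁻¹ : (AlgebraicClosure ℚ)ˣ) : AlgebraicClosure ℚ) * X a =
      (if a = 1 then 1849 else 0) +
        (if a ∈ Z then -43 * ((l a⁻¹ : (AlgebraicClosure ℚ)ˣ) : AlgebraicClosure ℚ) else 0) := by
    intro a
    by_cases ha : a = 1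
    · subst ha
      simp [hX1, Z]
      norm_num
    · by_cases hz : a ∈ Z
      · rw [hZ a hz (by simpa using ha), if_neg ha, if_pos hz]
        push_cast
        ring
      · rw [hX a a.2 hz, if_neg ha, if_neg hz]
        simp
  rw [Finset.sum_congr rfl fun a _ => h1 a, Finset.sum_add_distrib, Finset.sum_ite_eq' Finset.univ,
    ← Finset.sum_filter, ← Finset.mul_sum] at hm
  have h2 : ∑ a ∈ Finset.univ.filter (fun a => a ∈ Z),
      ((l a⁻¹ : (AlgebraicClosure ℚ)ˣ) : AlgebraicClosure ℚ) = 0 := by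
    rw [← hf0, Finset.sum_subtype (p := fun a => a ∈ Z) _ (by simp)]
    rfl
  rw [h2, ← Nat.card_eq_fintype_card, hP] at hm
  simp only [Finset.mem_univ, if_true, mul_zero, add_zero] at hm
  have h3 : 1849 = m * 43 ^ 3 := by exact_mod_cast hm
  omega

omit [Finite G] in
theorem card_centralizer_conj (g x : G) :
    Nat.card (Subgroup.centralizer {g * x * g⁻¹}) = Nat.card (Subgroup.centralizer {x}) := by
  refine Nat.card_congr ((MulAut.conj g⁻¹).toEquiv.subtypeEquiv fun y => ?_)
  change y ∈ Subgroup.centralizer {g * x * g⁻¹} ↔ MulAut.conj g⁻¹ y ∈ Subgroup.centralizer {x}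
  rw [mem_centralizer, mem_centralizer]
  constructor
  · intro h
    simpa [mul_assoc] using h.map (MulAut.conj g⁻¹)
  · intro h
    simpa [mul_assoc] using h.map (MulAut.conj g)

/-- The structure of a Sylow `43`-subgroup `P` and its centre `Z`. -/
structure IsLocal (P Z : Subgroup G) : Prop where
  card_P : Nat.card P = 43 ^ 3
  card_Z : Nat.card Z = 43
  le : Z ≤ P
  commute : ∀ z ∈ Z, ∀ x ∈ P, Commute z x
  centralizer_Z : ∀ z ∈ Z, z ≠ 1 → ∀ w ∈ Z, w ≠ 1 →
    Subgroup.centralizer {z} = Subgroup.centralizer {w}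
  card_centralizer_Z : ∀ z ∈ Z, z ≠ 1 → Nat.card (Subgroup.centralizer {z}) = 43 ^ 3 * 22 ∨
    Nat.card (Subgroup.centralizer {z}) = 43 ^ 3 * 44
  card_centralizer : ∀ x ∈ P, x ∉ Z → Nat.card (Subgroup.centralizer {x}) = 43 ^ 2

theorem mem_of_commute_all {P Z : Subgroup G} (hP : Nat.card P = 43 ^ 3) (hZ : Nat.card Z = 43)
    (hZP : Z ≤ P) (hcom : ∀ z ∈ Z, ∀ x ∈ P, Commute z x) (hnc : ∃ a ∈ P, ∃ b ∈ P, ¬ Commute a b)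
    {w : G} (hw : w ∈ P) (hwc : ∀ x ∈ P, Commute w x) : w ∈ Z := by
  have : Fact (Nat.Prime 43) := ⟨by norm_num⟩
  by_contra hwZ
  obtain ⟨a, ha, b, hb, hab⟩ := hnc
  have h1 : Z.subgroupOf P ≤ Subgroup.center P := fun z hz => Subgroup.mem_center_iff.2 fun x =>
    Subtype.ext (hcom z hz x x.2).eq.symm
  have h2 : Nat.card (Subgroup.center P) ∣ 43 ^ 3 := hP ▸ Subgroup.card_subgroup_dvd_card _
  have hZ' : Nat.card (Z.subgroupOf P) = 43 := by
    rw [← hZ]; exact Nat.card_congr (Subgroup.subgroupOfEquivOfLe hZP).toEquiv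
  have h3 : Nat.card (Subgroup.center P) ≠ 43 := by
    intro h
    have h4 := Subgroup.eq_of_le_of_card_ge h1 (by rw [h, hZ'])
    apply hwZ
    have : (⟨w, hw⟩ : P) ∈ Z.subgroupOf P := by
      rw [h4]
      exact Subgroup.mem_center_iff.2 fun x => Subtype.ext (hwc x x.2).eq.symm
    exact this
  have h4 : 43 ∣ Nat.card (Subgroup.center P) := hZ' ▸ Subgroup.card_dvd_of_le h1
  have h5 := Subgroup.card_eq_card_quotient_mul_card_subgroup (Subgroup.center P)
  rw [hP] at h5
  have h6 : IsCyclic (P ⧸ Subgroup.center P) := by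
    obtain ⟨k, hk, hk2⟩ := (Nat.dvd_prime_pow (by norm_num)).1 h2
    rw [hk2] at h3 h4 h5
    obtain rfl | rfl | rfl | rfl : k = 0 ∨ k = 1 ∨ k = 2 ∨ k = 3 := by omega
    · norm_num at h4
    · norm_num at h3
    · exact isCyclic_of_prime_card (p := 43) (by omega)
    · have : Subsingleton (P ⧸ Subgroup.center P) := (Nat.card_eq_one_iff_unique.1 (by omega)).1
      infer_instance
  have h7 := MonoidHom.isMulCommutative_of_isCyclic_of_ker_le_center
    (QuotientGroup.mk' (Subgroup.center P)) (by simp)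
  exact hab (congrArg Subtype.val (h7.is_comm.comm (⟨a, ha⟩ : P) ⟨b, hb⟩))

omit [Finite G] in
theorem pow_eq_one_of_mem {P : Subgroup G} (hP : Nat.card P = 43 ^ 3) {x : G} (hx : x ∈ P) :
    x ^ 43 ^ 3 = 1 := by
  have := pow_card_eq_one' (x := (⟨x, hx⟩ : P))
  rw [hP] at this
  exact congrArg Subtype.val this

omit [Finite G] in
theorem factorization_card (hG : ODPattern G) : (Nat.card G).factorization 43 = 3 := by
  rw [hG.card, show 2^5 * 3 * 7 * 11^2 * 13 * 43^3 * 139 = 43 ^ 3 * (81312 * 1807) by norm_num,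
    Nat.factorization_mul (by norm_num) (by norm_num), Nat.Prime.factorization_pow (by norm_num)]
  simp [Nat.factorization_eq_zero_of_not_dvd (show ¬ 43 ∣ 146930784 by norm_num)]

theorem exists_conj_le (hG : ODPattern G) {P Q : Subgroup G} (hP : Nat.card P = 43 ^ 3)
    (hQ : Nat.card Q = 43 ^ 3) : ∃ g : G, ∀ x, x ∈ Q ↔ g * x * g⁻¹ ∈ P := by
  have : Fact (Nat.Prime 43) := ⟨by norm_num⟩
  obtain ⟨g, hg⟩ := MulAction.exists_smul_eq G
    (Sylow.ofCard Q (by rw [factorization_card hG, hQ]) : Sylow 43 G)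
    (Sylow.ofCard P (by rw [factorization_card hG, hP]))
  refine ⟨g, fun x => ?_⟩
  have h1 := congrArg (fun S : Sylow 43 G => (S : Subgroup G)) hg
  change MulAut.conj g • Q = P at h1
  rw [← h1, ← MulAut.conj_apply, ← MulAut.smul_def, Subgroup.smul_mem_pointwise_smul_iff]

theorem exists_isLocal (hG : ODPattern G) : ∃ P Z : Subgroup G, IsLocal P Z := by
  obtain ⟨X, hX1, hsum, hX⟩ := exists_local_character hG
  obtain ⟨g, -, hy, hdvd⟩ := dvd_centralizer_of_mem_nbrs (p := 43) (q := 2)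
    (by rw [nbrs_43 hG]; simp)
  set y := g ^ 2
  have hone : ∀ {m : ℕ}, 22 ∣ m → m ≠ 43 ^ 2 ∧ m ≠ 43 ^ 3 := by omega
  have hyX : ∀ z ∈ Subgroup.zpowers y, z ≠ 1 →
      X z = -43 ∧ (Nat.card (Subgroup.centralizer {z}) = 43 ^ 3 * 22 ∨
        Nat.card (Subgroup.centralizer {z}) = 43 ^ 3 * 44) := by
    intro z hz hz1
    have h1 := card_centralizer_of_mem_zpowers hy hz hz1
    refine (hX z ?_ hz1).resolve_left ?_
    · refine orderOf_dvd_iff_pow_eq_one.1 ((orderOf_dvd_of_mem_zpowers hz).trans ?_)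
      rw [hy]
      norm_num
    · rintro ⟨-, h⟩
      rw [h1] at h
      omega
  have hy1 : y ≠ 1 := by
    intro h
    rw [h, orderOf_one] at hy
    norm_num at hy
  have hm := (hyX y (Subgroup.mem_zpowers y) hy1).2
  obtain ⟨P, hPy, hyP, hP⟩ : ∃ P : Subgroup G, P ≤ Subgroup.centralizer {y} ∧ y ∈ P ∧
      Nat.card P = 43 ^ 3 := by
    rcases hm with h | h
    · exact exists_sylow_of_centralizer hy (by norm_num) h
    · exact exists_sylow_of_centralizer hy (by norm_num) h
  have hZP : Subgroup.zpowers y ≤ P := (Subgroup.zpowers_le).2 hyP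
  have hcom : ∀ z ∈ Subgroup.zpowers y, ∀ x ∈ P, Commute z x := by
    rintro _ ⟨j, rfl⟩ x hx
    exact (mem_centralizer.1 (hPy hx)).zpow_left j
  have hXP : ∀ x ∈ P, x ∉ Subgroup.zpowers y → X x = 0 ∧
      (Nat.card (Subgroup.centralizer {x}) = 43 ^ 2 ∨
        Nat.card (Subgroup.centralizer {x}) = 43 ^ 3) := by
    intro x hx hxZ
    refine (hX x (pow_eq_one_of_mem hP hx) fun h => hxZ (h ▸ one_mem _)).resolve_right ?_
    rintro ⟨h, -⟩
    refine hxZ (mem_zpowers_of_character_eq hyP hy hX1 (fun a ha ha1 => ?_)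
      (fun z hz hz1 => (hyX z hz hz1).1) ?_ hx h)
    · exact (hX a (pow_eq_one_of_mem hP ha) ha1).imp And.left And.left
    · intro _
      obtain ⟨m, hm⟩ := hsum P 1
      refine ⟨m, ?_⟩
      rw [← Nat.card_eq_fintype_card, hP] at hm
      simp only [MonoidHom.one_apply, Units.val_one, one_mul] at hm
      exact_mod_cast hm
  have hnc := exists_not_commute hP hyP hy hX1 (fun x hx h => (hXP x hx h).1)
    (fun z hz hz1 => (hyX z hz hz1).1) (hsum P)
  have hcZ : Nat.card (Subgroup.zpowers y) = 43 := by rw [Nat.card_zpowers, hy]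
  refine ⟨P, Subgroup.zpowers y, hP, hcZ, hZP, hcom, ?_, fun z hz hz1 => (hyX z hz hz1).2, ?_⟩
  · intro z hz hz1 w hw hw1
    rw [card_centralizer_of_mem_zpowers hy hz hz1, card_centralizer_of_mem_zpowers hy hw hw1]
  · intro x hx hxZ
    refine (hXP x hx hxZ).2.resolve_right fun h => ?_
    obtain ⟨g, hg⟩ := exists_conj_le hG hP h
    have h1 : g * x * g⁻¹ ∈ P := (hg x).1 (mem_centralizer.2 (Commute.refl x))
    have h2 : g * x * g⁻¹ ∈ Subgroup.zpowers y := by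
      refine mem_of_commute_all hP hcZ hZP hcom hnc h1 fun a ha => ?_
      have h3 : g⁻¹ * a * g ∈ Subgroup.centralizer {x} := (hg _).2 (by simpa [mul_assoc] using ha)
      have h4 := (mem_centralizer.1 h3).map (MulAut.conj g)
      simpa [mul_assoc] using h4
    have h3 := (hyX _ h2 (by
      rw [Ne, conj_eq_one_iff]
      rintro rfl
      exact hxZ (one_mem _))).2
    rw [card_centralizer_conj, h] at h3
    omega

end

end U343

namespace U343

open WedderburnChar
open scoped Pointwise

theorem card_dvd_card_of_free {P α : Type*} [Group P] [MulAction P α]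
    (h : ∀ (x : P) (a : α), x • a = a → x = 1) : Nat.card P ∣ Nat.card α := by
  have h1 := Nat.card_congr (MulAction.selfEquivOrbitsQuotientProd (G := P) (X := α) fun b =>
    (Subgroup.eq_bot_iff_forall _).2 fun x hx => h x b hx)
  rw [h1, Nat.card_prod]
  exact dvd_mul_left _ _

theorem exists_smul_eq_of_free {P α : Type*} [Group P] [MulAction P α] [Finite α]
    (h : ∀ (x : P) (a : α), x • a = a → x = 1) (hc : Nat.card P = Nat.card α) (a b : α) :
    ∃ x : P, x • a = b := by
  have : Function.Injective fun x : P => x • a := fun x y hxy => by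
    have := h (y⁻¹ * x) a (by simpa [mul_smul, inv_smul_eq_iff] using hxy)
    rw [inv_mul_eq_one] at this
    exact this.symm
  have : Finite P := Finite.of_injective _ this
  exact (Function.Injective.bijective_of_nat_card_le ‹_› hc.ge).2 b

section

variable {G : Type*} [Group G] [Finite G] {P Z : Subgroup G}

theorem commute_of_mem_normalizer (hZ : Nat.card Z = 43) {x : G}
    (hx : x ∈ Subgroup.normalizer (Z : Set G)) {n : ℕ} (hn : n.Coprime 42) (hxn : x ^ n = 1) {z : G}
    (hz : z ∈ Z) : Commute x z := by
  have : Fact (Nat.Prime 43) := ⟨by norm_num⟩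
  have := isCyclic_of_prime_card hZ
  have h1 : Nat.card (MulAut Z) = 42 := by
    rw [IsCyclic.card_mulAut, hZ, Nat.totient_prime (by norm_num)]
  let f := Z.normalizerMonoidHom ⟨x, hx⟩
  have h2 : f ^ n = 1 := by
    rw [← map_pow, show (⟨x, hx⟩ : Subgroup.normalizer (Z : Set G)) ^ n = 1 from Subtype.ext hxn,
      map_one]
  have h3 : f ^ 42 = 1 := h1 ▸ pow_card_eq_one'
  have h4 : f = 1 := orderOf_eq_one_iff.1 (Nat.eq_one_of_dvd_coprimes hn
    (orderOf_dvd_of_pow_eq_one h2) (orderOf_dvd_of_pow_eq_one h3))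
  have h5 := congrArg Subtype.val (DFunLike.congr_fun h4 ⟨z, hz⟩)
  exact mul_inv_eq_iff_eq_mul.1 h5

namespace IsLocal

variable (h : IsLocal P Z)
include h

theorem zpowers_eq {z : G} (hz : z ∈ Z) (hz1 : z ≠ 1) : Subgroup.zpowers z = Z := by
  have : Fact (Nat.Prime 43) := ⟨by norm_num⟩
  refine Subgroup.eq_of_le_of_card_ge ((Subgroup.zpowers_le).2 hz) ?_
  rw [Nat.card_zpowers, h.card_Z]
  have h1 : z ^ 43 = 1 := by
    have := pow_card_eq_one' (x := (⟨z, hz⟩ : Z))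
    rw [h.card_Z] at this
    exact congrArg Subtype.val this
  exact (orderOf_eq_prime h1 hz1).ge

theorem mem_centralizer_iff {z : G} (hz : z ∈ Z) (hz1 : z ≠ 1) {x : G} :
    x ∈ Subgroup.centralizer {z} ↔ ∀ w ∈ Z, Commute x w := by
  rw [← centralizer_zpowers, h.zpowers_eq hz hz1, Subgroup.mem_centralizer_iff]
  exact forall₂_congr fun w _ => eq_comm

theorem centralizer_le {x : G} (hx : x ∈ P) (hxZ : x ∉ Z) : Subgroup.centralizer {x} ≤ P := by
  set D := Subgroup.centralizer {x} ⊓ P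
  have h1 : Z ≤ D := fun z hz => ⟨mem_centralizer.2 (h.commute z hz x hx).symm, h.le hz⟩
  have h2 : x ∈ D := ⟨mem_centralizer.2 (Commute.refl x), hx⟩
  have h3 : Nat.card D ∣ 43 ^ 2 := h.card_centralizer x hx hxZ ▸ Subgroup.card_dvd_of_le inf_le_left
  have h4 : Nat.card D ≠ 43 := fun h4 => hxZ
    (Subgroup.eq_of_le_of_card_ge h1 (by rw [h4, h.card_Z]) ▸ h2)
  have h5 : 43 ∣ Nat.card D := h.card_Z ▸ Subgroup.card_dvd_of_le h1
  have h6 : Nat.card D = 43 ^ 2 := by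
    obtain ⟨k, hk, hk2⟩ := (Nat.dvd_prime_pow (by norm_num)).1 h3
    rw [hk2] at h4 h5 ⊢
    obtain rfl | rfl | rfl : k = 0 ∨ k = 1 ∨ k = 2 := by omega
    · norm_num at h5
    · norm_num at h4
    · rfl
  have h7 : D = Subgroup.centralizer {x} :=
    Subgroup.eq_of_le_of_card_ge inf_le_left (by rw [h6, h.card_centralizer x hx hxZ])
  rw [← h7]
  exact inf_le_right

theorem exists_ne_one : ∃ z ∈ Z, z ≠ 1 := by
  have : Nontrivial Z := Finite.one_lt_card_iff_nontrivial.1 (by rw [h.card_Z]; norm_num)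
  obtain ⟨z, hz⟩ := exists_ne (1 : Z)
  exact ⟨z, z.2, by simpa using hz⟩

omit [Finite G] in
theorem mem_of_conj_mem {z g : G} (hz : z ∈ Z) (hz1 : z ≠ 1) (hg : g * z * g⁻¹ ∈ P) :
    g * z * g⁻¹ ∈ Z := by
  by_contra hn
  have h1 := h.card_centralizer _ hg hn
  rw [card_centralizer_conj] at h1
  rcases h.card_centralizer_Z z hz hz1 with h2 | h2 <;> omega

theorem exists_conj_mem {z w : G} (hz : z ∈ Z) (hz1 : z ≠ 1) (hw : w ∈ Subgroup.centralizer {z})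
    (hw43 : w ^ 43 ^ 3 = 1) : ∃ c ∈ Subgroup.centralizer {z}, c * w * c⁻¹ ∈ P := by
  have : Fact (Nat.Prime 43) := ⟨by norm_num⟩
  have hPC : P ≤ Subgroup.centralizer {z} := fun x hx => mem_centralizer.2 (h.commute z hz x hx)
  have hfac : (Nat.card (Subgroup.centralizer {z})).factorization 43 = 3 := by
    have key : ∀ m, ¬ 43 ∣ m → (43 ^ 3 * m).factorization 43 = 3 := fun m hm => by
      rw [Nat.factorization_mul (by norm_num) (by rintro rfl; simp at hm),
        Nat.Prime.factorization_pow (by norm_num)]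
      simp [Nat.factorization_eq_zero_of_not_dvd hm]
    rcases h.card_centralizer_Z z hz hz1 with h2 | h2 <;> rw [h2] <;> exact key _ (by norm_num)
  let Q : Sylow 43 (Subgroup.centralizer {z}) := Sylow.ofCard (P.subgroupOf _) (by
    rw [hfac, ← h.card_P]; exact Nat.card_congr (Subgroup.subgroupOfEquivOfLe hPC).toEquiv)
  let w' : Subgroup.centralizer {z} := ⟨w, hw⟩
  have hwP : IsPGroup 43 (Subgroup.zpowers w') := by
    obtain ⟨k, -, hk⟩ := (Nat.dvd_prime_pow (by norm_num)).1 (orderOf_dvd_of_pow_eq_one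
      (show w' ^ 43 ^ 3 = 1 from Subtype.ext hw43))
    exact IsPGroup.of_card (n := k) (by rw [Nat.card_zpowers, hk])
  obtain ⟨R, hR⟩ := hwP.exists_le_sylow
  obtain ⟨c, hc⟩ := MulAction.exists_smul_eq (Subgroup.centralizer {z}) R Q
  refine ⟨c, c.2, ?_⟩
  have h1 : MulAut.conj c • (R : Subgroup (Subgroup.centralizer {z})) = P.subgroupOf _ :=
    congrArg (fun S : Sylow 43 _ => (S : Subgroup (Subgroup.centralizer {z}))) hc
  have h2 : MulAut.conj c • w' ∈ P.subgroupOf (Subgroup.centralizer {z}) := by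
    rw [← h1]
    exact Subgroup.smul_mem_pointwise_smul _ _ _ (hR (Subgroup.mem_zpowers w'))
  exact h2

theorem mem_of_commute_conj {x z g : G} (hx : x ∈ P) (hx1 : x ≠ 1) (hz : z ∈ Z) (hz1 : z ≠ 1)
    (hc : Commute x (g * z * g⁻¹)) : g * z * g⁻¹ ∈ Z := by
  by_cases hxZ : x ∈ Z
  · obtain ⟨c, hc1, hc2⟩ := h.exists_conj_mem hxZ hx1 (mem_centralizer.2 hc) (by
      rw [conj_pow, pow_eq_one_of_mem h.card_P (h.le hz), mul_one, mul_inv_cancel])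
    have h1 : c * (g * z * g⁻¹) * c⁻¹ = (c * g) * z * (c * g)⁻¹ := by group
    rw [h1] at hc2
    have h2 := h.mem_of_conj_mem hz hz1 hc2
    rw [← h1] at h2
    have h3 := (h.mem_centralizer_iff hxZ hx1).1 hc1 _ h2
    have h4 : c * (g * z * g⁻¹) * c⁻¹ = g * z * g⁻¹ := by
      have h5 : Commute c (g * z * g⁻¹) := by simpa [mul_assoc] using h3.map (MulAut.conj c⁻¹)
      rw [h5.eq, mul_inv_cancel_right]
    rwa [h4] at h2
  · exact h.mem_of_conj_mem hz hz1 (h.centralizer_le hx hxZ (mem_centralizer.2 hc))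

omit h in
theorem mem_normalizer_of_conj_mem {g : G} (hg : ∀ z ∈ Z, g * z * g⁻¹ ∈ Z) :
    g ∈ Subgroup.normalizer (Z : Set G) := by
  have h1 : Z.map (MulAut.conj g).toMonoidHom ≤ Z := by
    rintro _ ⟨z, hz, rfl⟩
    exact hg z hz
  have h2 : Z.map (MulAut.conj g).toMonoidHom = Z := Subgroup.eq_of_le_of_card_ge h1 (by
    rw [Nat.card_congr (Subgroup.equivMapOfInjective Z (MulAut.conj g).toMonoidHom (MulAut.conj g).injective).toEquiv])
  rw [Subgroup.mem_normalizer_iff]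
  refine fun x => ⟨hg x, fun hx => ?_⟩
  have hx2 : g * x * g⁻¹ ∈ Z.map (MulAut.conj g).toMonoidHom := by rw [h2]; exact hx
  obtain ⟨z, hz, hzx⟩ := hx2
  have : z = x := (MulAut.conj g).injective hzx
  exact this ▸ hz

theorem mem_normalizer_of_fix {x g : G} (hx : x ∈ P) (hx1 : x ≠ 1)
    (hg : g⁻¹ * x * g ∈ Subgroup.normalizer (Z : Set G)) : g ∈ Subgroup.normalizer (Z : Set G) := by
  refine mem_normalizer_of_conj_mem fun z hz => ?_
  by_cases hz1 : z = 1
  · simp [hz1]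
  refine h.mem_of_commute_conj hx hx1 hz hz1 ?_
  have h1 := commute_of_mem_normalizer h.card_Z hg (n := 43 ^ 3) (by norm_num) (by
    have := conj_pow (i := 43 ^ 3) (a := g⁻¹) (b := x)
    rw [inv_inv] at this
    rw [this, pow_eq_one_of_mem h.card_P hx]; simp) hz
  have := h1.map (MulAut.conj g)
  simpa [mul_assoc] using this

end IsLocal

end

end U343

namespace U343

open WedderburnChar
open scoped Pointwise

theorem card_eq_of_dvd {n : ℕ} (h1 : n ∣ 81312 * 1807 * 79507) (h2 : 79507 ∣ n - 1) (h3 : 1 < n)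
    (h4 : 43 ^ 3 * 22 * n ∣ 81312 * 1807 * 79507) : n = 79508 := by
  have h5 : n ∣ 3696 * 1807 := by
    rw [show 81312 * 1807 * 79507 = 43 ^ 3 * 22 * (3696 * 1807) by norm_num] at h4
    exact Nat.dvd_of_mul_dvd_mul_left (by norm_num) h4
  obtain ⟨j, hj⟩ := h2
  obtain rfl : n = 79507 * j + 1 := by omega
  have h6 := Nat.le_of_dvd (by norm_num) h5
  have h7 : j < 85 := by omega
  have key : ∀ j < 85, 79507 * j + 1 ∣ 3696 * 1807 → j = 0 ∨ j = 1 := by decide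
  rcases key j h7 h5 with rfl | rfl
  · omega
  · rfl

section

variable {G : Type*} [Group G] [Finite G] {P Z : Subgroup G}

namespace IsLocal

variable (h : IsLocal P Z)
include h

theorem le_normalizer : P ≤ Subgroup.normalizer (Z : Set G) := fun x hx =>
  mem_normalizer_of_conj_mem fun z hz => by
    rw [← (h.commute z hz x hx).eq, mul_inv_cancel_right]
    exact hz

/-- The set of conjugates of `Z` other than `Z`, as a `P`-set. -/
def others : SubMulAction P (G ⧸ Subgroup.normalizer (Z : Set G)) where
  carrier := {ω | ω ≠ ((1 : G) : G ⧸ Subgroup.normalizer (Z : Set G))}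
  smul_mem' := by
    rintro ⟨x, hx⟩ ω hω heq
    apply hω
    have h1 : x • ω = ((1 : G) : G ⧸ Subgroup.normalizer (Z : Set G)) := heq
    rw [smul_eq_iff_eq_inv_smul] at h1
    rw [h1, MulAction.Quotient.smul_coe, QuotientGroup.eq]
    simpa using h.le_normalizer hx

theorem eq_one_of_smul_others (x : P) (ω : h.others) (hx : x • ω = ω) : x = 1 := by
  obtain ⟨ω, hω⟩ := ω
  obtain ⟨g, rfl⟩ := QuotientGroup.mk_surjective ω
  by_contra hx1
  have h1 : (((x : G) * g : G) : G ⧸ Subgroup.normalizer (Z : Set G)) = g := congrArg Subtype.val hx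
  rw [eq_comm, QuotientGroup.eq] at h1
  refine hω (QuotientGroup.eq.2 ?_)
  simpa using h.mem_normalizer_of_fix x.2 (by simpa using hx1) (by simpa [mul_assoc] using h1)

theorem card_others : Nat.card h.others + 1 = (Subgroup.normalizer (Z : Set G)).index := by
  classical
  have h1 := Set.ncard_add_ncard_compl {((1 : G) : G ⧸ Subgroup.normalizer (Z : Set G))}
  rw [Set.ncard_singleton, add_comm] at h1
  rw [Subgroup.index, ← h1]
  rfl

omit [Finite G] in
theorem card_centralizer_dvd {z : G} (hz : z ∈ Z) (hz1 : z ≠ 1) :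
    43 ^ 3 * 22 ∣ Nat.card (Subgroup.centralizer {z}) := by
  rcases h.card_centralizer_Z z hz hz1 with h2 | h2 <;> norm_num [h2]

theorem centralizer_le_normalizer {z : G} (hz : z ∈ Z) (hz1 : z ≠ 1) :
    Subgroup.centralizer {z} ≤ Subgroup.normalizer (Z : Set G) := fun x hx =>
  mem_normalizer_of_conj_mem fun w hw => by
    rw [((h.mem_centralizer_iff hz hz1).1 hx w hw).eq, mul_inv_cancel_right]
    exact hw

theorem index_normalizer (hG : ODPattern G) : (Subgroup.normalizer (Z : Set G)).index = 79508 := by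
  obtain ⟨z, hz, hz1⟩ := h.exists_ne_one
  have hcard : Nat.card G = 81312 * 1807 * 79507 := by rw [hG.card]; norm_num
  refine card_eq_of_dvd ?_ ?_ ?_ ?_
  · exact hcard ▸ Subgroup.index_dvd_card _
  · rw [← h.card_others, Nat.add_sub_cancel]
    have := card_dvd_card_of_free h.eq_one_of_smul_others
    rwa [h.card_P] at this
  · have h0 : (Subgroup.normalizer (Z : Set G)).index ≠ 0 := Subgroup.index_ne_zero_of_finite
    by_contra! h1
    have h2 : Subgroup.normalizer (Z : Set G) = ⊤ := Subgroup.index_eq_one.1 (by omega)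
    have : Fact (Nat.Prime 139) := ⟨by norm_num⟩
    obtain ⟨x, hx⟩ := exists_prime_orderOf_dvd_card' (G := G) 139 (by rw [hcard]; norm_num)
    have h3 := commute_of_mem_normalizer h.card_Z (x := x) (by rw [h2]; trivial) (n := 139)
      (by norm_num) (by rw [← hx, pow_orderOf_eq_one]) hz
    have h4 : orderOf x ∣ Nat.card (Subgroup.centralizer {z}) := by
      rw [← Nat.card_zpowers]
      exact Subgroup.card_dvd_of_le ((Subgroup.zpowers_le).2 (mem_centralizer.2 h3.symm))
    rw [hx] at h4
    rcases h.card_centralizer_Z z hz hz1 with h2 | h2 <;> rw [h2] at h4 <;> norm_num at h4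
  · rw [← hcard, ← Subgroup.card_mul_index (Subgroup.normalizer (Z : Set G))]
    exact mul_dvd_mul_right ((h.card_centralizer_dvd hz hz1).trans
      (Subgroup.card_dvd_of_le (h.centralizer_le_normalizer hz hz1))) _

theorem card_normalizer (hG : ODPattern G) :
    Nat.card (Subgroup.normalizer (Z : Set G)) = 43 ^ 3 * 1848 := by
  have h1 := Subgroup.card_mul_index (Subgroup.normalizer (Z : Set G))
  rw [h.index_normalizer hG, hG.card] at h1
  omega

theorem exists_mem_smul_eq (hG : ODPattern G) {a b : G ⧸ Subgroup.normalizer (Z : Set G)}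
    (ha : a ≠ ((1 : G) : G ⧸ Subgroup.normalizer (Z : Set G)))
    (hb : b ≠ ((1 : G) : G ⧸ Subgroup.normalizer (Z : Set G))) : ∃ x ∈ P, x • a = b := by
  obtain ⟨x, hx⟩ := exists_smul_eq_of_free h.eq_one_of_smul_others (by
    have := h.card_others
    rw [h.index_normalizer hG] at this
    rw [h.card_P]
    omega) ⟨a, ha⟩ ⟨b, hb⟩
  exact ⟨x, x.2, congrArg Subtype.val hx⟩

end IsLocal

end

end U343

namespace U343

open WedderburnChar
open scoped Pointwise

theorem sq_dvd_of_dvd_factorial {n d : ℕ} (hn : n = 1 ∨ n = 44) (h : 43 ^ 3 ∣ n.factorial * d) :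
    43 ^ 2 ∣ d := by
  rcases hn with rfl | rfl
  · simp only [Nat.factorial_one, one_mul] at h
    exact dvd_trans (by norm_num) h
  · obtain ⟨m, hm, hm2⟩ : ∃ m, Nat.factorial 44 = 43 * m ∧ ¬ 43 ∣ m :=
      ⟨44 * Nat.factorial 42, by rw [Nat.factorial_succ, Nat.factorial_succ]; ring, fun h1 => by
        rcases (Nat.Prime.dvd_mul (by norm_num)).1 h1 with h2 | h2
        · norm_num at h2
        · rw [Nat.Prime.dvd_factorial (by norm_num)] at h2
          norm_num at h2⟩
    rw [hm, pow_succ', mul_assoc] at h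
    have h2 := Nat.dvd_of_mul_dvd_mul_left (by norm_num) h
    exact Nat.Coprime.dvd_of_dvd_mul_left
      (((Nat.Prime.coprime_iff_not_dvd (by norm_num)).2 hm2).pow_left 2) h2

section

variable {G : Type*} [Group G] [Finite G] {P Z : Subgroup G}

namespace IsLocal

variable (h : IsLocal P Z)
include h

theorem conj_mem_of_mem_centralizer {z g x : G} (hz : z ∈ Z) (hz1 : z ≠ 1)
    (hg : g ∈ Subgroup.centralizer {z}) (hx : x ∈ P) : g * x * g⁻¹ ∈ P := by
  have : Fact (Nat.Prime 43) := ⟨by norm_num⟩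
  set C := Subgroup.centralizer {z}
  have hPC : P ≤ C := fun x hx => mem_centralizer.2 (h.commute z hz x hx)
  obtain ⟨c, hc, hcard⟩ : ∃ c, (c = 22 ∨ c = 44) ∧ Nat.card C = 43 ^ 3 * c := by
    rcases h.card_centralizer_Z z hz hz1 with h2 | h2
    exacts [⟨22, Or.inl rfl, h2⟩, ⟨44, Or.inr rfl, h2⟩]
  have hcardP : Nat.card (P.subgroupOf C) = 43 ^ 3 := by
    rw [← h.card_P]; exact Nat.card_congr (Subgroup.subgroupOfEquivOfLe hPC).toEquiv
  have hfac : (Nat.card C).factorization 43 = 3 := by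
    have key : ∀ m, ¬ 43 ∣ m → (43 ^ 3 * m).factorization 43 = 3 := fun m hm => by
      rw [Nat.factorization_mul (by norm_num) (by rintro rfl; simp at hm),
        Nat.Prime.factorization_pow (by norm_num)]
      simp [Nat.factorization_eq_zero_of_not_dvd hm]
    rcases hc with rfl | rfl <;> rw [hcard] <;> exact key _ (by norm_num)
  let Q : Sylow 43 C := Sylow.ofCard (P.subgroupOf C) (by rw [hfac, hcardP])
  have hQ : ∀ y : C, y ∈ (Q : Subgroup C) ↔ (y : G) ∈ P := fun y => Iff.rfl
  set n := Nat.card (Sylow 43 C) with hn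
  have hn1 : n ∣ c := by
    have h1 := Sylow.card_dvd_index Q
    have h2 := Subgroup.card_mul_index (P.subgroupOf C)
    rw [hcardP, hcard] at h2
    rwa [show (Q : Subgroup C).index = c from Nat.eq_of_mul_eq_mul_left (by norm_num) h2] at h1
  have hn2 : n ≡ 1 [MOD 43] := card_sylow_modEq_one 43 C
  have hn3 : n = 1 ∨ (n = 44 ∧ c = 44) := by
    have h1 : n ≤ 44 := (Nat.le_of_dvd (by omega) hn1).trans (by omega)
    have h2 : n % 43 = 1 := hn2
    obtain h3 | h3 : n = 1 ∨ n = 44 := by omega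
    · exact Or.inl h3
    · refine Or.inr ⟨h3, ?_⟩
      rw [h3] at hn1
      rcases hc with rfl | rfl
      · norm_num at hn1
      · rfl
  let f : C →* Equiv.Perm (Sylow 43 C) := MulAction.toPermHom C (Sylow 43 C)
  have hker : ∀ y : C, y ∈ f.ker → y ^ 43 ^ 3 = 1 → (y : G) ∈ P := by
    intro y hy hy2
    have h1 : y • Q = Q := DFunLike.congr_fun (MonoidHom.mem_ker.1 hy) Q
    obtain ⟨k, -, hk⟩ := (Nat.dvd_prime_pow (by norm_num)).1 (orderOf_dvd_of_pow_eq_one hy2)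
    have h2 : IsPGroup 43 (Subgroup.zpowers y) :=
      IsPGroup.of_card (n := k) (by rw [Nat.card_zpowers, hk])
    have h3 : y ∈ Subgroup.zpowers y ⊓ Subgroup.normalizer (Q : Set C) :=
      ⟨Subgroup.mem_zpowers y, Sylow.smul_eq_iff_mem_normalizer.1 h1⟩
    rw [IsPGroup.inf_normalizer_sylow h2 Q] at h3
    exact h3.2
  let D : Subgroup P := (f.comp (Subgroup.inclusion hPC)).ker
  have hD : 43 ^ 2 ∣ Nat.card D := by
    refine sq_dvd_of_dvd_factorial (n := n) (by omega) ?_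
    have h1 := Subgroup.card_mul_index D
    rw [h.card_P, Subgroup.index_ker] at h1
    rw [← h1, mul_comm]
    refine mul_dvd_mul_right ((Subgroup.card_subgroup_dvd_card _).trans ?_) _
    rw [Nat.card_perm]
  have hconj : ∀ y : C, ∀ d : P, d ∈ D → ∃ d' ∈ D, (d' : G) = y * d * y⁻¹ := by
    intro y d hd
    have h1 : y * (Subgroup.inclusion hPC d) * y⁻¹ ∈ f.ker :=
      (MonoidHom.normal_ker f).conj_mem _ (show Subgroup.inclusion hPC d ∈ f.ker from hd) y
    have h2 := hker _ h1 (Subtype.ext (by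
      change ((y : G) * d * (y : G)⁻¹) ^ 43 ^ 3 = 1
      rw [conj_pow, pow_eq_one_of_mem h.card_P d.2, mul_one, mul_inv_cancel]))
    exact ⟨⟨_, h2⟩, h1, rfl⟩
  have hDcard : Nat.card D = 43 ^ 2 ∨ Nat.card D = 43 ^ 3 := by
    have h1 : Nat.card D ∣ 43 ^ 3 := h.card_P ▸ Subgroup.card_subgroup_dvd_card D
    obtain ⟨k, hk, hk2⟩ := (Nat.dvd_prime_pow (by norm_num)).1 h1
    rw [hk2] at hD ⊢
    rw [Nat.pow_dvd_pow_iff_le_right (by norm_num)] at hD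
    obtain rfl | rfl : k = 2 ∨ k = 3 := by omega
    exacts [Or.inl rfl, Or.inr rfl]
  have hPD : Nat.card D = 43 ^ 3 → g * x * g⁻¹ ∈ P := fun h1 => by
    have h2 : D = ⊤ := Subgroup.eq_top_of_card_eq D (by rw [h1, h.card_P])
    obtain ⟨d, -, hd⟩ := hconj ⟨g, hg⟩ ⟨x, hx⟩ (h2 ▸ Subgroup.mem_top _)
    change (d : G) = g * x * g⁻¹ at hd
    exact hd ▸ d.2
  rcases hn3 with hn3 | ⟨-, hc4⟩
  · have h1 : Subsingleton (Sylow 43 C) := (Nat.card_eq_one_iff_unique.1 hn3).1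
    have h2 : D = ⊤ := (Subgroup.eq_top_iff' _).2 fun d => MonoidHom.mem_ker.2 <|
      Equiv.ext fun S => Subsingleton.elim _ _
    exact hPD (by rw [h2, Subgroup.card_top, h.card_P])
  · rcases hDcard with h1 | h1
    · exfalso
      obtain ⟨d, hd, hdZ⟩ : ∃ d : P, d ∈ D ∧ (d : G) ∉ Z := by
        by_contra! h2
        have h3 : D.map P.subtype ≤ Z := by
          rintro _ ⟨d, hd, rfl⟩
          exact h2 d hd
        have h4 := Subgroup.card_dvd_of_le h3
        rw [Nat.card_congr (Subgroup.equivMapOfInjective D _ P.subtype_injective).toEquiv.symm,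
          h1, h.card_Z] at h4
        norm_num at h4
      let dC : C := Subgroup.inclusion hPC d
      have h2 : Nat.card (ConjAct (C) ⧸ MulAction.stabilizer (ConjAct C) dC) ≤ Nat.card D := by
        rw [← Nat.card_congr (MulAction.orbitEquivQuotientStabilizer (ConjAct C) dC)]
        have hex : ∀ w : MulAction.orbit (ConjAct C) dC, ∃ d' : D, ((d' : P) : G) = (w : C) := by
          rintro ⟨_, y, rfl⟩
          obtain ⟨d', hd', hd2⟩ := hconj (ConjAct.ofConjAct y) d hd
          exact ⟨⟨d', hd'⟩, hd2⟩
        choose e he using hex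
        refine Nat.card_le_card_of_injective e fun w w' hw => Subtype.ext (Subtype.ext ?_)
        rw [← he, ← he, hw]
      have h3 : Nat.card (MulAction.stabilizer (ConjAct C) dC) ≤ 43 ^ 2 := by
        rw [← h.card_centralizer d d.2 hdZ]
        refine Nat.card_le_card_of_injective
          (fun y => ⟨((ConjAct.ofConjAct (y : ConjAct C) : C) : G), mem_centralizer.2 ?_⟩) ?_
        · have h4 : ConjAct.ofConjAct (y : ConjAct C) * dC * (ConjAct.ofConjAct (y : ConjAct C))⁻¹ = dC :=
            y.2
          have h5 := congrArg Subtype.val (mul_inv_eq_iff_eq_mul.1 h4)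
          exact h5.symm
        · intro y y' hy
          exact Subtype.ext (ConjAct.ofConjAct.injective (Subtype.ext (Subtype.mk.inj hy)))
      have h4 := Subgroup.card_eq_card_quotient_mul_card_subgroup
        (MulAction.stabilizer (ConjAct C) dC)
      rw [show Nat.card (ConjAct C) = Nat.card C from rfl, hcard, hc4] at h4
      have h5 := Nat.mul_le_mul h2 h3
      rw [← h4, h1] at h5
      norm_num at h5
    · exact hPD h1

/-- The local subgroup `P` is normal in the normalizer of its centre `Z`. -/
theorem conj_mem {b x : G} (hb : b ∈ Subgroup.normalizer (Z : Set G))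
    (hx : x ∈ P) : b * x * b⁻¹ ∈ P := by
  obtain ⟨z, hz, hz1⟩ := h.exists_ne_one
  have h1 : ∀ w ∈ Z, Commute (b * x * b⁻¹) w := fun w hw => by
    have h2 : b⁻¹ * w * b ∈ Z := by
      have := conj_mem_of_mem_normalizer (inv_mem hb) hw
      rwa [inv_inv] at this
    have h3 := (h.commute _ h2 x hx).map (MulAut.conj b)
    have h4 : MulAut.conj b (b⁻¹ * w * b) = w := by simp [mul_assoc]
    rw [h4] at h3
    exact h3.symm
  obtain ⟨c, hc, hcP⟩ := h.exists_conj_mem hz hz1 ((h.mem_centralizer_iff hz hz1).2 h1) (by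
    rw [conj_pow, pow_eq_one_of_mem h.card_P hx, mul_one, mul_inv_cancel])
  have := h.conj_mem_of_mem_centralizer hz hz1 (inv_mem hc) hcP
  simpa [mul_assoc] using this

end IsLocal

end

end U343

namespace U343

open WedderburnChar

/-- An element of prime order acting by conjugation on a set of prime-to-`q` size fixes a point. -/
theorem exists_commute_of_conj_mem {G : Type*} [Group G] {g : G} {q : ℕ} (hq : q.Prime)
    (hg : g ^ q = 1) {S : Set G} (hS : ∀ y ∈ S, g * y * g⁻¹ ∈ S) (hfin : S.Finite)
    (hcard : ¬ q ∣ Nat.card S) : ∃ y ∈ S, Commute g y := by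
  classical
  have : Fact q.Prime := ⟨hq⟩
  have := hfin.fintype
  let f : Function.End S := fun y => ⟨g * y * g⁻¹, hS y y.2⟩
  have hf : ∀ (n : ℕ) (y : S), ((f ^ n) y : G) = g ^ n * y * (g ^ n)⁻¹ := by
    intro n
    induction n with
    | zero => intro y; simp [show (1 : Function.End S) y = y from rfl]
    | succ n ih =>
      intro y
      rw [pow_succ', pow_succ']
      change g * ((f ^ n) y : G) * g⁻¹ = _
      rw [ih]
      group
  have h1 := Equiv.Perm.card_fixedPoints_modEq (f := f) (p := q) (n := 1) (by
    funext y
    refine Subtype.ext ?_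
    rw [hf, pow_one, hg]
    simp [show (1 : Function.End S) y = y from rfl])
  have h2 : Fintype.card (Function.fixedPoints f) ≠ 0 := by
    intro h0
    rw [h0] at h1
    exact hcard (Nat.card_eq_fintype_card (α := S) ▸ (Nat.modEq_zero_iff_dvd.1 h1))
  obtain ⟨⟨y, hy⟩⟩ := Fintype.card_pos_iff.1 (Nat.pos_of_ne_zero h2)
  exact ⟨y, y.2, mul_inv_eq_iff_eq_mul.1 (congrArg Subtype.val hy)⟩

section

variable {G : Type*} [Group G] [Finite G] {P Z H : Subgroup G}

namespace IsLocal

omit [Finite G] in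
theorem pow_43_of_mem (h : IsLocal P Z) {w : G} (hw : w ∈ Z) : w ^ 43 = 1 := by
  have := pow_card_eq_one' (x := (⟨w, hw⟩ : Z))
  rw [h.card_Z] at this
  exact congrArg Subtype.val this

omit [Finite G] in
theorem exists_mul_eq (h : IsLocal P Z) {x y : G} (hx : x ∈ P) (hy : y ∈ P) :
    ∃ w ∈ Z, x * y = y * x * w := by
  have : Fact (Nat.Prime 43) := ⟨by norm_num⟩
  have hN : (Z.subgroupOf P).Normal := ⟨fun z hz g => by
    rw [Subgroup.mem_subgroupOf] at hz ⊢
    simpa [← (h.commute z hz g g.2).eq] using hz⟩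
  have hc : Nat.card (P ⧸ Z.subgroupOf P) = 43 ^ 2 := by
    have h1 := Subgroup.card_eq_card_quotient_mul_card_subgroup (Z.subgroupOf P)
    rw [h.card_P, Nat.card_congr (Subgroup.subgroupOfEquivOfLe h.le).toEquiv, h.card_Z] at h1
    omega
  have hcomm := (IsPGroup.isMulCommutative_of_card_eq_prime_sq hc).is_comm.comm
  have h2 := hcomm (QuotientGroup.mk ⟨y, hy⟩) (QuotientGroup.mk ⟨x, hx⟩)
  rw [← QuotientGroup.mk_mul, ← QuotientGroup.mk_mul, QuotientGroup.eq] at h2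
  exact ⟨_, h2, by simp [mul_assoc]⟩

omit [Finite G] in
theorem pow_43_mem (h : IsLocal P Z) {x : G} (hx : x ∈ P) : x ^ 43 ∈ Z := by
  by_contra hn
  have h1 := h.card_centralizer _ (pow_mem hx 43) hn
  have h2 : P ≤ Subgroup.centralizer {x ^ 43} := by
    intro y hy
    obtain ⟨w, hw, hxy⟩ := h.exists_mul_eq hy hx
    have h3 : y * x * y⁻¹ = x * w := by
      rw [hxy, mul_assoc x y w, ← (h.commute w hw y hy).eq]
      group
    rw [mem_centralizer]
    have h4 : y * x ^ 43 * y⁻¹ = x ^ 43 := by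
      rw [← conj_pow, h3, (h.commute w hw x hx).symm.mul_pow, h.pow_43_of_mem hw, mul_one]
    exact (mul_inv_eq_iff_eq_mul.1 h4).symm
  have h3 := Subgroup.card_dvd_of_le h2
  rw [h1, h.card_P] at h3
  norm_num at h3

variable (h : IsLocal P Z) (hH : H ≤ Subgroup.normalizer (Z : Set G)) (hcard : Nat.card H = 1848)
include h hH hcard

theorem mem_of_conj_eq_mul {g x w : G} (hg : g ∈ H) (hg1 : g ≠ 1) (hx : x ∈ P)
    (hw : w ∈ Z) (hgx : g * x * g⁻¹ = x * w) : x ∈ Z := by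
  by_contra hxZ
  have key : ∀ n : ℕ, ∃ w ∈ Z, g ^ n * x * (g ^ n)⁻¹ = x * w := by
    intro n
    induction n with
    | zero => exact ⟨1, one_mem _, by simp⟩
    | succ n ih =>
      obtain ⟨v, hv, hn⟩ := ih
      refine ⟨_, mul_mem hw (conj_mem_of_mem_normalizer (hH hg) hv), ?_⟩
      calc g ^ (n + 1) * x * (g ^ (n + 1))⁻¹ = g * (g ^ n * x * (g ^ n)⁻¹) * g⁻¹ := by
            rw [pow_succ']; group
        _ = (g * x * g⁻¹) * (g * v * g⁻¹) := by rw [hn]; group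
        _ = _ := by rw [hgx, mul_assoc]
  obtain ⟨q, hq, hqd⟩ := Nat.exists_prime_and_dvd (fun h1 => hg1 (orderOf_eq_one_iff.1 h1))
  have hq1848 : q ∣ 1848 := hqd.trans (by
    rw [← hcard, ← Nat.card_zpowers]
    exact Subgroup.card_dvd_of_le ((Subgroup.zpowers_le).2 hg))
  have ho : orderOf (g ^ (orderOf g / q)) = q := orderOf_pow_orderOf_div (orderOf_pos g).ne' hqd
  obtain ⟨v, hv, hgv⟩ := key (orderOf g / q)
  have hg' : g ^ (orderOf g / q) ∈ H := pow_mem hg _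
  generalize g ^ (orderOf g / q) = g' at ho hgv hg'
  have hinj : Function.Injective fun y : Z => x * (y : G) := fun a b hab =>
    Subtype.ext (mul_left_cancel hab)
  obtain ⟨_, ⟨y, rfl⟩, hy⟩ := exists_commute_of_conj_mem hq (by rw [← ho, pow_orderOf_eq_one])
    (S := Set.range fun y : Z => x * (y : G)) (by
      rintro _ ⟨y, rfl⟩
      refine ⟨⟨_, mul_mem hv (conj_mem_of_mem_normalizer (hH hg') y.2)⟩, ?_⟩
      change x * (v * (g' * y * g'⁻¹)) = g' * (x * y) * g'⁻¹
      rw [← mul_assoc x v, ← hgv]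
      group) (Set.finite_range _) (by
      rw [Nat.card_congr (Equiv.ofInjective _ hinj).symm, h.card_Z]
      intro h43
      obtain rfl := (Nat.prime_dvd_prime_iff_eq hq (by norm_num)).1 h43
      norm_num at hq1848)
  have hyZ : x * (y : G) ∉ Z := fun h1 => hxZ ((Subgroup.mul_mem_cancel_right Z y.2).1 h1)
  have h1 := h.card_centralizer _ (mul_mem hx (h.le y.2)) hyZ
  have h2 : q ∣ Nat.card (Subgroup.centralizer {x * (y : G)}) := by
    rw [← ho, ← Nat.card_zpowers]
    exact Subgroup.card_dvd_of_le ((Subgroup.zpowers_le).2 (mem_centralizer.2 hy.symm))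
  rw [h1] at h2
  obtain rfl := (Nat.prime_dvd_prime_iff_eq hq (by norm_num)).1 (hq.dvd_of_dvd_pow h2)
  norm_num at hq1848

theorem card_inf_centralizer {z : G} (hz : z ∈ Z) (hz1 : z ≠ 1) :
    Nat.card (H ⊓ Subgroup.centralizer {z} : Subgroup G) = 44 := by
  have : Fact (Nat.Prime 43) := ⟨by norm_num⟩
  have := isCyclic_of_prime_card h.card_Z
  have h1 : Nat.card (MulAut Z) = 42 := by
    rw [IsCyclic.card_mulAut, h.card_Z, Nat.totient_prime (by norm_num)]
  set K := H ⊓ Subgroup.centralizer {z}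
  let f : H →* MulAut Z := Z.normalizerMonoidHom.comp (Subgroup.inclusion hH)
  have h2 : f.ker = K.subgroupOf H := by
    ext x
    rw [MonoidHom.mem_ker, Subgroup.mem_subgroupOf, Subgroup.mem_inf, h.mem_centralizer_iff hz hz1]
    constructor
    · exact fun hf => ⟨x.2, fun w hw => by
        have h5 : f x ⟨w, hw⟩ = ⟨w, hw⟩ := by rw [hf]; rfl
        exact mul_inv_eq_iff_eq_mul.1 (congrArg Subtype.val h5)⟩
    · rintro ⟨-, hx⟩
      ext w
      exact mul_inv_eq_iff_eq_mul.2 (hx w w.2)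
  have h3 := Subgroup.card_mul_index f.ker
  rw [Subgroup.index_ker, h2, Nat.card_congr (Subgroup.subgroupOfEquivOfLe inf_le_left).toEquiv,
    hcard] at h3
  have h4 : Nat.card f.range ∣ 42 := h1 ▸ Subgroup.card_subgroup_dvd_card _
  have h5 : 44 ∣ Nat.card K := by
    obtain ⟨j, hj⟩ := h4
    have h6 : 1848 * j = Nat.card K * 42 := by rw [← h3, hj]; ring
    exact ⟨j, by omega⟩
  have h6 : Nat.card K ∣ 44 := by
    have h7 : Nat.card K ∣ 43 ^ 3 * 44 := by
      refine (Subgroup.card_dvd_of_le inf_le_right).trans ?_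
      rcases h.card_centralizer_Z z hz hz1 with h8 | h8 <;> norm_num [h8]
    refine Nat.Coprime.dvd_of_dvd_mul_left ?_ h7
    exact Nat.Coprime.coprime_dvd_left (hcard ▸ Subgroup.card_dvd_of_le inf_le_left) (by norm_num)
  exact Nat.dvd_antisymm h6 h5

theorem conj_eq_inv_mul {t x : G} (ht : t ∈ H) (ht1 : t ≠ 1) (ht2 : t ^ 2 = 1) (hx : x ∈ P) :
    ∃ v ∈ Z, t * x * t⁻¹ = x⁻¹ * v := by
  have h1 := h.conj_mem (hH ht) hx
  obtain ⟨w, hw, hc⟩ := h.exists_mul_eq h1 hx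
  refine ⟨x * (t * x * t⁻¹), ?_, by group⟩
  refine h.mem_of_conj_eq_mul hH hcard ht ht1 (mul_mem hx h1) hw ?_
  rw [← hc]
  have h2 : t * t = 1 := by rw [← pow_two, ht2]
  have h3 : t⁻¹ = t := inv_eq_of_mul_eq_one_left h2
  rw [h3]
  calc t * (x * (t * x * t)) * t = t * x * t * x * (t * t) := by group
    _ = _ := by rw [h2, mul_one]

theorem eq_of_sq_eq_one {s t : G} (hs : s ∈ H) (hs1 : s ≠ 1) (hs2 : s ^ 2 = 1) (ht : t ∈ H) (ht1 : t ≠ 1)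
    (ht2 : t ^ 2 = 1) : s = t := by
  by_contra hne
  obtain ⟨x, hx, hxZ⟩ : ∃ x ∈ P, x ∉ Z := by
    by_contra! h1
    have := Subgroup.card_dvd_of_le (show P ≤ Z from h1)
    rw [h.card_P, h.card_Z] at this
    norm_num at this
  obtain ⟨v, hv, hv2⟩ := h.conj_eq_inv_mul hH hcard ht ht1 ht2 (inv_mem hx)
  obtain ⟨w, hw, hw2⟩ := h.conj_eq_inv_mul hH hcard hs hs1 hs2 hx
  refine hxZ (h.mem_of_conj_eq_mul hH hcard (g := t * s) (mul_mem ht hs) ?_ hx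
    (mul_mem hv (conj_mem_of_mem_normalizer (hH ht) hw)) ?_)
  · intro h1
    have h2 : s⁻¹ = s := inv_eq_of_mul_eq_one_left (by rw [← pow_two, hs2])
    exact hne (h2 ▸ (eq_inv_of_mul_eq_one_left h1).symm)
  · calc t * s * x * (t * s)⁻¹ = t * (s * x * s⁻¹) * t⁻¹ := by group
      _ = t * x⁻¹ * t⁻¹ * (t * w * t⁻¹) := by rw [hw2]; group
      _ = _ := by rw [hv2]; group

theorem exists_sq_involution :
    ∃ k ∈ H, (∀ w ∈ Z, Commute k w) ∧ k ^ 2 ≠ 1 ∧ k ^ 4 = 1 := by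
  have : Fact (Nat.Prime 2) := ⟨Nat.prime_two⟩
  obtain ⟨z, hz, hz1⟩ := h.exists_ne_one
  set K := H ⊓ Subgroup.centralizer {z} with hK
  have hKc : Nat.card K = 44 := h.card_inf_centralizer hH hcard hz hz1
  let S : Sylow 2 K := default
  have hS : Nat.card S = 4 := by
    rw [Sylow.card_eq_multiplicity, hKc, show (44 : ℕ) = 2 ^ 2 * 11 by norm_num,
      Nat.factorization_mul (by norm_num) (by norm_num), Nat.Prime.factorization_pow Nat.prime_two]
    simp [Nat.factorization_eq_zero_of_not_dvd (show ¬ 2 ∣ 11 by norm_num)]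
  have hmem : ∀ s : S, ((s : K) : G) ∈ H := fun s => (s : K).2.1
  have h4 : ∀ s : S, ((s : K) : G) ^ 4 = 1 := fun s => by
    have : s ^ Nat.card (S : Subgroup K) = 1 := pow_card_eq_one' (x := s)
    rw [hS] at this
    exact congrArg (fun s : S => ((s : K) : G)) this
  obtain ⟨k, hk⟩ : ∃ k : S, ((k : K) : G) ^ 2 ≠ 1 := by
    by_contra! h2
    have hle : Nat.card S ≤ Nat.card (Fin 2) := by
      classical
      refine Nat.card_le_card_of_injective (fun s : S => if s = 1 then (0 : Fin 2) else 1) ?_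
      intro s t hst
      by_cases hs : s = 1 <;> by_cases ht : t = 1 <;> simp only [hs, ht, if_true, if_false] at hst ⊢
      · norm_num at hst
      · norm_num at hst
      · refine Subtype.ext (Subtype.ext (h.eq_of_sq_eq_one hH hcard (hmem s) ?_ (h2 s)
          (hmem t) ?_ (h2 t))) <;> simpa
    rw [hS, Nat.card_fin] at hle
    omega
  exact ⟨k, hmem k, (h.mem_centralizer_iff hz hz1).1 (k : K).2.2, hk, h4 k⟩

end IsLocal

end

end U343

namespace U343

open Matrix

theorem mul_self_fin_two {R : Type*} [CommRing R] (A : Matrix (Fin 2) (Fin 2) R) :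
    A * A = A.trace • A - A.det • (1 : Matrix (Fin 2) (Fin 2) R) := by
  ext i j
  fin_cases i <;> fin_cases j <;>
    simp [Matrix.mul_apply, Fin.sum_univ_two, Matrix.trace_fin_two, Matrix.det_fin_two] <;> ring

theorem commute_J_iff {R : Type*} [CommRing R] (A : Matrix (Fin 2) (Fin 2) R) :
    Commute A !![0, -1; 1, 0] ↔ A 1 1 = A 0 0 ∧ A 0 1 = - A 1 0 := by
  rw [Commute, SemiconjBy]
  constructor
  · intro h
    have h1 := congrFun (congrFun h 0) 0
    have h2 := congrFun (congrFun h 1) 0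
    simp [Matrix.mul_apply, Fin.sum_univ_two] at h1 h2
    exact ⟨h2, h1⟩
  · rintro ⟨h1, h2⟩
    ext i j
    fin_cases i <;> fin_cases j <;> simp [Matrix.mul_apply, Fin.sum_univ_two, h1, h2]

section

variable {H : Type*} [Group H] [Finite H] {M : H →* Matrix (Fin 2) (Fin 2) (ZMod 43)}

omit [Finite H] in
theorem injective_of_free (hM : ∀ (g : H) (v : Fin 2 → ZMod 43), v ≠ 0 → M g *ᵥ v = v → g = 1) :
    Function.Injective M := fun a b hab => by
  refine (inv_mul_eq_one.1 (hM (a⁻¹ * b) (Pi.single 0 1) ?_ ?_))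
  · simp only [ne_eq, Pi.single_eq_zero_iff]
    decide
  · rw [map_mul, ← hab, ← map_mul, inv_mul_cancel, map_one, one_mulVec]

omit [Finite H] in
theorem eq_one_or_eq_neg_one
    (hM : ∀ (g : H) (v : Fin 2 → ZMod 43), v ≠ 0 → M g *ᵥ v = v → g = 1) {g : H}
    (hg : M g * M g = 1) : g = 1 ∨ M g = -1 := by
  by_cases h : ∀ v, (M g + 1) *ᵥ v = 0
  · right
    rw [eq_neg_iff_add_eq_zero]
    exact Matrix.ext_of_mulVec_single fun i => by rw [h, zero_mulVec]
  · left
    push Not at h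
    obtain ⟨v, hv⟩ := h
    refine hM g _ hv ?_
    rw [mulVec_mulVec, mul_add, hg, mul_one, add_comm]

variable [Fact (Nat.Prime 43)]

omit [Finite H] in
theorem conj_eq_or_eq_inv
    (hM : ∀ (g : H) (v : Fin 2 → ZMod 43), v ≠ 0 → M g *ᵥ v = v → g = 1) {r g : H}
    (hr : (M r).det = 1) (hc : Commute r (g * r * g⁻¹)) :
    g * r * g⁻¹ = r ∨ g * r * g⁻¹ = r⁻¹ := by
  by_cases hne : g * r * g⁻¹ = r
  · exact Or.inl hne
  refine Or.inr (injective_of_free hM ?_)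
  set r' := g * r * g⁻¹
  have htr : (M r').trace = (M r).trace := by
    rw [map_mul, Matrix.trace_mul_comm, ← map_mul]
    congr 2
    simp
  have hdet : (M r').det = 1 := by
    rw [map_mul, map_mul, det_mul, det_mul, hr, mul_one, ← det_mul, ← map_mul, mul_inv_cancel,
      map_one, det_one]
  have h1 := mul_self_fin_two (M r)
  have h2 := mul_self_fin_two (M r')
  rw [hr] at h1
  rw [hdet, htr] at h2
  have h3 : M r * M r' = M r' * M r := hc.map M
  set t := (M r).trace
  have h4 : M r⁻¹ = t • 1 - M r := by
    have h5 : M r * (t • 1 - M r) = 1 := by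
      rw [mul_sub, h1, mul_smul_comm, mul_one, one_smul]; abel
    calc M r⁻¹ = M r⁻¹ * (M r * (t • 1 - M r)) := by rw [h5, mul_one]
      _ = _ := by rw [← mul_assoc, ← map_mul, inv_mul_cancel, map_one, one_mul]
  have h5 : (M r' - M r) * (M r' - (t • 1 - M r)) = 0 := by
    simp only [sub_mul, mul_sub, mul_smul_comm, mul_one, h1, h2, h3, smul_sub]
    abel
  have h6 : (M r' - M r).det ≠ 0 := by
    intro h0
    obtain ⟨v, hv, hv2⟩ := Matrix.exists_mulVec_eq_zero_iff.2 h0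
    rw [sub_mulVec, sub_eq_zero] at hv2
    refine hne (inv_mul_eq_one.1 (hM (r⁻¹ * r') v hv ?_)).symm
    rw [map_mul, ← mulVec_mulVec, hv2, mulVec_mulVec, ← map_mul, inv_mul_cancel, map_one,
      one_mulVec]
  rw [h4]
  have h7 : IsUnit (M r' - M r) := (Matrix.isUnit_iff_isUnit_det _).2 (isUnit_iff_ne_zero.2 h6)
  exact sub_eq_zero.1 (h7.mul_right_eq_zero.1 h5)

/-- The determinant as a homomorphism to the units. -/
def detHom (M : H →* Matrix (Fin 2) (Fin 2) (ZMod 43)) : H →* (ZMod 43)ˣ :=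
  (Matrix.detMonoidHom.comp M).toHomUnits

omit [Finite H] in
theorem coe_detHom (g : H) : (detHom M g : ZMod 43) = (M g).det := rfl

omit [Finite H] in
theorem detHom_surjective (hcard : Nat.card H = 1848) (hK : Nat.card (detHom M).ker = 44) :
    Function.Surjective (detHom M) := by
  rw [← MonoidHom.range_eq_top]
  refine Subgroup.eq_top_of_card_eq _ ?_
  have h1 := Subgroup.card_mul_index (detHom M).ker
  rw [Subgroup.index_ker, hK, hcard] at h1
  rw [Nat.card_eq_fintype_card (α := (ZMod 43)ˣ), ZMod.card_units]
  omega

theorem exists_commute_conj (hK : Nat.card (detHom M).ker = 44) :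
    ∃ r : H, (M r).det = 1 ∧ r ≠ 1 ∧ r ^ 11 = 1 ∧ ∀ g, Commute r (g * r * g⁻¹) := by
  have : Fact (Nat.Prime 11) := ⟨by norm_num⟩
  obtain ⟨r, hr⟩ := exists_prime_orderOf_dvd_card' (G := (detHom M).ker) 11 (by rw [hK]; norm_num)
  have hfac : (44 : ℕ).factorization 11 = 1 := by
    rw [show (44 : ℕ) = 4 * 11 ^ 1 by norm_num, Nat.factorization_mul (by norm_num) (by norm_num),
      Nat.Prime.factorization_pow (by norm_num)]
    simp [Nat.factorization_eq_zero_of_not_dvd (show ¬ 11 ∣ 4 by norm_num)]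
  have hsyl : ∀ s : (detHom M).ker, orderOf s = 11 →
      ∃ S : Sylow 11 (detHom M).ker, (S : Subgroup (detHom M).ker) = Subgroup.zpowers s :=
    fun s hs => ⟨Sylow.ofCard (Subgroup.zpowers s) (by
      rw [Nat.card_zpowers, hs, hK, hfac, pow_one]), rfl⟩
  obtain ⟨S, hS⟩ := hsyl r hr
  have huniq : Subsingleton (Sylow 11 (detHom M).ker) := by
    have h1 := Sylow.card_dvd_index S
    have h2 := Subgroup.card_mul_index (S : Subgroup (detHom M).ker)
    rw [hS, Nat.card_zpowers, hr, hK] at h2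
    have h3 : Nat.card (Sylow 11 (detHom M).ker) % 11 = 1 := card_sylow_modEq_one 11 _
    rw [hS, show (Subgroup.zpowers r).index = 4 by omega] at h1
    have h4 := Nat.le_of_dvd (by norm_num) h1
    exact (Nat.card_eq_one_iff_unique.1 (by omega)).1
  refine ⟨r, ?_, ?_, ?_, fun g => ?_⟩
  · rw [← coe_detHom, MonoidHom.mem_ker.1 r.2, Units.val_one]
  · intro h1
    rw [show r = 1 from Subtype.ext h1, orderOf_one] at hr
    norm_num at hr
  · have := pow_orderOf_eq_one r
    rw [hr] at this
    exact congrArg Subtype.val this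
  · let s : (detHom M).ker := ⟨g * r * g⁻¹, (MonoidHom.normal_ker _).conj_mem _ r.2 g⟩
    have hs : orderOf s = 11 := by
      rw [← Subgroup.orderOf_coe, ← hr, ← Subgroup.orderOf_coe]
      exact orderOf_injective (MulAut.conj g).toMonoidHom (MulAut.conj g).injective r
    obtain ⟨T, hT⟩ := hsyl s hs
    have h1 : s ∈ Subgroup.zpowers r := by
      rw [← hS, huniq.elim S T, hT]
      exact Subgroup.mem_zpowers s
    obtain ⟨n, hn⟩ := h1
    have h2 : (g * r * g⁻¹ : H) = (r : H) ^ n := congrArg Subtype.val hn.symm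
    rw [h2]
    exact (Commute.refl _).zpow_right n

theorem exists_commute_all
    (hM : ∀ (g : H) (v : Fin 2 → ZMod 43), v ≠ 0 → M g *ᵥ v = v → g = 1)
    (hcard : Nat.card H = 1848) (hK : Nat.card (detHom M).ker = 44) :
    ∃ r : H, (M r).det = 1 ∧ r ≠ 1 ∧ r ^ 11 = 1 ∧ ∀ g, Commute g r := by
  obtain ⟨r, hr, hr1, hr11, hrc⟩ := exists_commute_conj hK
  refine ⟨r, hr, hr1, hr11, ?_⟩
  have hr2 : r ≠ r⁻¹ := fun h1 => hr1 <| by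
    have h2 : r ^ 2 = 1 := by rw [pow_two]; nth_rw 2 [h1]; exact mul_inv_cancel r
    calc r = r ^ 11 * ((r ^ 2) ^ 5)⁻¹ := by group
      _ = 1 := by rw [hr11, h2]; simp
  have hcases : ∀ g, Commute g r ∨ g * r * g⁻¹ = r⁻¹ := fun g =>
    (conj_eq_or_eq_inv hM hr (hrc g)).imp (fun h1 => mul_inv_eq_iff_eq_mul.1 h1) id
  have hsq : ∀ g, g * r * g⁻¹ = r⁻¹ → Commute (g * g) r := fun g hinv => by
    refine mul_inv_eq_iff_eq_mul.1 ?_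
    calc g * g * r * (g * g)⁻¹ = g * (g * r * g⁻¹) * g⁻¹ := by group
      _ = (g * r * g⁻¹)⁻¹ := by nth_rw 1 [hinv]; group
      _ = r := by rw [hinv, inv_inv]
  have hex : ∀ g, ¬ Commute g r → (M g).det ≠ -1 := by
    intro g hg hdet
    have hinv := (hcases g).resolve_left hg
    have hsq := hsq g hinv
    have h1 := mul_self_fin_two (M g)
    have htr : (M g).trace = 0 := by
      by_contra ht
      apply hg
      apply injective_of_free hM
      have h2 : Commute ((M g).trace • M g) (M r) := by
        have h3 : (M g).trace • M g = M (g * g) + (M g).det • 1 := by rw [map_mul, h1]; abel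
        rw [h3]
        exact (hsq.map M).add_left ((Commute.one_left _).smul_left _)
      have h3 := h2.smul_left ((M g).trace)⁻¹
      rw [smul_smul, inv_mul_cancel₀ ht, one_smul] at h3
      rw [map_mul, map_mul]
      exact h3
    rw [htr, hdet, zero_smul, zero_sub, neg_smul, neg_neg, one_smul] at h1
    rcases eq_one_or_eq_neg_one hM h1 with rfl | h2
    · exact hg (Commute.one_left _)
    · refine hg (injective_of_free hM ?_)
      rw [map_mul, map_mul, h2, neg_one_mul, mul_neg_one]
  obtain ⟨y, hy⟩ := detHom_surjective hcard hK (-1)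
  have hy1 : (M y).det = -1 := by rw [← coe_detHom, hy]; rfl
  have hyr : Commute y r := by
    by_contra h1
    exact hex y h1 hy1
  intro g
  by_contra hg
  have hinv := (hcases g).resolve_left hg
  have hg2 : g ^ 21 * r * (g ^ 21)⁻¹ = r⁻¹ := by
    have h2 : Commute (g ^ 2) r := pow_two g ▸ hsq g hinv
    calc g ^ 21 * r * (g ^ 21)⁻¹ = g * ((g ^ 2) ^ 10 * r * ((g ^ 2) ^ 10)⁻¹) * g⁻¹ := by group
      _ = g * r * g⁻¹ := by rw [(h2.pow_left 10).eq, mul_inv_cancel_right]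
      _ = _ := hinv
  have hnc : ¬ Commute (g ^ 21) r := fun h1 => hr2 <| by
    rw [← hg2, h1.eq, mul_inv_cancel_right]
  have hd : (M (g ^ 21)).det = 1 ∨ (M (g ^ 21)).det = -1 := by
    rw [← sq_eq_one_iff, ← coe_detHom, ← Units.val_pow_eq_pow_val, ← map_pow, ← pow_mul, map_pow]
    have h1 := pow_card_eq_one' (x := detHom M g)
    rw [Nat.card_eq_fintype_card, ZMod.card_units] at h1
    exact congrArg Units.val h1
  rcases hd with hd | hd
  · refine hex (g ^ 21 * y) (fun h1 => hnc ?_) ?_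
    · have := h1.mul_left hyr.inv_left
      rwa [mul_inv_cancel_right] at this
    · rw [map_mul, det_mul, hd, hy1, one_mul]
  · exact hex _ hnc hd

/-- A group of order `43 ^ 2 - 1` acting regularly on the nonzero vectors of a plane over `ZMod 43`,
with a kernel of the determinant of order `44`, centralizes an element acting as `J`. -/
theorem apply_eq_of_free
    (hM : ∀ (g : H) (v : Fin 2 → ZMod 43), v ≠ 0 → M g *ᵥ v = v → g = 1)
    (hcard : Nat.card H = 1848) (hK : Nat.card (detHom M).ker = 44) {k : H}
    (hk : M k = !![0, -1; 1, 0]) (g : H) : M g 1 1 = M g 0 0 ∧ M g 0 1 = - M g 1 0 := by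
  obtain ⟨r, hr, hr1, hr11, hrc⟩ := exists_commute_all hM hcard hK
  have h1 := (commute_J_iff (M r)).1 (hk ▸ ((hrc k).map M).symm)
  have ht : M r 1 0 ≠ 0 := by
    intro h0
    have h2 : M r * M r = 1 := by
      rw [det_fin_two, h1.1, h0, mul_zero, sub_zero] at hr
      ext i j
      fin_cases i <;> fin_cases j <;>
        simp [Matrix.mul_apply, Fin.sum_univ_two, h1.1, h1.2, h0, hr]
    have h3 : r ^ 2 = 1 := injective_of_free hM (by rw [pow_two, map_mul, h2, map_one])
    refine hr1 ?_
    calc r = r ^ 11 * ((r ^ 2) ^ 5)⁻¹ := by group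
      _ = 1 := by rw [hr11, h3]; simp
  have h2 : Commute (M g) (M r) := (hrc g).map M
  have hA : M r = M r 0 0 • 1 + M r 1 0 • !![0, -1; 1, 0] := by
    ext i j
    fin_cases i <;> fin_cases j <;> simp [h1.1, h1.2]
  have h3 : Commute (M g) (M r 1 0 • !![0, -1; 1, 0]) := by
    have : M r 1 0 • !![0, -1; 1, 0] = M r - M r 0 0 • 1 := by rw [eq_sub_iff_add_eq, add_comm, ← hA]
    rw [this]
    exact h2.sub_right ((Commute.one_right _).smul_right _)
  have h4 := h3.smul_right (M r 1 0)⁻¹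
  rw [smul_smul, inv_mul_cancel₀ ht, one_smul] at h4
  exact (commute_J_iff _).1 h4

end

end U343

namespace U343

section

variable {G : Type*} [Group G]

/-- Powers of an element of order `43` with exponents in `ZMod 43`. -/
def zpw (u : G) (a : ZMod 43) : G := u ^ a.val

theorem zpw_natCast {u : G} (hu : u ^ 43 = 1) (n : ℕ) : zpw u n = u ^ n := by
  rw [zpw, ZMod.val_natCast]
  conv_rhs => rw [← Nat.mod_add_div n 43, pow_add, pow_mul, hu, one_pow, mul_one]

theorem exists_natCast (a : ZMod 43) : ∃ n : ℕ, (n : ZMod 43) = a := ⟨a.val, ZMod.natCast_zmod_val a⟩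

theorem zpw_add {u : G} (hu : u ^ 43 = 1) (a b : ZMod 43) : zpw u (a + b) = zpw u a * zpw u b := by
  obtain ⟨n, rfl⟩ := exists_natCast a
  obtain ⟨m, rfl⟩ := exists_natCast b
  rw [← Nat.cast_add, zpw_natCast hu, zpw_natCast hu, zpw_natCast hu, pow_add]

theorem zpw_zero (u : G) : zpw u 0 = 1 := by simp [zpw]

theorem zpw_one (u : G) : zpw u 1 = u := by
  rw [zpw, show (1 : ZMod 43).val = 1 from rfl, pow_one]

theorem zpw_pow {u : G} (hu : u ^ 43 = 1) (a : ZMod 43) (n : ℕ) : zpw u a ^ n = zpw u (a * n) := by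
  obtain ⟨m, rfl⟩ := exists_natCast a
  rw [← Nat.cast_mul, zpw_natCast hu, zpw_natCast hu, pow_mul]

theorem zpw_pow_43 {u : G} (hu : u ^ 43 = 1) (a : ZMod 43) : zpw u a ^ 43 = 1 := by
  rw [zpw_pow hu, CharP.cast_eq_zero (ZMod 43) 43, mul_zero, zpw_zero]

theorem zpw_zpw {u : G} (hu : u ^ 43 = 1) (a b : ZMod 43) : zpw (zpw u a) b = zpw u (a * b) := by
  obtain ⟨m, rfl⟩ := exists_natCast b
  rw [zpw_natCast (zpw_pow_43 hu a), zpw_pow hu]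

theorem zpw_neg {u : G} (hu : u ^ 43 = 1) (a : ZMod 43) : zpw u (-a) = (zpw u a)⁻¹ := by
  rw [eq_inv_iff_mul_eq_one, ← zpw_add hu, neg_add_cancel, zpw_zero]

theorem zpw_mul {u v : G} (h : Commute u v) (a : ZMod 43) : zpw (u * v) a = zpw u a * zpw v a :=
  h.mul_pow _

theorem conj_zpw (g u : G) (a : ZMod 43) : g * zpw u a * g⁻¹ = zpw (g * u * g⁻¹) a :=
  (conj_pow).symm

theorem zpw_commute {u v : G} (h : Commute u v) (a b : ZMod 43) : Commute (zpw u a) (zpw v b) :=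
  h.pow_pow _ _

theorem eq_zero_of_zpw [Fact (Nat.Prime 43)] {u : G} (hu : u ^ 43 = 1) (hu1 : u ≠ 1) {a : ZMod 43}
    (h : zpw u a = 1) : a = 0 := by
  by_contra ha
  apply hu1
  rw [← zpw_one u, ← mul_inv_cancel₀ ha, ← zpw_zpw hu, h, zpw, one_pow]

/-- Generators of an extraspecial group of order `43 ^ 3` and exponent `43`. -/
structure IsHeisenberg (u v x : G) : Prop where
  u_pow : u ^ 43 = 1
  v_pow : v ^ 43 = 1
  x_pow : x ^ 43 = 1
  x_ne : x ≠ 1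
  mul_eq : u * v = v * u * x
  commute_u : Commute x u
  commute_v : Commute x v

/-- Symmetric coordinates on the group generated by `u`, `v`, `x`. -/
def heis (u v x : G) (a b c : ZMod 43) : G := zpw u a * zpw v b * zpw x (c - 22 * a * b)

namespace IsHeisenberg

variable {u v x : G} (h : IsHeisenberg u v x)
include h

theorem zpw_mul_zpw (a b : ZMod 43) :
    zpw v b * zpw u a = zpw u a * zpw v b * zpw x (-(a * b)) := by
  have h1 : v * u * v⁻¹ = u * zpw x (-1) := by
    rw [zpw_neg h.x_pow, zpw_one, eq_mul_inv_iff_mul_eq, mul_assoc, mul_assoc, ← h.commute_v.inv_right.eq,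
      ← mul_assoc, ← mul_assoc, ← h.mul_eq, mul_inv_cancel_right]
  have hxu : ∀ c, Commute u (zpw x c) := fun c => (h.commute_u.symm.pow_right _)
  have hxv : ∀ c, Commute v (zpw x c) := fun c => (h.commute_v.symm.pow_right _)
  have h2 : v * zpw u a * v⁻¹ = zpw u a * zpw x (-a) := by
    rw [conj_zpw, h1, zpw_mul (hxu _), zpw_zpw h.x_pow, neg_one_mul]
  have h3 : (zpw u a)⁻¹ * v * zpw u a = v * zpw x (-a) := by
    rw [mul_inv_eq_iff_eq_mul] at h2
    rw [mul_assoc, h2, mul_assoc, inv_mul_cancel_left, (hxv _).eq]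
  have h4 := conj_zpw (zpw u a)⁻¹ v b
  rw [inv_inv, h3, zpw_mul (hxv _), zpw_zpw h.x_pow, mul_assoc, inv_mul_eq_iff_eq_mul] at h4
  rw [h4, neg_mul, mul_assoc]

theorem commute_zpw_x (a b c : ZMod 43) : Commute (zpw x c) (zpw u a * zpw v b) :=
  (zpw_commute h.commute_u _ _).mul_right (zpw_commute h.commute_v _ _)

theorem mul (a b c a' b' c' : ZMod 43) : heis u v x a b c * heis u v x a' b' c' =
    heis u v x (a + a') (b + b') (c + c' + 22 * (a * b' - a' * b)) := by
  have h44 : (44 : ZMod 43) = 1 := rfl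
  simp only [heis]
  calc zpw u a * zpw v b * zpw x (c - 22 * a * b) *
        (zpw u a' * zpw v b' * zpw x (c' - 22 * a' * b'))
      = zpw u a * zpw v b * (zpw x (c - 22 * a * b) * (zpw u a' * zpw v b')) *
          zpw x (c' - 22 * a' * b') := by simp only [mul_assoc]
    _ = zpw u a * (zpw v b * zpw u a') * zpw v b' *
          (zpw x (c - 22 * a * b) * zpw x (c' - 22 * a' * b')) := by
        rw [(h.commute_zpw_x a' b' _).eq]; simp only [mul_assoc]
    _ = zpw u a * zpw u a' * zpw v b * (zpw x (-(a' * b)) * zpw v b') *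
          (zpw x (c - 22 * a * b) * zpw x (c' - 22 * a' * b')) := by
        rw [h.zpw_mul_zpw]; simp only [mul_assoc]
    _ = zpw u (a + a') * zpw v (b + b') * (zpw x (-(a' * b)) *
          (zpw x (c - 22 * a * b) * zpw x (c' - 22 * a' * b'))) := by
        rw [(zpw_commute h.commute_v _ _).eq, zpw_add h.u_pow, zpw_add h.v_pow]
        simp only [mul_assoc]
    _ = _ := by
        rw [← zpw_add h.x_pow, ← zpw_add h.x_pow]
        congr 2
        linear_combination (- a' * b) * h44.symm

omit h in
theorem heis_zero : heis u v x 0 0 0 = 1 := by simp [heis, zpw_zero]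

omit h in
theorem heis_u : heis u v x 1 0 0 = u := by simp [heis, zpw_zero, zpw_one]

omit h in
theorem heis_v : heis u v x 0 1 0 = v := by simp [heis, zpw_zero, zpw_one]

omit h in
theorem heis_x (c : ZMod 43) : heis u v x 0 0 c = zpw x c := by simp [heis, zpw_zero]

theorem inv (a b c : ZMod 43) : (heis u v x a b c)⁻¹ = heis u v x (-a) (-b) (-c) := by
  rw [inv_eq_iff_mul_eq_one, h.mul, ← heis_zero]
  congr 1 <;> ring

theorem eq_zero [Fact (Nat.Prime 43)] {a b c : ZMod 43} (h1 : heis u v x a b c = 1) :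
    a = 0 ∧ b = 0 ∧ c = 0 := by
  have h44 : (44 : ZMod 43) = 1 := rfl
  have ha : a = 0 := by
    have h2 : heis u v x a b c * heis u v x 0 1 0 =
        heis u v x 0 1 0 * heis u v x a b c * heis u v x 0 0 a := by
      rw [h.mul, h.mul, h.mul]
      congr 1 <;> first | ring1 | linear_combination a * h44
    rw [h1, one_mul, mul_one, left_eq_mul, heis_x] at h2
    exact eq_zero_of_zpw h.x_pow h.x_ne h2
  have hb : b = 0 := by
    have h2 : heis u v x a b c * heis u v x 1 0 0 =
        heis u v x 1 0 0 * heis u v x a b c * heis u v x 0 0 (-b) := by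
      rw [h.mul, h.mul, h.mul]
      congr 1 <;> first | ring1 | linear_combination (-b) * h44
    rw [h1, one_mul, mul_one, left_eq_mul, heis_x] at h2
    exact neg_eq_zero.1 (eq_zero_of_zpw h.x_pow h.x_ne h2)
  subst ha hb
  rw [heis_x] at h1
  exact ⟨rfl, rfl, eq_zero_of_zpw h.x_pow h.x_ne h1⟩

theorem injective [Fact (Nat.Prime 43)] {a b c a' b' c' : ZMod 43}
    (h1 : heis u v x a b c = heis u v x a' b' c') : a = a' ∧ b = b' ∧ c = c' := by
  rw [← mul_inv_eq_one, h.inv, h.mul] at h1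
  obtain ⟨h2, h3, h4⟩ := h.eq_zero h1
  obtain rfl : a = a' := by linear_combination h2
  obtain rfl : b = b' := by linear_combination h3
  exact ⟨rfl, rfl, by linear_combination h4⟩

theorem zpw_heis (a b c d : ZMod 43) :
    zpw (heis u v x a b c) d = heis u v x (d * a) (d * b) (d * c) := by
  have key : ∀ n : ℕ, heis u v x a b c ^ n = heis u v x (n * a) (n * b) (n * c) := by
    intro n
    induction n with
    | zero => simp [heis_zero]
    | succ n ih =>
      rw [pow_succ, ih, h.mul]
      congr 1 <;> push_cast <;> ring
  rw [zpw, key, ZMod.natCast_zmod_val]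

theorem conj {g : G} {s t s' t' : ZMod 43} (hu : g * u * g⁻¹ = heis u v x s t 0)
    (hv : g * v * g⁻¹ = heis u v x s' t' 0) (a b c : ZMod 43) :
    g * heis u v x a b c * g⁻¹ =
      heis u v x (a * s + b * s') (a * t + b * t') ((s * t' - s' * t) * c) := by
  have h44 : (44 : ZMod 43) = 1 := rfl
  have hx : g * x * g⁻¹ = heis u v x 0 0 (s * t' - s' * t) := by
    have h1 := congrArg (fun y => g * y * g⁻¹) h.mul_eq
    have h2 : heis u v x s t 0 * heis u v x s' t' 0 =
        heis u v x s' t' 0 * heis u v x s t 0 * (g * x * g⁻¹) := by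
      rw [← hu, ← hv]
      calc _ = g * (u * v) * g⁻¹ := by group
        _ = _ := by rw [h.mul_eq]; group
    have h3 : heis u v x s t 0 * heis u v x s' t' 0 =
        heis u v x s' t' 0 * heis u v x s t 0 * heis u v x 0 0 (s * t' - s' * t) := by
      rw [h.mul, h.mul, h.mul]
      congr 1 <;> first | ring1 | linear_combination (s * t' - s' * t) * h44
    exact mul_left_cancel (h2.symm.trans h3)
  have h1 : g * heis u v x a b c * g⁻¹ =
      (g * zpw u a * g⁻¹) * (g * zpw v b * g⁻¹) * (g * zpw x (c - 22 * a * b) * g⁻¹) := by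
    simp only [heis]; group
  rw [h1, conj_zpw, conj_zpw, conj_zpw, hu, hv, hx, h.zpw_heis, h.zpw_heis, h.zpw_heis, h.mul, h.mul]
  congr 1 <;> ring

end IsHeisenberg

end

end U343

namespace U343

open WedderburnChar

theorem mul_self_add_one_ne_zero : ∀ j : ZMod 43, j * j + 1 ≠ 0 := by decide

section

variable {G : Type*} [Group G] [Finite G] {P Z H : Subgroup G}

namespace IsLocal

variable (h : IsLocal P Z) (hH : H ≤ Subgroup.normalizer (Z : Set G)) (hcard : Nat.card H = 1848)
include h hH hcard

theorem exists_inverted {z : G} (hz : z ∈ H) (hz1 : z ≠ 1) (hz2 : z ^ 2 = 1)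
    (hzZ : ∀ w ∈ Z, Commute z w) : ∃ u ∈ P, u ∉ Z ∧ z * u * z⁻¹ = u⁻¹ := by
  obtain ⟨x, hx, hxZ⟩ : ∃ x ∈ P, x ∉ Z := by
    by_contra! h1
    have := Subgroup.card_dvd_of_le (show P ≤ Z from h1)
    rw [h.card_P, h.card_Z] at this
    norm_num at this
  obtain ⟨v, hv, hzx⟩ := h.conj_eq_inv_mul hH hcard hz hz1 hz2 hx
  have hv21 := pow_mem hv 21
  refine ⟨x * v ^ 21, mul_mem hx (h.le hv21),
    fun h1 => hxZ ((Subgroup.mul_mem_cancel_right Z hv21).1 h1), ?_⟩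
  calc z * (x * v ^ 21) * z⁻¹ = (z * x * z⁻¹) * (z * v ^ 21 * z⁻¹) := by group
    _ = x⁻¹ * (v ^ 43 * (v ^ 21)⁻¹) := by
        rw [hzx, (hzZ _ hv21).eq, mul_inv_cancel_right]; group
    _ = _ := by
        rw [h.pow_43_of_mem hv, one_mul, mul_inv_rev]
        exact ((h.commute _ (inv_mem hv21) _ (inv_mem hx))).symm.eq

omit hH hcard in
omit [Finite G] in
theorem eq_one_of_inverted {z y : G} (hzZ : ∀ w ∈ Z, Commute z w) (hy : y ∈ Z)
    (hzy : z * y * z⁻¹ = y⁻¹) : y = 1 := by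
  rw [(hzZ y hy).eq, mul_inv_cancel_right] at hzy
  have h2 : y ^ 2 = 1 := by rw [pow_two]; nth_rw 2 [hzy]; exact mul_inv_cancel y
  calc y = y ^ 43 * ((y ^ 2) ^ 21)⁻¹ := by group
    _ = 1 := by rw [h.pow_43_of_mem hy, h2]; simp

omit hH hcard in
theorem not_commute_conj [Fact (Nat.Prime 43)] {k u : G} (hkZ : ∀ w ∈ Z, Commute k w) (hu : u ∈ P)
    (huZ : u ∉ Z) (hu43 : u ^ 43 = 1) (hk2 : k ^ 2 * u * (k ^ 2)⁻¹ = u⁻¹) :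
    ¬ Commute u (k * u * k⁻¹) := by
  intro hc
  have hzZ : ∀ w ∈ Z, Commute (k ^ 2) w := fun w hw => (hkZ w hw).pow_left 2
  have hzu : ∀ i, k ^ 2 * zpw u i * (k ^ 2)⁻¹ = (zpw u i)⁻¹ := fun i => by
    rw [conj_zpw, hk2, zpw, zpw, inv_pow]
  have hu1 : u ≠ 1 := fun h1 => huZ (h1 ▸ one_mem _)
  have hcu : ∀ i w, w ∈ Z → zpw u i * w ∈ Subgroup.centralizer {u} := fun i w hw =>
    mem_centralizer.2 (((Commute.refl u).pow_right _).mul_right (h.commute w hw u hu).symm)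
  let f : ZMod 43 × Z → Subgroup.centralizer {u} := fun i => ⟨_, hcu i.1 i.2 i.2.2⟩
  have hf : Function.Injective f := by
    rintro ⟨i, w⟩ ⟨j, w'⟩ hij
    have h1 : zpw u i * (w : G) = zpw u j * w' := congrArg Subtype.val hij
    have h2 : zpw u (i - j) = w' * (w : G)⁻¹ := by
      rw [eq_mul_inv_iff_mul_eq, sub_eq_neg_add, zpw_add hu43, mul_assoc, h1, ← mul_assoc,
        ← zpw_add hu43, neg_add_cancel, zpw_zero, one_mul]
    have h3 : i = j := by
      rw [← sub_eq_zero]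
      refine eq_zero_of_zpw hu43 hu1 (h.eq_one_of_inverted hzZ ?_ (hzu _))
      rw [h2]
      exact mul_mem w'.2 (inv_mem w.2)
    subst h3
    rw [mul_right_inj] at h1
    exact Prod.ext rfl (Subtype.ext h1)
  have hsurj := (hf.bijective_of_nat_card_le (by
    rw [h.card_centralizer u hu huZ, Nat.card_prod, h.card_Z, Nat.card_zmod]; norm_num)).2
  obtain ⟨⟨j, w, hw⟩, hj⟩ := hsurj ⟨k * u * k⁻¹, mem_centralizer.2 hc⟩
  have hj' : zpw u j * w = k * u * k⁻¹ := congrArg Subtype.val hj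
  have h1 : k ^ 2 * (k * u * k⁻¹) * (k ^ 2)⁻¹ = (k * u * k⁻¹)⁻¹ := by
    calc _ = k * (k ^ 2 * u * (k ^ 2)⁻¹) * k⁻¹ := by group
      _ = _ := by rw [hk2]; group
  have hw1 : w = 1 := by
    refine h.eq_one_of_inverted hzZ hw ?_
    have h2 : k ^ 2 * w * (k ^ 2)⁻¹ = (k ^ 2 * zpw u j * (k ^ 2)⁻¹)⁻¹ * (k ^ 2 * (zpw u j * w) *
      (k ^ 2)⁻¹) := by group
    rw [h2, hzu, hj', h1, ← hj', inv_inv, mul_inv_rev, ← mul_assoc]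
    have h3 : Commute (zpw u j) w⁻¹ := ((h.commute w hw u hu).inv_left.symm).pow_left _
    rw [h3.eq, mul_inv_cancel_right]
  rw [hw1, mul_one] at hj'
  have h2 : zpw u (j * j + 1) = 1 := by
    have h3 : k ^ 2 * u * (k ^ 2)⁻¹ = k * (k * u * k⁻¹) * k⁻¹ := by
      simp only [pow_two, mul_inv_rev, mul_assoc]
    rw [zpw_add hu43, ← zpw_zpw hu43, hj', ← conj_zpw, hj', ← h3, hk2, zpw_one, inv_mul_cancel]
  exact mul_self_add_one_ne_zero j (eq_zero_of_zpw hu43 hu1 h2)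

theorem exists_heisenberg [Fact (Nat.Prime 43)] : ∃ k ∈ H, ∃ u v x : G, IsHeisenberg u v x ∧ u ∈ P ∧
    v ∈ P ∧ x ∈ Z ∧ k * u * k⁻¹ = v ∧ k * v * k⁻¹ = u⁻¹ ∧ k * x * k⁻¹ = x ∧
    ∀ g ∈ H, Commute g (k ^ 2) := by
  obtain ⟨k, hk, hkZ, hk2, hk4⟩ := h.exists_sq_involution hH hcard
  have hz2 : (k ^ 2) ^ 2 = 1 := by rw [← pow_mul, hk4]
  have hzZ : ∀ w ∈ Z, Commute (k ^ 2) w := fun w hw => (hkZ w hw).pow_left 2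
  obtain ⟨u, hu, huZ, hzu⟩ := h.exists_inverted hH hcard (pow_mem hk 2) hk2 hz2 hzZ
  have hu43 : u ^ 43 = 1 := h.eq_one_of_inverted hzZ (h.pow_43_mem hu) (by
    rw [← conj_pow, hzu, inv_pow])
  have hv := h.conj_mem (hH hk) hu
  obtain ⟨x, hx, hxe⟩ := h.exists_mul_eq hu hv
  refine ⟨k, hk, u, k * u * k⁻¹, x, ⟨hu43, by rw [conj_pow, hu43, mul_one, mul_inv_cancel],
    h.pow_43_of_mem hx, ?_, hxe, h.commute x hx u hu, h.commute x hx _ hv⟩, hu, hv, hx, rfl, ?_, ?_,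
    fun g hg => ?_⟩
  · rintro rfl
    rw [mul_one] at hxe
    exact h.not_commute_conj hkZ hu huZ hu43 hzu hxe
  · rw [← hzu]
    simp only [pow_two, mul_inv_rev, mul_assoc]
  · rw [(hkZ x hx).eq, mul_inv_cancel_right]
  · refine mul_inv_eq_iff_eq_mul.1 (h.eq_of_sq_eq_one hH hcard
      (mul_mem (mul_mem hg (pow_mem hk 2)) (inv_mem hg)) ?_ ?_ (pow_mem hk 2) hk2 hz2)
    · rwa [ne_eq, conj_eq_one_iff]
    · rw [conj_pow, hz2, mul_one, mul_inv_cancel]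

end IsLocal

end

end U343

namespace U343

open Matrix

section

variable {G : Type*} [Group G] [Finite G] {P Z H : Subgroup G}

namespace IsLocal

section

variable {u v x : G} (h : IsLocal P Z) (hP : IsHeisenberg u v x) (hu : u ∈ P) (hv : v ∈ P) (hx : x ∈ Z)
include h hu hv hx

omit [Finite G] in
theorem heis_mem (a b c : ZMod 43) : heis u v x a b c ∈ P :=
  mul_mem (mul_mem (pow_mem hu _) (pow_mem hv _)) (pow_mem (h.le hx) _)

include hP

theorem exists_heis_eq [Fact (Nat.Prime 43)] {y : G} (hy : y ∈ P) :
    ∃ a b c, heis u v x a b c = y := by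
  let f : ZMod 43 × ZMod 43 × ZMod 43 → P := fun i => ⟨_, h.heis_mem hu hv hx i.1 i.2.1 i.2.2⟩
  have hf : Function.Injective f := by
    rintro ⟨a, b, c⟩ ⟨a', b', c'⟩ hij
    obtain ⟨h1, h2, h3⟩ := hP.injective (congrArg Subtype.val hij)
    exact Prod.ext h1 (Prod.ext h2 h3)
  obtain ⟨⟨a, b, c⟩, hj⟩ := (hf.bijective_of_nat_card_le (by
    rw [h.card_P, Nat.card_prod, Nat.card_prod, Nat.card_zmod]; norm_num)).2 ⟨y, hy⟩
  exact ⟨a, b, c, congrArg Subtype.val hj⟩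

omit [Finite G] in
theorem eq_zero_of_heis_mem [Fact (Nat.Prime 43)] {a b c : ZMod 43} (hZ : heis u v x a b c ∈ Z) :
    a = 0 ∧ b = 0 := by
  have h44 : (44 : ZMod 43) = 1 := rfl
  have h1 := h.commute _ hZ _ (h.heis_mem hu hv hx 1 0 0)
  have h2 := h.commute _ hZ _ (h.heis_mem hu hv hx 0 1 0)
  rw [commute_iff_eq, hP.mul, hP.mul] at h1 h2
  have h3 := (hP.injective h1).2.2
  have h4 := (hP.injective h2).2.2
  constructor
  · linear_combination h4 - a * h44
  · linear_combination -h3 - b * h44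

end

variable (h : IsLocal P Z) (hH : H ≤ Subgroup.normalizer (Z : Set G)) (hcard : Nat.card H = 1848)
include h hH hcard

theorem exists_matrix_rep [Fact (Nat.Prime 43)] : ∃ u v x : G, ∃ M : H →* Matrix (Fin 2) (Fin 2) (ZMod 43),
    IsHeisenberg u v x ∧ u ∈ P ∧ v ∈ P ∧ x ∈ Z ∧ (∃ k, M k = !![0, -1; 1, 0]) ∧
    ∀ (g : H) (a b c : ZMod 43), (g : G) * heis u v x a b c * (g : G)⁻¹ =
      heis u v x (M g 0 0 * a + M g 0 1 * b) (M g 1 0 * a + M g 1 1 * b) ((M g).det * c) := by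
  obtain ⟨k, hk, u, v, x, hP, hu, hv, hx, hku, hkv, -, hkc⟩ := h.exists_heisenberg hH hcard
  have hzu : k ^ 2 * u * (k ^ 2)⁻¹ = u⁻¹ := by
    rw [← hkv, ← hku]
    simp only [pow_two, _root_.mul_inv_rev, mul_assoc]
  have hzv : k ^ 2 * v * (k ^ 2)⁻¹ = v⁻¹ := by
    rw [show k ^ 2 * v * (k ^ 2)⁻¹ = k * (k * v * k⁻¹) * k⁻¹ by
      simp only [pow_two, _root_.mul_inv_rev, mul_assoc], hkv, ← conj_inv, hku]
  have hz : ∀ a b c, k ^ 2 * heis u v x a b c * (k ^ 2)⁻¹ = heis u v x (-a) (-b) c := by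
    intro a b c
    have h1 : k ^ 2 * u * (k ^ 2)⁻¹ = heis u v x (-1) 0 0 := by
      rw [hzu, ← neg_zero, ← hP.inv, IsHeisenberg.heis_u]
    have h2 : k ^ 2 * v * (k ^ 2)⁻¹ = heis u v x 0 (-1) 0 := by
      rw [hzv, ← neg_zero, ← hP.inv, IsHeisenberg.heis_v]
    rw [hP.conj h1 h2]
    congr 1 <;> ring
  have key : ∀ g ∈ H, ∀ y ∈ P, k ^ 2 * y * (k ^ 2)⁻¹ = y⁻¹ → ∃ s t, g * y * g⁻¹ = heis u v x s t 0 := by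
    intro g hg y hy hzy
    obtain ⟨s, t, c, hc⟩ := h.exists_heis_eq hP hu hv hx (h.conj_mem (hH hg) hy)
    have h1 := hz s t c
    have h2 : k ^ 2 * (g * y * g⁻¹) * (k ^ 2)⁻¹ = (g * y * g⁻¹)⁻¹ := by
      have h3 := (hkc g hg).eq
      have h4 : g⁻¹ * (k ^ 2)⁻¹ = (k ^ 2)⁻¹ * g⁻¹ := by rw [← _root_.mul_inv_rev, ← _root_.mul_inv_rev, h3]
      calc _ = (k ^ 2 * g) * y * (g⁻¹ * (k ^ 2)⁻¹) := by group
        _ = g * (k ^ 2 * y * (k ^ 2)⁻¹) * g⁻¹ := by rw [h4, ← h3]; group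
        _ = _ := by rw [hzy]; group
    rw [hc, h2, ← hc, hP.inv] at h1
    have h5 : -c = c := (hP.injective h1).2.2
    have h44 : (44 : ZMod 43) = 1 := rfl
    refine ⟨s, t, ?_⟩
    rw [← hc, show c = 0 by linear_combination -22 * h5 - c * h44]
  have key2 : ∀ g : H, ∃ A : Matrix (Fin 2) (Fin 2) (ZMod 43), ∀ a b c : ZMod 43,
      (g : G) * heis u v x a b c * (g : G)⁻¹ =
        heis u v x (A 0 0 * a + A 0 1 * b) (A 1 0 * a + A 1 1 * b) (A.det * c) := by
    intro g
    obtain ⟨s, t, hs⟩ := key g g.2 u hu hzu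
    obtain ⟨s', t', hs'⟩ := key g g.2 v hv hzv
    refine ⟨!![s, s'; t, t'], fun a b c => ?_⟩
    rw [hP.conj hs hs']
    simp only [det_fin_two, of_apply, cons_val', cons_val_zero, cons_val_one, cons_val_fin_one]
    congr 1 <;> ring
  choose M hM using key2
  have huniq : ∀ (g : H) (A : Matrix (Fin 2) (Fin 2) (ZMod 43)),
      (∀ a b, (g : G) * heis u v x a b 0 * (g : G)⁻¹ =
        heis u v x (A 0 0 * a + A 0 1 * b) (A 1 0 * a + A 1 1 * b) 0) → M g = A := by
    intro g A hA
    obtain ⟨h1, h2, -⟩ := hP.injective ((hM g 1 0 0).symm.trans (hA 1 0))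
    obtain ⟨h3, h4, -⟩ := hP.injective ((hM g 0 1 0).symm.trans (hA 0 1))
    ext i j
    fin_cases i <;> fin_cases j <;> simp_all
  refine ⟨u, v, x, ⟨⟨M, huniq 1 1 (by simp)⟩, fun g g' => huniq _ _ fun a b => ?_⟩, hP, hu, hv, hx,
    ⟨⟨k, hk⟩, huniq _ _ fun a b => ?_⟩, hM⟩
  · have h1 : ((g * g' : H) : G) * heis u v x a b 0 * ((g * g' : H) : G)⁻¹ =
      g * (g' * heis u v x a b 0 * (g' : G)⁻¹) * (g : G)⁻¹ := by push_cast; group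
    rw [h1, hM, hM]
    simp only [Matrix.mul_apply, Fin.sum_univ_two]
    congr 1 <;> ring
  · rw [hP.conj (s := 0) (t := 1) (s' := -1) (t' := 0)]
    · simp
    · rw [IsHeisenberg.heis_v, hku]
    · rw [← neg_zero, ← hP.inv, IsHeisenberg.heis_u, hkv]

end IsLocal

end

end U343

namespace U343

open Matrix

instance : Fact (Nat.Prime 43) := ⟨by norm_num⟩

instance : Fact (∀ r : ZMod 43, r ^ 2 ≠ -1 + 0 * r) := ⟨by decide⟩

/-- The field with `43 ^ 2` elements, generated by a square root of `-1`. -/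
abbrev GaussField := QuadraticAlgebra (ZMod 43) (-1) 0

instance : Finite GaussField := Finite.of_equiv _ (QuadraticAlgebra.equivProd (-1 : ZMod 43) 0).symm

theorem card_gaussField : Nat.card GaussField = 43 ^ 2 := by
  rw [Nat.card_congr (QuadraticAlgebra.equivProd (-1 : ZMod 43) 0), Nat.card_prod, Nat.card_zmod]
  norm_num

theorem card_units_gaussField : Nat.card GaussFieldˣ = 1848 := by
  rw [Nat.card_units, card_gaussField]
  norm_num

/-- The norm of the field with `43 ^ 2` elements over its prime field. -/
def nrm (α : GaussField) : ZMod 43 := α.re ^ 2 + α.im ^ 2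

theorem nrm_mul (α β : GaussField) : nrm (α * β) = nrm α * nrm β := by
  simp only [nrm, QuadraticAlgebra.re_mul, QuadraticAlgebra.im_mul]
  ring

/-- The area form on the field with `43 ^ 2` elements. -/
def wedge (α β : GaussField) : ZMod 43 := α.re * β.im - β.re * α.im

theorem wedge_mul (γ α β : GaussField) : wedge (γ * α) (γ * β) = nrm γ * wedge α β := by
  simp only [nrm, wedge, QuadraticAlgebra.re_mul, QuadraticAlgebra.im_mul]
  ring

section

variable {G : Type*} [Group G]

/-- Coordinates on a Frobenius-like group `P * H`, identifying `P` with a Heisenberg group over `ZMod 43`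
and `H` with the multiplicative group of the field with `43 ^ 2` elements. -/
structure IsForm (P H : Subgroup G) (p : GaussField → ZMod 43 → G) (m : GaussFieldˣ →* G) : Prop where
  p_mem : ∀ α c, p α c ∈ P
  p_injective : ∀ {α c α' c'}, p α c = p α' c' → α = α' ∧ c = c'
  p_surjective : ∀ y ∈ P, ∃ α c, p α c = y
  p_mul : ∀ α c α' c', p α c * p α' c' = p (α + α') (c + c' + 22 * wedge α α')
  m_mem : ∀ β, m β ∈ H
  m_surjective : ∀ g ∈ H, ∃ β, m β = g
  conj : ∀ β α c, m β * p α c * (m β)⁻¹ = p (β * α) (nrm β * c)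

theorem IsLocal.exists_isForm [Finite G] {P Z H : Subgroup G} (h : IsLocal P Z)
    (hH : H ≤ Subgroup.normalizer (Z : Set G)) (hcard : Nat.card H = 1848) :
    ∃ p m, IsForm P H p m := by
  obtain ⟨u, v, x, M, hP, hu, hv, hx, ⟨k, hk⟩, hM⟩ := h.exists_matrix_rep hH hcard
  have hfree : ∀ (g : H) (v : Fin 2 → ZMod 43), v ≠ 0 → M g *ᵥ v = v → g = 1 := by
    intro g w hw hgw
    by_contra hg
    have h0 : w 0 = M g 0 0 * w 0 + M g 0 1 * w 1 := by
      conv_lhs => rw [← hgw]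
      simp [Matrix.mulVec, dotProduct, Fin.sum_univ_two]
    have h1 : w 1 = M g 1 0 * w 0 + M g 1 1 * w 1 := by
      conv_lhs => rw [← hgw]
      simp [Matrix.mulVec, dotProduct, Fin.sum_univ_two]
    have h2 := hM g (w 0) (w 1) 0
    rw [← h0, ← h1, mul_zero] at h2
    have h3 := h.mem_of_conj_eq_mul hH hcard g.2 (by simpa using hg) (h.heis_mem hu hv hx _ _ _)
      (one_mem Z) (h2.trans (mul_one _).symm)
    obtain ⟨h4, h5⟩ := h.eq_zero_of_heis_mem hP hu hv hx h3
    exact hw (funext fun i => by fin_cases i <;> assumption)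
  have hK : Nat.card (detHom M).ker = 44 := by
    rw [← h.card_inf_centralizer hH hcard hx hP.x_ne, ← Subgroup.card_map_of_injective
      H.subtype_injective]
    have hgx : ∀ g : H, (g : G) * x * (g : G)⁻¹ = heis u v x 0 0 (M g).det := fun g => by
      have := hM g 0 0 1
      simpa [IsHeisenberg.heis_x, zpw_one] using this
    have : (detHom M).ker.map H.subtype = H ⊓ Subgroup.centralizer {x} := by
      ext g
      simp only [Subgroup.mem_map, MonoidHom.mem_ker, Subgroup.mem_inf, mem_centralizer,
        Subgroup.subtype_apply, ← Units.val_inj, coe_detHom, Units.val_one]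
      constructor
      · rintro ⟨g, hg, rfl⟩
        refine ⟨g.2, (show Commute (g : G) x from mul_inv_eq_iff_eq_mul.1 ?_).symm⟩
        rw [hgx, hg, IsHeisenberg.heis_x, zpw_one]
      · rintro ⟨hg, hgc⟩
        refine ⟨⟨g, hg⟩, ?_, rfl⟩
        have h1 := hgx ⟨g, hg⟩
        rw [show g * x * g⁻¹ = heis u v x 0 0 1 by
          rw [← hgc.eq, mul_inv_cancel_right, IsHeisenberg.heis_x, zpw_one]] at h1
        exact (hP.injective h1).2.2.symm
    rw [this]
  have hform := apply_eq_of_free hfree hcard hK hk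
  let f : H →* GaussField :=
    { toFun := fun g => ⟨M g 0 0, M g 1 0⟩
      map_one' := by ext <;> simp [QuadraticAlgebra.re_one, QuadraticAlgebra.im_one]
      map_mul' := fun a b => by
        have h1 := hform a
        ext
        · simp [Matrix.mul_apply, Fin.sum_univ_two, h1.2]
        · simp [Matrix.mul_apply, Fin.sum_univ_two, h1.1, add_comm] }
  have hf : Function.Injective f.toHomUnits := by
    intro a b hab
    have h1 : f a = f b := congrArg Units.val hab
    have h2 : M a 0 0 = M b 0 0 := congrArg QuadraticAlgebra.re h1
    have h3 : M a 1 0 = M b 1 0 := congrArg QuadraticAlgebra.im h1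
    refine injective_of_free hfree ?_
    ext i j
    fin_cases i <;> fin_cases j <;> simp [h2, h3, (hform a).1, (hform b).1, (hform a).2, (hform b).2]
  let e : H ≃* GaussFieldˣ := MulEquiv.ofBijective f.toHomUnits (hf.bijective_of_nat_card_le (by
    rw [card_units_gaussField, hcard]))
  refine ⟨fun α c => heis u v x α.re α.im c, H.subtype.comp e.symm.toMonoidHom,
    fun α c => h.heis_mem hu hv hx _ _ _, fun h1 => ?_, fun y hy => ?_, fun α c α' c' => ?_,
    fun β => (e.symm β).2, fun g hg => ⟨e ⟨g, hg⟩, by simp⟩, fun β α c => ?_⟩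
  · obtain ⟨h1, h2, h3⟩ := hP.injective h1
    exact ⟨QuadraticAlgebra.ext h1 h2, h3⟩
  · obtain ⟨a, b, c, h1⟩ := h.exists_heis_eq hP hu hv hx hy
    exact ⟨⟨a, b⟩, c, h1⟩
  · simp only [hP.mul, wedge, QuadraticAlgebra.re_add, QuadraticAlgebra.im_add]
  · obtain ⟨g, rfl⟩ := e.surjective β
    have hg : (H.subtype.comp e.symm.toMonoidHom) (e g) = g := by simp
    have h1 : (e g : GaussField) = ⟨M g 0 0, M g 1 0⟩ := rfl
    rw [hg, hM, h1, det_fin_two, (hform g).1, (hform g).2]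
    simp only [nrm, QuadraticAlgebra.re_mul, QuadraticAlgebra.im_mul]
    congr 1 <;> ring

end

end U343

namespace U343

open Equiv

/-- The points of the Hermitian curve over the field with `43 ^ 2` elements, with a point at infinity. -/
abbrev HermPoint := Option (GaussField × ZMod 43)

/-- The Heisenberg translation by `(α, c)`. -/
def trl (α : GaussField) (c : ZMod 43) : Perm HermPoint :=
  optionCongr
    { toFun := fun q => (α + q.1, c + q.2 + 22 * wedge α q.1)
      invFun := fun q => (-α + q.1, -c + q.2 + 22 * wedge (-α) q.1)
      left_inv := fun q => by
        ext1
        · simp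
        · simp only [wedge, QuadraticAlgebra.re_add, QuadraticAlgebra.im_add, QuadraticAlgebra.re_neg,
            QuadraticAlgebra.im_neg]
          ring
      right_inv := fun q => by
        ext1
        · simp
        · simp only [wedge, QuadraticAlgebra.re_add, QuadraticAlgebra.im_add, QuadraticAlgebra.re_neg,
            QuadraticAlgebra.im_neg]
          ring }

/-- The dilation by `β`. -/
def dil (β : GaussFieldˣ) : Perm HermPoint :=
  optionCongr
    { toFun := fun q => (β * q.1, nrm β * q.2)
      invFun := fun q => (↑β⁻¹ * q.1, nrm ↑β⁻¹ * q.2)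
      left_inv := fun q => by
        ext1
        · simp
        · simp only [← mul_assoc, ← nrm_mul]
          simp [nrm, QuadraticAlgebra.re_one, QuadraticAlgebra.im_one]
      right_inv := fun q => by
        ext1
        · simp
        · simp only [← mul_assoc, ← nrm_mul]
          simp [nrm, QuadraticAlgebra.re_one, QuadraticAlgebra.im_one] }

@[simp] theorem trl_none (α : GaussField) (c : ZMod 43) : trl α c none = none := rfl

@[simp] theorem trl_some (α : GaussField) (c : ZMod 43) (q : GaussField × ZMod 43) :
    trl α c (some q) = some (α + q.1, c + q.2 + 22 * wedge α q.1) := rfl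

@[simp] theorem dil_none (β : GaussFieldˣ) : dil β none = none := rfl

@[simp] theorem dil_some (β : GaussFieldˣ) (q : GaussField × ZMod 43) :
    dil β (some q) = some (β * q.1, nrm β * q.2) := rfl

/-- A group of permutations of the Hermitian curve that resembles the unitary group. -/
structure IsUnitaryLike (L : Subgroup (Perm HermPoint)) : Prop where
  trl_mem : ∀ α c, trl α c ∈ L
  dil_mem : ∀ β, dil β ∈ L
  exists_eq : ∀ g ∈ L, g none = none → ∃ α c β, g = trl α c * dil β
  exists_ne : ∃ g ∈ L, g none ≠ none

section

variable {G : Type*} [Group G] [Finite G] {P Z : Subgroup G}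

theorem IsLocal.exists_mem_eq_mul (h : IsLocal P Z) (hG : ODPattern G)
    {a : G ⧸ Subgroup.normalizer (Z : Set G)} (ha : a ≠ ((1 : G) : G ⧸ Subgroup.normalizer (Z : Set G)))
    {b : G} (hb : b ∈ Subgroup.normalizer (Z : Set G)) :
    ∃ x ∈ P, ∃ y ∈ Subgroup.normalizer (Z : Set G) ⊓ MulAction.stabilizer G a, x * y = b := by
  have hb1 : b • ((1 : G) : G ⧸ Subgroup.normalizer (Z : Set G)) = ((1 : G) : G ⧸ _) := by
    rw [MulAction.Quotient.smul_coe, QuotientGroup.eq]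
    simpa using inv_mem hb
  obtain ⟨x, hx, hxa⟩ := h.exists_mem_smul_eq hG ha (b := b • a) fun h1 => ha (by
    rwa [← hb1, smul_left_cancel_iff] at h1)
  refine ⟨x, hx, x⁻¹ * b,
    Subgroup.mem_inf.2 ⟨mul_mem (inv_mem (h.le_normalizer hx)) hb, ?_⟩, mul_inv_cancel_left _ _⟩
  rw [MulAction.mem_stabilizer_iff, mul_smul, ← hxa, inv_smul_smul]

theorem IsLocal.eq_one_of_smul_eq (h : IsLocal P Z)
    {a : G ⧸ Subgroup.normalizer (Z : Set G)} (ha : a ≠ ((1 : G) : G ⧸ Subgroup.normalizer (Z : Set G)))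
    {x : G} (hx : x ∈ P) (hxa : x • a = a) : x = 1 :=
  congrArg Subtype.val (h.eq_one_of_smul_others ⟨x, hx⟩ ⟨a, ha⟩ (Subtype.ext hxa))

theorem IsLocal.card_complement (h : IsLocal P Z) (hG : ODPattern G)
    {a : G ⧸ Subgroup.normalizer (Z : Set G)} (ha : a ≠ ((1 : G) : G ⧸ Subgroup.normalizer (Z : Set G))) :
    Nat.card (Subgroup.normalizer (Z : Set G) ⊓ MulAction.stabilizer G a : Subgroup G) = 1848 := by
  set H := Subgroup.normalizer (Z : Set G) ⊓ MulAction.stabilizer G a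
  let f : P × H → Subgroup.normalizer (Z : Set G) := fun i =>
    ⟨i.1 * i.2, mul_mem (h.le_normalizer i.1.2) i.2.2.1⟩
  have hf : Function.Bijective f := by
    constructor
    · rintro ⟨x, y⟩ ⟨x', y'⟩ hij
      have h1 : (x : G) * y = x' * y' := congrArg Subtype.val hij
      have h2 : ((x' : G)⁻¹ * x) • a = a := by
        rw [show (x' : G)⁻¹ * x = y' * (y : G)⁻¹ by
          rw [eq_mul_inv_iff_mul_eq, mul_assoc, h1, inv_mul_cancel_left], mul_smul,
          show (y : G)⁻¹ • a = a from inv_smul_eq_iff.2 (show (y : G) • a = a from y.2.2).symm]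
        exact y'.2.2
      have h3 := inv_mul_eq_one.1 (h.eq_one_of_smul_eq ha (mul_mem (inv_mem x'.2) x.2) h2)
      rw [h3, mul_right_inj] at h1
      exact Prod.ext (Subtype.ext h3.symm) (Subtype.ext h1)
    · rintro ⟨b, hb⟩
      obtain ⟨x, hx, y, hy, hxy⟩ := h.exists_mem_eq_mul hG ha hb
      exact ⟨(⟨x, hx⟩, ⟨y, hy⟩), Subtype.ext hxy⟩
  have h1 := Nat.card_congr (Equiv.ofBijective f hf)
  rw [Nat.card_prod, h.card_P, h.card_normalizer hG] at h1
  exact Nat.eq_of_mul_eq_mul_left (by norm_num) h1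

end

theorem exists_isUnitaryLike {G : Type*} [Group G] [Finite G] (hG : ODPattern G) :
    ∃ φ : G →* Perm HermPoint, Function.Injective φ ∧ IsUnitaryLike φ.range := by
  obtain ⟨P, Z, h⟩ := exists_isLocal hG
  set B := Subgroup.normalizer (Z : Set G)
  have hB : B ≠ ⊤ := fun h1 => by
    have := h.index_normalizer hG
    rw [show Subgroup.normalizer (Z : Set G) = ⊤ from h1, Subgroup.index_top] at this
    norm_num at this
  obtain ⟨g₀, -, hg₀⟩ := SetLike.exists_of_lt (lt_top_iff_ne_top.2 hB)
  have hfix : ∀ b : G, b • ((1 : G) : G ⧸ B) = ((1 : G) : G ⧸ B) ↔ b ∈ B := fun b => by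
    rw [MulAction.Quotient.smul_coe, QuotientGroup.eq]
    simp
  set o : G ⧸ B := ((1 : G) : G ⧸ B)
  set a : G ⧸ B := g₀ • o
  have ha : a ≠ o := fun h1 => hg₀ ((hfix g₀).1 h1)
  obtain ⟨p, m, hpm⟩ := h.exists_isForm (inf_le_left : B ⊓ MulAction.stabilizer G a ≤ B)
    (h.card_complement hG ha)
  have hpB : ∀ α c, p α c ∈ B := fun α c => h.le_normalizer (hpm.p_mem α c)
  have hpo : ∀ α c, p α c • o = o := fun α c => (hfix _).2 (hpB α c)
  have hmo : ∀ β, m β • o = o := fun β => (hfix _).2 (hpm.m_mem β).1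
  have hma : ∀ β, m β • a = a := fun β => (hpm.m_mem β).2
  have hpa : ∀ α c, p α c • a ≠ o := fun α c h1 => ha (by
    rwa [← hpo α c, smul_left_cancel_iff] at h1)
  let e : HermPoint ≃ G ⧸ B := Equiv.ofBijective (fun q => q.elim o fun q => p q.1 q.2 • a) (by
    constructor
    · rintro (_ | ⟨α, c⟩) (_ | ⟨α', c'⟩) h1
      · rfl
      · exact absurd h1.symm (hpa _ _)
      · exact absurd h1 (hpa _ _)
      · have h1 : p α c • a = p α' c' • a := h1
        have h2 := h.eq_one_of_smul_eq ha (mul_mem (inv_mem (hpm.p_mem α' c')) (hpm.p_mem α c))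
          (by rw [mul_smul, h1, inv_smul_smul])
        obtain ⟨rfl, rfl⟩ := hpm.p_injective (inv_mul_eq_one.1 h2)
        rfl
    · intro b
      by_cases hb : b = o
      · exact ⟨none, hb.symm⟩
      · obtain ⟨x, hx, hxb⟩ := h.exists_mem_smul_eq hG ha hb
        obtain ⟨α, c, rfl⟩ := hpm.p_surjective x hx
        exact ⟨some (α, c), hxb⟩)
  have he0 : e none = o := rfl
  have he1 : ∀ α c, e (some (α, c)) = p α c • a := fun α c => rfl
  let φ : G →* Perm HermPoint := (e.symm.permCongrHom.toMonoidHom).comp (MulAction.toPermHom G (G ⧸ B))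
  have hφ : ∀ g q r, φ g q = r ↔ g • e q = e r := fun g q r => e.symm_apply_eq
  have hp : ∀ α c, φ (p α c) = trl α c := fun α c => by
    ext1 q
    rw [hφ]
    rcases q with _ | ⟨α', c'⟩
    · exact hpo α c
    · rw [trl_some, he1, he1, ← mul_smul, hpm.p_mul]
  have hm : ∀ β, φ (m β) = dil β := fun β => by
    ext1 q
    rw [hφ]
    rcases q with _ | ⟨α', c'⟩
    · exact hmo β
    · rw [dil_some, he1, he1, ← hpm.conj, mul_smul, mul_smul, inv_smul_eq_iff.2 (hma β).symm]
  have hdec : ∀ g, φ g none = none → ∃ α c β, g = p α c * m β := by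
    intro g hg
    obtain ⟨x, hx, y, hy, rfl⟩ := h.exists_mem_eq_mul hG ha ((hfix g).1 ((hφ _ _ _).1 hg))
    obtain ⟨α, c, rfl⟩ := hpm.p_surjective x hx
    obtain ⟨β, rfl⟩ := hpm.m_surjective y hy
    exact ⟨α, c, β, rfl⟩
  refine ⟨φ, (injective_iff_map_eq_one φ).2 fun g hg => ?_, fun α c => ⟨_, hp α c⟩,
    fun β => ⟨_, hm β⟩, ?_, ?_⟩
  · obtain ⟨α, c, β, rfl⟩ := hdec g (by rw [hg]; rfl)
    rw [map_mul, hp, hm] at hg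
    have h1 := Equiv.congr_fun hg (some (0, 0))
    have h2 := Equiv.congr_fun hg (some (1, 0))
    simp [wedge] at h1 h2
    obtain ⟨rfl, h1⟩ := h1
    have h3 : β = 1 := Units.ext (by simpa using h2.1)
    subst h3
    rw [h1, map_one, mul_one]
    simpa [wedge] using hpm.p_mul 0 0 0 0
  · rintro _ ⟨g, rfl⟩ hg
    obtain ⟨α, c, β, rfl⟩ := hdec g hg
    exact ⟨α, c, β, by rw [map_mul, hp, hm]⟩
  · exact ⟨φ g₀, ⟨g₀, rfl⟩, fun h1 => ha ((hφ _ _ _).1 h1)⟩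

end U343

namespace U343

open Equiv

theorem two_ne_zero_zmod : (2 : ZMod 43) ≠ 0 := by decide

theorem nrm_zero : nrm 0 = 0 := by simp [nrm]

theorem nrm_one : nrm 1 = 1 := by simp [nrm, QuadraticAlgebra.re_one, QuadraticAlgebra.im_one]

theorem nrm_neg (α : GaussField) : nrm (-α) = nrm α := by simp [nrm]

theorem wedge_self (α : GaussField) : wedge α α = 0 := sub_self _

theorem wedge_zero_left (α : GaussField) : wedge 0 α = 0 := by simp [wedge]

theorem wedge_zero_right (α : GaussField) : wedge α 0 = 0 := by simp [wedge]

theorem wedge_neg_left (α β : GaussField) : wedge (-α) β = -wedge α β := by simp [wedge]; ring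

theorem wedge_neg_right (α β : GaussField) : wedge α (-β) = -wedge α β := by simp [wedge]; ring

theorem wedge_add_right (α β γ : GaussField) : wedge α (β + γ) = wedge α β + wedge α γ := by
  simp only [wedge, QuadraticAlgebra.re_add, QuadraticAlgebra.im_add]; ring

theorem wedge_add_left (α β γ : GaussField) : wedge (α + β) γ = wedge α γ + wedge β γ := by
  simp only [wedge, QuadraticAlgebra.re_add, QuadraticAlgebra.im_add]; ring

theorem nrm_pow (α : GaussField) (n : ℕ) : nrm (α ^ n) = nrm α ^ n := by
  induction n with
  | zero => simp [nrm_one]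
  | succ n ih => rw [pow_succ, nrm_mul, ih, pow_succ]

theorem nrm_ne_zero {α : GaussField} (hα : α ≠ 0) : nrm α ≠ 0 := fun h => by
  have h1 := nrm_mul α α⁻¹
  rw [mul_inv_cancel₀ hα, nrm_one, h, zero_mul] at h1
  exact one_ne_zero h1

instance : CharP GaussField 43 :=
  charP_of_injective_algebraMap (algebraMap (ZMod 43) GaussField).injective 43

theorem two_ne_zero_gaussField : (2 : GaussField) ≠ 0 := fun h =>
  two_ne_zero_zmod (congrArg QuadraticAlgebra.re h)

theorem eq_zero_of_two_mul {α : GaussField} (h : α + α = 0) : α = 0 := by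
  rw [← two_mul] at h
  exact (mul_eq_zero.1 h).resolve_left two_ne_zero_gaussField

theorem pow_43 (α : GaussField) : α ^ 43 = ⟨α.re, -α.im⟩ := by
  have h1 : α = algebraMap (ZMod 43) GaussField α.re + algebraMap (ZMod 43) GaussField α.im *
      (⟨0, 1⟩ : GaussField) := by
    ext <;> simp
  have h2 : (⟨0, 1⟩ : GaussField) ^ 2 = -1 := by
    ext <;> simp [pow_two, QuadraticAlgebra.re_one, QuadraticAlgebra.im_one]
  have h3 : (⟨0, 1⟩ : GaussField) ^ 43 = -⟨0, 1⟩ := by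
    rw [pow_succ _ 42, pow_mul _ 2 21, h2]
    ring
  conv_lhs => rw [h1]
  rw [add_pow_char, mul_pow, ← map_pow, ← map_pow, ZMod.pow_card, ZMod.pow_card, h3]
  ext <;> simp

theorem pow_44 (α : GaussField) : α ^ 44 = ⟨nrm α, 0⟩ := by
  rw [pow_succ, pow_43]
  ext
  · simp [nrm]; ring
  · simp; ring

theorem nrm_eq_one_iff (β : GaussFieldˣ) : nrm β = 1 ↔ β ^ 44 = 1 := by
  rw [← Units.val_inj, Units.val_pow_eq_pow_val, pow_44]
  refine ⟨fun h => ?_, fun h => congrArg QuadraticAlgebra.re h⟩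
  rw [h]
  rfl

theorem units_eq_one_or {β : GaussFieldˣ} (h : β * β = 1) : β = 1 ∨ β = -1 := by
  rw [← Units.val_inj, ← Units.val_inj]
  exact mul_self_eq_one_iff.1 (congrArg Units.val h)

theorem dil_mul (β γ : GaussFieldˣ) : dil (β * γ) = dil β * dil γ := by
  ext1 q
  rcases q with _ | ⟨α, c⟩
  · rfl
  · simp only [dil_some, Perm.mul_apply, Units.val_mul, nrm_mul, mul_assoc]

theorem dil_one : dil 1 = 1 := by
  ext1 q
  rcases q with _ | ⟨α, c⟩
  · rfl
  · simp [nrm_one]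

theorem dil_injective : Function.Injective dil := fun β γ h => by
  have h1 := Equiv.congr_fun h (some (1, 0))
  exact Units.ext (by simpa using h1)

theorem dil_neg_one_some (q : GaussField × ZMod 43) : dil (-1) (some q) = some (-q.1, q.2) := by
  simp [nrm_neg, nrm_one]

theorem dil_neg_one_mul_self : dil (-1) * dil (-1) = 1 := by
  rw [← dil_mul, neg_mul_neg, one_mul, dil_one]

theorem dil_mul_trl (β : GaussFieldˣ) (α : GaussField) (c : ZMod 43) :
    dil β * trl α c = trl (β * α) (nrm β * c) * dil β := by
  ext1 q
  rcases q with _ | ⟨α, c⟩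
  · rfl
  · simp only [dil_some, Perm.mul_apply, trl_some, wedge_mul]
    ring_nf

theorem trl_zero : trl 0 0 = 1 := by
  ext1 q
  rcases q with _ | ⟨α, c⟩
  · rfl
  · simp [wedge_zero_left]

theorem trl_apply_zero (α : GaussField) (c : ZMod 43) : trl α c (some (0, 0)) = some (α, c) := by
  simp [wedge_zero_right]

theorem dil_apply_zero (β : GaussFieldˣ) : dil β (some (0, 0)) = some (0, 0) := by simp

theorem trl_neg_apply (α : GaussField) (c : ZMod 43) : trl (-α) (-c) (some (α, c)) = some (0, 0) := by
  simp [wedge_neg_left, wedge_self]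

theorem trl_neg (α : GaussField) (c : ZMod 43) : trl (-α) (-c) = (trl α c)⁻¹ := by
  rw [eq_inv_iff_mul_eq_one]
  ext1 q
  rcases q with _ | ⟨α, c⟩
  · rfl
  · simp [wedge_neg_left, wedge_add_right, wedge_self]
    ring

theorem dil_neg_one_fixed {q : HermPoint} :
    dil (-1) q = q ↔ q = none ∨ ∃ c, q = some (0, c) := by
  rcases q with _ | ⟨α, c⟩
  · simp
  · rw [dil_neg_one_some]
    simp only [Option.some.injEq, Prod.mk.injEq, and_true, reduceCtorEq, false_or]
    constructor
    · intro h
      exact ⟨c, eq_zero_of_two_mul (by linear_combination -h), rfl⟩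
    · rintro ⟨c, rfl, -⟩
      exact neg_zero

end U343

namespace U343

open Equiv

/-- An involution of `L`, conjugate to `dil (-1)`, that swaps the points at infinity and at the origin. -/
structure IsSwap (L : Subgroup (Perm HermPoint)) (w : Perm HermPoint) : Prop where
  mem : w ∈ L
  apply_none : w none = some (0, 0)
  mul_self : w * w = 1
  exists_conj : ∃ r ∈ L, w = r⁻¹ * dil (-1) * r

namespace IsUnitaryLike

variable {L : Subgroup (Perm HermPoint)} (h : IsUnitaryLike L)
include h

theorem exists_apply_none (q : HermPoint) : ∃ g ∈ L, g none = q := by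
  rcases q with _ | ⟨α, c⟩
  · exact ⟨1, one_mem _, rfl⟩
  · obtain ⟨g, hg, hg1⟩ := h.exists_ne
    obtain ⟨⟨α', c'⟩, hq⟩ := Option.ne_none_iff_exists'.1 hg1
    refine ⟨trl α c * trl (-α') (-c') * g, mul_mem (mul_mem (h.trl_mem _ _) (h.trl_mem _ _)) hg, ?_⟩
    rw [Perm.mul_apply, hq, Perm.mul_apply, trl_neg_apply, trl_apply_zero]

theorem exists_eq_dil {g : Perm HermPoint} (hg : g ∈ L) (h1 : g none = none)
    (h2 : g (some (0, 0)) = some (0, 0)) : ∃ β, g = dil β := by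
  obtain ⟨α, c, β, rfl⟩ := h.exists_eq g hg h1
  rw [Perm.mul_apply, dil_apply_zero, trl_apply_zero] at h2
  obtain ⟨rfl, rfl⟩ := Prod.mk.inj (Option.some.inj h2)
  exact ⟨β, by rw [trl_zero, one_mul]⟩

theorem eq_trl_mul_dil_neg_one {g : Perm HermPoint} (hg : g ∈ L) (h1 : g none = none)
    (h2 : g * g = 1) (h3 : g ≠ 1) : ∃ α, g = trl α 0 * dil (-1) := by
  obtain ⟨α, c, β, rfl⟩ := h.exists_eq g hg h1
  have key : ∀ α', α + β * (α + β * α') = α' := fun α' => by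
    have := Equiv.congr_fun h2 (some (α', 0))
    simp only [Perm.mul_apply, dil_some, trl_some, Perm.one_apply, Option.some.injEq,
      Prod.mk.injEq] at this
    exact this.1
  have hα : α + β * α = 0 := by simpa using key 0
  have hβ : β * β = 1 := by
    rw [← Units.val_inj]
    push_cast
    linear_combination key 1 - hα
  rcases units_eq_one_or hβ with rfl | rfl
  · have hα0 : α = 0 := eq_zero_of_two_mul (by simpa using hα)
    subst hα0
    have := Equiv.congr_fun h2 (some (0, 0))
    simp [wedge_zero_left, nrm_one] at this
    have hc : c = 0 := (mul_eq_zero.1 ((two_mul c).trans this)).resolve_left two_ne_zero_zmod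
    subst hc
    rw [dil_one, trl_zero, one_mul] at h3
    exact absurd rfl h3
  · refine ⟨α, ?_⟩
    have := Equiv.congr_fun h2 (some (0, 0))
    simp [wedge_zero_right, wedge_neg_right, wedge_self, nrm_neg, nrm_one] at this
    have hc : c = 0 := (mul_eq_zero.1 ((two_mul c).trans this)).resolve_left two_ne_zero_zmod
    rw [hc]

theorem eq_of_commute {x y : Perm HermPoint} (hx : x ∈ L) (hy : y ∈ L) {q : HermPoint}
    (hxq : x q = q) (hyq : y q = q) (hx2 : x * x = 1) (hy2 : y * y = 1) (hx1 : x ≠ 1) (hy1 : y ≠ 1)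
    (hxy : Commute x y) : x = y := by
  obtain ⟨r, hr, hrq⟩ := h.exists_apply_none q
  have key : ∀ w ∈ L, w q = q → w * w = 1 → w ≠ 1 → ∃ α, r⁻¹ * w * r = trl α 0 * dil (-1) := by
    intro w hw hwq hw2 hw1
    refine h.eq_trl_mul_dil_neg_one (mul_mem (mul_mem (inv_mem hr) hw) hr) ?_ ?_ ?_
    · rw [Perm.mul_apply, Perm.mul_apply, hrq, hwq, Perm.inv_eq_iff_eq, hrq]
    · calc _ = r⁻¹ * (w * w) * r := by group
        _ = 1 := by rw [hw2]; group
    · intro h1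
      apply hw1
      calc w = r * (r⁻¹ * w * r) * r⁻¹ := by group
        _ = 1 := by rw [h1]; group
  obtain ⟨α, hα⟩ := key x hx hxq hx2 hx1
  obtain ⟨α', hα'⟩ := key y hy hyq hy2 hy1
  have h1 : trl α 0 * dil (-1) * (trl α' 0 * dil (-1)) = trl α' 0 * dil (-1) * (trl α 0 * dil (-1)) := by
    rw [← hα, ← hα']
    calc _ = r⁻¹ * (x * y) * r := by group
      _ = _ := by rw [hxy.eq]; group
  have h2 := Equiv.congr_fun h1 (some (0, 0))
  simp only [Perm.mul_apply, dil_neg_one_some, trl_some, Option.some.injEq, Prod.mk.injEq] at h2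
  have h3 : α = α' := sub_eq_zero.1 (eq_zero_of_two_mul (by linear_combination h2.1))
  rw [h3, ← hα'] at hα
  exact mul_left_cancel (mul_right_cancel hα)

theorem exists_isSwap : ∃ w, IsSwap L w := by
  obtain ⟨g, hg, hg1⟩ := h.exists_apply_none (some (1, 0))
  have hg2 : (g⁻¹ * dil (-1) * g) none ≠ none := by
    rw [Perm.mul_apply, Perm.mul_apply, hg1, ne_eq, Perm.inv_eq_iff_eq, hg1, dil_neg_one_some]
    intro h1
    have h2 : (-1 : GaussField) = 1 := congrArg Prod.fst (Option.some.inj h1)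
    exact one_ne_zero (eq_zero_of_two_mul (by linear_combination -h2))
  obtain ⟨⟨α, c⟩, hq⟩ := Option.ne_none_iff_exists'.1 hg2
  refine ⟨(g * trl α c)⁻¹ * dil (-1) * (g * trl α c), ?_, ?_, ?_, g * trl α c, ?_, rfl⟩
  · exact mul_mem (mul_mem (inv_mem (mul_mem hg (h.trl_mem _ _))) (h.dil_mem _))
      (mul_mem hg (h.trl_mem _ _))
  · calc _ = (trl α c)⁻¹ ((g⁻¹ * dil (-1) * g) (trl α c none)) := by
          simp only [mul_inv_rev, Perm.mul_apply]
      _ = _ := by rw [trl_none, hq, ← trl_neg, trl_neg_apply]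
  · calc _ = (g * trl α c)⁻¹ * (dil (-1) * dil (-1)) * (g * trl α c) := by group
      _ = 1 := by rw [dil_neg_one_mul_self]; group
  · exact mul_mem hg (h.trl_mem _ _)

end IsUnitaryLike

end U343

namespace U343

open Equiv

theorem trl_zero_apply (c d : ZMod 43) : trl 0 c (some (0, d)) = some (0, c + d) := by
  simp [wedge_zero_left]

theorem commute_dil_trl {β : GaussFieldˣ} (hβ : nrm β = 1) (c : ZMod 43) :
    Commute (dil β) (trl 0 c) := by
  rw [commute_iff_eq, dil_mul_trl, hβ, mul_zero, one_mul]

theorem card_fixedBy_dil_neg_one : Nat.card (MulAction.fixedBy HermPoint (dil (-1))) = 44 := by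
  let f : Option (ZMod 43) → MulAction.fixedBy HermPoint (dil (-1)) := fun c =>
    ⟨c.map (fun c => (0, c)), dil_neg_one_fixed.2 (by rcases c with _ | c <;> simp)⟩
  have hf : Function.Bijective f := by
    constructor
    · intro c d hcd
      exact Option.map_injective (Prod.mk_right_injective _) (congrArg Subtype.val hcd)
    · rintro ⟨q, hq⟩
      rcases dil_neg_one_fixed.1 hq with rfl | ⟨c, rfl⟩
      · exact ⟨none, rfl⟩
      · exact ⟨some c, rfl⟩
  rw [← Nat.card_congr (Equiv.ofBijective f hf), Finite.card_option, Nat.card_zmod]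

namespace IsSwap

variable {L : Subgroup (Perm HermPoint)} {w : Perm HermPoint} (hw : IsSwap L w)
include hw

theorem apply_apply (q : HermPoint) : w (w q) = q := Equiv.congr_fun hw.mul_self q

theorem apply_zero : w (some (0, 0)) = none := by rw [← hw.apply_none, hw.apply_apply]

theorem conj_conj (g : Perm HermPoint) : w * (w * g * w) * w = g := by
  calc _ = (w * w) * g * (w * w) := by group
    _ = g := by rw [hw.mul_self]; group

theorem conj_mul (g g' : Perm HermPoint) : w * (g * g') * w = (w * g * w) * (w * g' * w) := by
  calc _ = w * g * 1 * g' * w := by group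
    _ = _ := by rw [← hw.mul_self]; group

theorem commute_of_conj {g : Perm HermPoint} (hg : w * g * w = g) : Commute w g := by
  rw [commute_iff_eq]
  nth_rw 2 [← hg]
  rw [mul_assoc (w * g), hw.mul_self, mul_one]

theorem card_fixedBy : Nat.card (MulAction.fixedBy HermPoint w) = 44 := by
  obtain ⟨r, -, hr⟩ := hw.exists_conj
  rw [← card_fixedBy_dil_neg_one]
  refine Nat.card_congr (Equiv.subtypeEquiv r fun q => ?_)
  rw [MulAction.mem_fixedBy, MulAction.mem_fixedBy, hr, Perm.smul_def, Perm.mul_apply, Perm.mul_apply,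
    Perm.inv_eq_iff_eq, Perm.smul_def]

variable (hL : IsUnitaryLike L)
include hL

theorem exists_sigma : ∃ σ : GaussFieldˣ →* GaussFieldˣ, ∀ β, w * dil β * w = dil (σ β) := by
  have h1 : ∀ β, ∃ γ, w * dil β * w = dil γ := fun β => by
    refine hL.exists_eq_dil (mul_mem (mul_mem hw.mem (hL.dil_mem β)) hw.mem) ?_ ?_
    · rw [Perm.mul_apply, Perm.mul_apply, hw.apply_none, dil_apply_zero, hw.apply_zero]
    · rw [Perm.mul_apply, Perm.mul_apply, hw.apply_zero, dil_none, hw.apply_none]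
  choose σ hσ using h1
  exact ⟨MonoidHom.mk' σ fun β γ => dil_injective (by
    rw [dil_mul, ← hσ, dil_mul, hw.conj_mul, hσ, hσ]), hσ⟩

variable {σ : GaussFieldˣ →* GaussFieldˣ} (hσ : ∀ β, w * dil β * w = dil (σ β))
include hσ

omit hL in
theorem sigma_sigma (β : GaussFieldˣ) : σ (σ β) = β :=
  dil_injective (by rw [← hσ, ← hσ, hw.conj_conj])

omit hL in
theorem sigma_neg_one : σ (-1) = -1 := by
  rcases units_eq_one_or (β := σ (-1)) (by rw [← map_mul, neg_mul_neg, one_mul, map_one]) with h1 | h1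
  · have h2 := hw.sigma_sigma hσ (-1)
    rw [h1, map_one] at h2
    rw [h1]
    exact h2
  · exact h1

omit hL in
theorem commute_dil_neg_one : Commute w (dil (-1)) :=
  hw.commute_of_conj (by rw [hσ, hw.sigma_neg_one hσ])

omit hL in
theorem exists_apply_eq {c : ZMod 43} (hc : c ≠ 0) : ∃ d, w (some (0, c)) = some (0, d) := by
  have h1 : dil (-1) (w (some (0, c))) = w (some (0, c)) := by
    rw [← Perm.mul_apply, ← (hw.commute_dil_neg_one hσ).eq, Perm.mul_apply, dil_neg_one_some, neg_zero]
  rcases dil_neg_one_fixed.1 h1 with h2 | h2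
  · rw [← hw.apply_zero] at h2
    exact absurd (Prod.mk.inj (Option.some.inj (w.injective h2))).2 hc
  · exact h2

theorem sigma_eq_of_nrm {β : GaussFieldˣ} (hβ : nrm β = 1) : σ β = β := by
  have hK : ∀ γ : GaussFieldˣ, nrm γ = 1 → nrm (σ γ) = 1 := fun γ hγ => by
    rw [nrm_eq_one_iff, ← map_pow, (nrm_eq_one_iff γ).1 hγ, map_one]
  have hcomm : ∀ γ : GaussFieldˣ, nrm γ = 1 → ∀ c, Commute (dil γ) (w * trl 0 c * w) := by
    intro γ hγ c
    have h1 := commute_dil_trl (hK γ hγ) c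
    rw [← hσ] at h1
    rw [commute_iff_eq, ← hw.conj_conj (dil γ), ← hw.conj_mul, h1.eq, hw.conj_mul]
  obtain ⟨d, hd⟩ := hw.exists_apply_eq hσ one_ne_zero
  obtain ⟨e, he⟩ := hw.exists_apply_eq hσ (neg_ne_zero.2 one_ne_zero)
  set t := (w * trl 0 (-e) * w) * trl 0 (-1) * (w * trl 0 d * w)
  have ht1 : t none = some (0, 0) := by
    have hd' : w (some (0, d)) = some (0, 1) := by rw [← hd, hw.apply_apply]
    simp only [t, Perm.mul_apply, hw.apply_none, trl_zero_apply, add_zero, hd', neg_add_cancel,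
      hw.apply_zero, trl_none]
  have ht2 : t (some (0, 0)) = none := by
    simp only [t, Perm.mul_apply, hw.apply_none, trl_zero_apply, add_zero, he, neg_add_cancel,
      hw.apply_zero, trl_none]
  have htL : t ∈ L := by
    have h1 := hw.mem
    have h2 := hL.trl_mem
    exact mul_mem (mul_mem (mul_mem (mul_mem h1 (h2 _ _)) h1) (h2 _ _))
      (mul_mem (mul_mem h1 (h2 _ _)) h1)
  have htc : Commute (dil β) t := ((hcomm β hβ _).mul_right (commute_dil_trl hβ _)).mul_right
    (hcomm β hβ _)
  obtain ⟨γ, hγ⟩ := hL.exists_eq_dil (mul_mem hw.mem htL)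
    (by rw [Perm.mul_apply, ht1, hw.apply_zero]) (by rw [Perm.mul_apply, ht2, hw.apply_none])
  have h1 : Commute (dil β) w := by
    rw [show w = dil γ * t⁻¹ by rw [← hγ, mul_inv_cancel_right]]
    refine Commute.mul_right ?_ htc.inv_right
    rw [commute_iff_eq, ← dil_mul, ← dil_mul, mul_comm]
  refine dil_injective ?_
  rw [← hσ, ← h1.eq, mul_assoc, hw.mul_self, mul_one]

theorem fst_ne_zero {q : GaussField × ZMod 43} (hq : w (some q) = some q) : q.1 ≠ 0 := by
  intro h0
  have h1 : w = dil (-1) := hL.eq_of_commute hw.mem (hL.dil_mem _) hq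
    (dil_neg_one_fixed.2 (Or.inr ⟨q.2, by rw [← h0]⟩)) hw.mul_self dil_neg_one_mul_self
    (fun h1 => by simpa [h1] using hw.apply_none) (fun h1 => by
      have h2 := Equiv.congr_fun h1 (some (1, 0))
      rw [dil_neg_one_some] at h2
      have h2 : (-1 : GaussField) = 1 := congrArg Prod.fst (Option.some.inj h2)
      exact one_ne_zero (eq_zero_of_two_mul (by linear_combination -h2)))
    (hw.commute_dil_neg_one hσ)
  have h2 := hw.apply_none
  rw [h1] at h2
  simp at h2

theorem nrm_eq_one_of_sigma_eq {β : GaussFieldˣ} (hβ : σ β = β) : nrm β = 1 := by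
  let C : Subgroup GaussFieldˣ := (σ.eqLocus (MonoidHom.id _))
  have hC : ∀ γ ∈ C, Commute (dil γ) w := fun γ hγ => by
    refine (hw.commute_of_conj ?_).symm
    rw [hσ, show σ γ = γ from hγ]
  let act : MulAction C (MulAction.fixedBy HermPoint w) :=
    { smul := fun γ q => ⟨dil γ q, by
        rw [MulAction.mem_fixedBy, Perm.smul_def, ← Perm.mul_apply, ← (hC γ γ.2).eq, Perm.mul_apply]
        exact congrArg _ q.2⟩
      one_smul := fun q => Subtype.ext (by
        change dil (1 : GaussFieldˣ) q = q
        rw [dil_one]; rfl)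
      mul_smul := fun γ δ q => Subtype.ext (by
        change dil (γ * δ : GaussFieldˣ) q = dil γ (dil δ q)
        rw [dil_mul]; rfl) }
  have h1 : Nat.card C ∣ 44 := by
    rw [← hw.card_fixedBy]
    refine card_dvd_card_of_free ?_
    rintro γ ⟨_ | q, hq⟩ hγ
    · have h2 : w none = none := hq
      rw [hw.apply_none] at h2
      cases h2
    · have h2 : w (some q) = some q := hq
      have h3 : dil (γ : GaussFieldˣ) (some q) = some q := congrArg Subtype.val hγ
      rw [dil_some] at h3
      have h4 : (γ : GaussFieldˣ) * q.1 = q.1 := congrArg Prod.fst (Option.some.inj h3)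
      exact Subtype.ext (Units.ext ((mul_eq_right₀ (hw.fst_ne_zero hL hσ h2)).1 h4))
  have h2 : (⟨β, hβ⟩ : C) ^ 44 = 1 := by
    obtain ⟨k, hk⟩ := h1
    rw [hk, pow_mul, pow_card_eq_one', one_pow]
  rw [nrm_eq_one_iff]
  exact congrArg Subtype.val h2

theorem sigma_mul_pow (β : GaussFieldˣ) : σ β * β ^ 43 = 1 := by
  let τ : GaussFieldˣ →* GaussFieldˣ := σ * powMonoidHom 43
  have hτ : ∀ γ, τ γ = σ γ * γ ^ 43 := fun γ => rfl
  have hτ1 : ∀ γ : GaussFieldˣ, nrm γ = 1 → τ γ = 1 := fun γ hγ => by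
    rw [hτ, hw.sigma_eq_of_nrm hL hσ hγ, ← pow_succ', (nrm_eq_one_iff γ).1 hγ]
  have h1848 : ∀ γ : GaussFieldˣ, γ ^ 1848 = 1 := fun γ => by
    rw [← card_units_gaussField, pow_card_eq_one']
  have h42 : τ β ^ 42 = 1 := by
    rw [← map_pow]
    refine hτ1 _ ((nrm_eq_one_iff _).2 ?_)
    rw [← pow_mul, h1848]
  have h44 : τ β ^ 44 = 1 := by
    have h1 : nrm (β * σ β : GaussFieldˣ) = 1 := by
      refine hw.nrm_eq_one_of_sigma_eq hL hσ ?_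
      rw [map_mul, hw.sigma_sigma hσ, mul_comm]
    have h2 : τ β = (β * σ β) * β ^ 42 := by rw [hτ, pow_succ' β 42]; ac_rfl
    rw [h2, mul_pow, (nrm_eq_one_iff _).1 h1, one_mul, ← pow_mul, h1848]
  have h2 : τ β * τ β = 1 := by
    calc τ β * τ β = τ β ^ 44 * (τ β ^ 42)⁻¹ := by rw [← pow_two]; group
      _ = 1 := by rw [h44, h42]; simp
  rcases units_eq_one_or h2 with h3 | h3
  · exact h3
  exfalso
  have h4 : τ (β ^ 21) = -1 := by rw [map_pow, h3, Odd.neg_one_pow (by decide)]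
  have h5 : nrm (β ^ 21 : GaussFieldˣ) * nrm (β ^ 21 : GaussFieldˣ) = 1 := by
    rw [Units.val_pow_eq_pow_val, nrm_pow, ← pow_two, ← pow_mul]
    exact ZMod.pow_card_sub_one_eq_one (nrm_ne_zero β.ne_zero)
  have hne : (1 : GaussFieldˣ) ≠ -1 := fun h6 => by
    have h7 : (1 : GaussField) = -1 := congrArg Units.val h6
    exact one_ne_zero (eq_zero_of_two_mul (by linear_combination h7))
  rcases mul_self_eq_one_iff.1 h5 with h6 | h6
  · exact hne ((hτ1 _ h6).symm.trans h4)
  · have h7 : (β ^ 21) ^ 44 = -1 := by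
      rw [← Units.val_inj, Units.val_pow_eq_pow_val, pow_44, h6]
      ext <;> simp [QuadraticAlgebra.re_one, QuadraticAlgebra.im_one]
    have h8 : σ (β ^ 21) = β ^ 21 := by
      rw [← mul_left_inj ((β ^ 21) ^ 43), ← hτ, h4, ← pow_succ', h7]
    have h9 := hw.nrm_eq_one_of_sigma_eq hL hσ h8
    exact hne ((hτ1 _ h9).symm.trans h4)

omit hσ in
theorem mul_dil (β : GaussFieldˣ) : w * dil β = dil (β ^ 43)⁻¹ * w := by
  obtain ⟨σ, hσ⟩ := hw.exists_sigma hL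
  rw [← eq_inv_of_mul_eq_one_left (hw.sigma_mul_pow hL hσ β), ← hσ, mul_assoc, hw.mul_self, mul_one]

end IsSwap

end U343

namespace U343

open Equiv

theorem exists_nrm_eq {n : ZMod 43} (hn : n ≠ 0) : ∃ β : GaussFieldˣ, nrm β = n := by
  obtain ⟨a, b, hab⟩ := ZMod.sq_add_sq 43 n
  refine ⟨Units.mk0 ⟨a, b⟩ fun h => hn ?_, hab⟩
  rw [← hab, show a = 0 from congrArg QuadraticAlgebra.re h,
    show b = 0 from congrArg QuadraticAlgebra.im h]
  simp

/-- The block through the point at infinity in the direction `α`. -/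
def line (α : GaussField) : Set HermPoint := {q | q = none ∨ ∃ c, q = some (α, c)}

/-- The block with centre `α`, radius `n` and height `d`. -/
def circ (α : GaussField) (n d : ZMod 43) : Set HermPoint :=
  {q | ∃ p : GaussField × ZMod 43, q = some p ∧ nrm (p.1 - α) = n ∧ p.2 = d + 22 * wedge α p.1}

/-- The blocks of the Hermitian unital. -/
def IsBlock (S : Set HermPoint) : Prop :=
  (∃ α, S = line α) ∨ ∃ α n d, n ≠ 0 ∧ S = circ α n d

theorem setOf_conj_dil_neg_one (r : Perm HermPoint) :
    {q | (r * dil (-1) * r⁻¹) q = q} = r '' line 0 := by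
  ext q
  rw [Equiv.image_eq_preimage_symm, Set.mem_ofPred_eq, mul_assoc, Perm.mul_apply, ← Perm.eq_inv_iff_eq,
    Perm.mul_apply, dil_neg_one_fixed]
  rfl

theorem image_trl_line_zero (α : GaussField) : trl α 0 '' line 0 = line α := by
  ext q
  constructor
  · rintro ⟨_, rfl | ⟨c, rfl⟩, rfl⟩
    · exact Or.inl rfl
    · exact Or.inr ⟨c, by simp [wedge_zero_right]⟩
  · rintro (rfl | ⟨c, rfl⟩)
    · exact ⟨none, Or.inl rfl, rfl⟩
    · exact ⟨some (0, c), Or.inr ⟨c, rfl⟩, by simp [wedge_zero_right]⟩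

theorem image_trl_circ_zero (α : GaussField) (c n d : ZMod 43) :
    trl α c '' circ 0 n d = circ α n (c + d) := by
  ext q
  constructor
  · rintro ⟨_, ⟨⟨β, e⟩, rfl, h1, h2⟩, rfl⟩
    refine ⟨_, trl_some _ _ _, by simpa using h1, ?_⟩
    simp only at h2
    simp only [h2, wedge_add_right, wedge_self, wedge_zero_left]
    ring
  · rintro ⟨⟨β, e⟩, rfl, h1, h2⟩
    refine ⟨some (β - α, d), ⟨_, rfl, by simpa using h1, by simp [wedge_zero_left]⟩, ?_⟩
    simp only at h2
    have h3 : wedge α (β - α) = wedge α β := by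
      rw [sub_eq_add_neg, wedge_add_right, wedge_neg_right, wedge_self, neg_zero, add_zero]
    rw [trl_some, h2, h3, add_sub_cancel]

theorem image_dil_circ_zero (β : GaussFieldˣ) (n d : ZMod 43) :
    dil β '' circ 0 n d = circ 0 (nrm β * n) (nrm β * d) := by
  ext q
  constructor
  · rintro ⟨_, ⟨⟨γ, e⟩, rfl, h1, h2⟩, rfl⟩
    simp only [sub_zero, wedge_zero_left, mul_zero, add_zero] at h1 h2
    exact ⟨_, dil_some _ _, by simp [nrm_mul, h1], by simp [wedge_zero_left, h2]⟩
  · rintro ⟨⟨γ, e⟩, rfl, h1, h2⟩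
    simp only [sub_zero, wedge_zero_left, mul_zero, add_zero] at h1 h2
    refine ⟨some (↑β⁻¹ * γ, d), ⟨_, rfl, ?_, by simp [wedge_zero_left]⟩, ?_⟩
    · refine mul_left_cancel₀ (nrm_ne_zero β.ne_zero) ?_
      rw [sub_zero, ← nrm_mul, Units.mul_inv_cancel_left, h1]
    · rw [dil_some, Units.mul_inv_cancel_left, h2]

theorem exists_orderOf_eq_44 : ∃ ζ : GaussFieldˣ, orderOf ζ = 44 := by
  obtain ⟨g, hg⟩ := IsCyclic.exists_generator (α := GaussFieldˣ)
  refine ⟨g ^ 42, ?_⟩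
  rw [orderOf_pow, orderOf_eq_card_of_forall_mem_zpowers hg, card_units_gaussField]
  decide

theorem IsSwap.exists_circ {L : Subgroup (Perm HermPoint)} (hL : IsUnitaryLike L)
    {w : Perm HermPoint} (hw : IsSwap L w) : ∃ n d, n ≠ 0 ∧ {q | w q = q} = circ 0 n d := by
  obtain ⟨σ, hσ⟩ := hw.exists_sigma hL
  have hcard := hw.card_fixedBy
  have : Nonempty (MulAction.fixedBy HermPoint w) := (Nat.card_pos_iff.1 (by rw [hcard]; decide)).1
  obtain ⟨⟨_ | q, hq⟩⟩ := this
  · have h2 : w none = none := hq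
    rw [hw.apply_none] at h2
    cases h2
  replace hq : w (some q) = some q := hq
  have hq0 := hw.fst_ne_zero hL hσ hq
  have hfix : ∀ β : GaussFieldˣ, nrm β = 1 → w (dil β (some q)) = dil β (some q) := fun β hβ => by
    rw [← Perm.mul_apply, (hw.commute_of_conj (g := dil β)
      (by rw [hσ, hw.sigma_eq_of_nrm hL hσ hβ])).eq, Perm.mul_apply, hq]
  obtain ⟨ζ, hζ⟩ := exists_orderOf_eq_44
  have hζ1 : ∀ i : ℕ, nrm (ζ ^ i : GaussFieldˣ) = 1 := fun i => by
    rw [nrm_eq_one_iff, ← pow_mul, mul_comm, pow_mul, ← hζ, pow_orderOf_eq_one, one_pow]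
  let f : Fin 44 → MulAction.fixedBy HermPoint w := fun i => ⟨dil (ζ ^ (i : ℕ)) (some q), hfix _ (hζ1 i)⟩
  have hf : Function.Injective f := fun i j hij => by
    have h1 : dil (ζ ^ (i : ℕ)) (some q) = dil (ζ ^ (j : ℕ)) (some q) := congrArg Subtype.val hij
    rw [dil_some, dil_some] at h1
    have h2 := mul_right_cancel₀ hq0 (congrArg Prod.fst (Option.some.inj h1))
    exact Fin.ext (pow_injOn_Iio_orderOf (by simp [hζ]) (by simp [hζ]) (Units.ext h2))
  have hsurj : Function.Surjective f :=
    ((Nat.bijective_iff_injective_and_card f).2 ⟨hf, by rw [hcard, Nat.card_fin]⟩).2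
  refine ⟨nrm q.1, q.2, nrm_ne_zero hq0, ?_⟩
  ext x
  constructor
  · intro hx
    obtain ⟨i, hi⟩ := hsurj ⟨x, hx⟩
    refine ⟨_, (congrArg Subtype.val hi).symm.trans (dil_some _ _), ?_, ?_⟩
    · rw [sub_zero, nrm_mul, hζ1, one_mul]
    · simp only [hζ1, wedge_zero_left, one_mul, mul_zero, add_zero]
  · rintro ⟨⟨γ, d⟩, rfl, h1, h2⟩
    simp only [sub_zero, wedge_zero_left, mul_zero, add_zero] at h1 h2
    have hγ : γ ≠ 0 := by
      rintro rfl
      rw [nrm_zero] at h1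
      exact nrm_ne_zero hq0 h1.symm
    have h3 : nrm (γ * q.1⁻¹) = 1 := by
      refine mul_right_cancel₀ (nrm_ne_zero hq0) ?_
      rw [← nrm_mul, inv_mul_cancel_right₀ hq0, h1, one_mul]
    have h4 := hfix (Units.mk0 _ (mul_ne_zero hγ (inv_ne_zero hq0))) h3
    rw [dil_some, Units.val_mk0, h3, inv_mul_cancel_right₀ hq0, one_mul, ← h2] at h4
    exact h4

namespace IsUnitaryLike

variable {L : Subgroup (Perm HermPoint)} (h : IsUnitaryLike L)
include h

theorem isBlock_image_line {r : Perm HermPoint} (hr : r ∈ L) : IsBlock (r '' line 0) := by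
  rw [← setOf_conj_dil_neg_one]
  generalize hy : r * dil (-1) * r⁻¹ = y
  have hyL : y ∈ L := hy ▸ mul_mem (mul_mem hr (h.dil_mem _)) (inv_mem hr)
  have hyy : y * y = 1 := by
    calc y * y = r * (dil (-1) * dil (-1)) * r⁻¹ := by rw [← hy]; group
      _ = 1 := by rw [dil_neg_one_mul_self]; group
  rcases hq : y none with _ | p
  · have hy1 : y ≠ 1 := fun h1 => by
      have h2 : dil (-1) = 1 := by
        calc dil (-1) = r⁻¹ * y * r := by rw [← hy]; group
          _ = 1 := by rw [h1]; group
      have h3 : (-1 : GaussFieldˣ) = 1 := dil_injective (h2.trans dil_one.symm)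
      have h4 : (-1 : GaussField) = 1 := congrArg Units.val h3
      exact one_ne_zero (eq_zero_of_two_mul (by linear_combination -h4))
    obtain ⟨α, hα⟩ := h.eq_trl_mul_dil_neg_one hyL hq hyy hy1
    obtain ⟨β, rfl⟩ : ∃ β, α = β + β := ⟨α * 2⁻¹, by field_simp [two_ne_zero_gaussField]; ring⟩
    refine Or.inl ⟨β, ?_⟩
    ext q
    rw [Set.mem_ofPred_eq, hα]
    rcases q with _ | ⟨γ, c⟩
    · simp [line]
    · simp only [Perm.mul_apply, dil_neg_one_some, trl_some, line, Set.mem_ofPred_eq, reduceCtorEq,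
        false_or, Option.some.injEq, Prod.mk.injEq]
      constructor
      · rintro ⟨h1, -⟩
        refine ⟨c, ?_, rfl⟩
        rw [← sub_eq_zero]
        exact eq_zero_of_two_mul (by linear_combination -h1)
      · rintro ⟨_, rfl, rfl⟩
        exact ⟨by ring, by simp [wedge_add_left, wedge_neg_right, wedge_self]⟩
  · have hw : IsSwap L ((trl p.1 p.2)⁻¹ * y * trl p.1 p.2) := by
      have ht := h.trl_mem p.1 p.2
      refine ⟨mul_mem (mul_mem (inv_mem ht) hyL) ht, ?_, ?_, ⟨r⁻¹ * trl p.1 p.2,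
        mul_mem (inv_mem hr) ht, by rw [← hy]; group⟩⟩
      · rw [Perm.mul_apply, trl_none, Perm.mul_apply, hq, ← trl_neg, trl_neg_apply]
      · calc _ = (trl p.1 p.2)⁻¹ * (y * y) * trl p.1 p.2 := by group
          _ = 1 := by rw [hyy]; group
    obtain ⟨n, d, hn, hnd⟩ := hw.exists_circ h
    refine Or.inr ⟨p.1, n, p.2 + d, hn, ?_⟩
    rw [← image_trl_circ_zero, ← hnd, Equiv.image_eq_preimage_symm]
    ext q
    rw [Set.mem_preimage, Set.mem_ofPred_eq, Set.mem_ofPred_eq, Perm.mul_apply, Perm.mul_apply,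
      Perm.inv_eq_iff_eq, Equiv.apply_symm_apply]

theorem exists_eq_image_line {S : Set HermPoint} (hS : IsBlock S) : ∃ r ∈ L, S = r '' line 0 := by
  rcases hS with ⟨α, rfl⟩ | ⟨α, n, d, hn, rfl⟩
  · exact ⟨trl α 0, h.trl_mem _ _, (image_trl_line_zero α).symm⟩
  · obtain ⟨w, hw⟩ := h.exists_isSwap
    obtain ⟨n', d', hn', hnd⟩ := hw.exists_circ h
    obtain ⟨r, hr, rfl⟩ := hw.exists_conj
    have h1 := setOf_conj_dil_neg_one r⁻¹
    rw [inv_inv, hnd] at h1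
    obtain ⟨β, hβ⟩ := exists_nrm_eq (mul_ne_zero hn (inv_ne_zero hn'))
    refine ⟨trl α (d - nrm β * d') * dil β * r⁻¹,
      mul_mem (mul_mem (h.trl_mem _ _) (h.dil_mem _)) (inv_mem hr), ?_⟩
    rw [Perm.coe_mul, Set.image_comp, ← h1, Perm.coe_mul, Set.image_comp, image_dil_circ_zero,
      image_trl_circ_zero, sub_add_cancel, hβ, inv_mul_cancel_right₀ hn']

theorem isBlock_image {g : Perm HermPoint} (hg : g ∈ L) {S : Set HermPoint} (hS : IsBlock S) :
    IsBlock (g '' S) := by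
  obtain ⟨r, hr, rfl⟩ := h.exists_eq_image_line hS
  rw [← Set.image_comp, ← Perm.coe_mul]
  exact h.isBlock_image_line (mul_mem hg hr)

end IsUnitaryLike

end U343

namespace U343

open Equiv

theorem none_mem_line (α : GaussField) : none ∈ line α := Or.inl rfl

theorem none_notMem_circ (α : GaussField) (n d : ZMod 43) : none ∉ circ α n d := by
  rintro ⟨_, h, -⟩
  cases h

theorem some_mem_circ {α β : GaussField} {n d e : ZMod 43} :
    some (β, e) ∈ circ α n d ↔ nrm (β - α) = n ∧ e = d + 22 * wedge α β := by
  constructor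
  · rintro ⟨_, h, h1⟩
    obtain rfl := Option.some.inj h
    exact h1
  · exact fun h => ⟨_, rfl, h⟩

/-- A circle through the origin of the Gaussian plane is determined by two further points. -/
theorem eq_of_nrm_sub_eq {μ α : GaussField} (hμ : μ ≠ 0) (h1 : nrm (2 * μ - α) = nrm α)
    (h2 : nrm (⟨1, 1⟩ * μ - α) = nrm α) : α = μ := by
  obtain ⟨ν, rfl⟩ : ∃ ν, α = ν * μ := ⟨α * μ⁻¹, (inv_mul_cancel_right₀ hμ α).symm⟩
  rw [← sub_mul, nrm_mul, nrm_mul] at h1 h2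
  replace h1 := mul_right_cancel₀ (nrm_ne_zero hμ) h1
  replace h2 := mul_right_cancel₀ (nrm_ne_zero hμ) h2
  have h2re : (2 : GaussField).re = 2 := rfl
  have h2im : (2 : GaussField).im = 0 := rfl
  simp only [nrm, QuadraticAlgebra.re_sub, QuadraticAlgebra.im_sub, h2re, h2im] at h1 h2
  have h4 : (4 : ZMod 43) ≠ 0 := by decide
  have hre : ν.re = 1 := mul_left_cancel₀ h4 (by linear_combination -h1)
  have him : ν.im = 0 := by
    rw [hre] at h2
    exact mul_left_cancel₀ two_ne_zero_zmod (by linear_combination -h2)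
  have hν : ν = 1 := QuadraticAlgebra.ext hre him
  rw [hν, one_mul]

/-- A permutation of the unital commuting with all dilations is determined by its action on the
`z`-axis and on one line. -/
theorem eq_dil_of_fixes_axis {a : Perm HermPoint} (h0 : a none = none) (hd : ∀ β, Commute a (dil β))
    (hB : ∀ S, IsBlock S → IsBlock (a '' S)) (hz : ∀ c, a (some (0, c)) = some (0, c)) :
    ∃ β, a = dil β := by
  obtain ⟨l, hl⟩ : ∃ l, ∀ c, ∃ e, a (some (1, c)) = some (l, e) := by
    rcases hB (line 1) (Or.inl ⟨1, rfl⟩) with ⟨l, hl⟩ | ⟨α, n, d, -, hc⟩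
    · refine ⟨l, fun c => ?_⟩
      have h1 : a (some (1, c)) ∈ line l := hl ▸ Set.mem_image_of_mem a (Or.inr ⟨c, rfl⟩)
      rcases h1 with h1 | ⟨e, he⟩
      · rw [← h0] at h1
        cases a.injective h1
      · exact ⟨e, he⟩
    · refine absurd ?_ (none_notMem_circ α n d)
      rw [← hc]
      exact ⟨none, none_mem_line 1, h0⟩
  have hl0 : l ≠ 0 := by
    rintro rfl
    obtain ⟨e, he⟩ := hl 0
    rw [← hz] at he
    exact one_ne_zero (congrArg Prod.fst (Option.some.inj (a.injective he)))
  have hdil : ∀ (β : GaussFieldˣ) c, a (some (β, nrm β * c)) = dil β (a (some (1, c))) := fun β c => by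
    rw [← Perm.mul_apply, ← (hd β).eq, Perm.mul_apply, dil_some, mul_one]
  have hfst : ∀ α c, ∃ e, a (some (α, c)) = some (l * α, e) := fun α c => by
    rcases eq_or_ne α 0 with rfl | hα
    · exact ⟨c, by rw [hz, mul_zero]⟩
    · obtain ⟨e, he⟩ := hl ((nrm α)⁻¹ * c)
      have h1 := hdil (Units.mk0 α hα) ((nrm α)⁻¹ * c)
      rw [Units.val_mk0, mul_inv_cancel_left₀ (nrm_ne_zero hα), he, dil_some, Units.val_mk0, mul_comm α]
        at h1
      exact ⟨_, h1⟩
  have hcirc : ∀ y d, a (some (1, d - 22 * y)) = some (l, d - 22 * (y * nrm l)) := fun y d => by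
    let α : GaussField := ⟨22, y⟩
    have hα : α ≠ 0 := fun h => by
      have h1 : (22 : ZMod 43) = 0 := congrArg QuadraticAlgebra.re h
      exact absurd h1 (by decide)
    rcases hB (circ α (nrm α) d) (Or.inr ⟨α, nrm α, d, nrm_ne_zero hα, rfl⟩) with
      ⟨β, hβ⟩ | ⟨β, n, e, -, hc⟩
    · obtain ⟨q, hq, hq1⟩ : none ∈ a '' circ α (nrm α) d := hβ ▸ none_mem_line β
      rw [← h0] at hq1
      rw [a.injective hq1] at hq
      exact absurd hq (none_notMem_circ _ _ _)
    · have hmem : ∀ β', nrm (β' - α) = nrm α →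
          a (some (β', d + 22 * wedge α β')) ∈ circ β n e := fun β' hβ' => by
        rw [← hc]
        exact Set.mem_image_of_mem a (some_mem_circ.2 ⟨hβ', rfl⟩)
      have h1 := hmem 0 (by rw [zero_sub, nrm_neg])
      rw [wedge_zero_right, mul_zero, add_zero, hz, some_mem_circ, zero_sub, nrm_neg, wedge_zero_right,
        mul_zero, add_zero] at h1
      obtain ⟨rfl, rfl⟩ := h1
      have h2 : ∀ β', nrm (β' - α) = nrm α → nrm (l * β' - β) = nrm β := fun β' hβ' => by
        have h3 := hmem β' hβ'
        obtain ⟨f, hf⟩ := hfst β' (d + 22 * wedge α β')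
        rw [hf] at h3
        exact (some_mem_circ.1 h3).1
      have hβ : β = l * α := by
        refine eq_of_nrm_sub_eq (mul_ne_zero hl0 hα) ?_ ?_
        · rw [mul_left_comm]
          exact h2 _ (by rw [two_mul, add_sub_cancel_right])
        · rw [mul_left_comm]
          refine h2 _ ?_
          simp only [nrm, α, QuadraticAlgebra.re_sub, QuadraticAlgebra.im_sub, QuadraticAlgebra.re_mul,
            QuadraticAlgebra.im_mul]
          ring
      have hw1 : wedge α 1 = -y := by
        simp [wedge, α, QuadraticAlgebra.re_one, QuadraticAlgebra.im_one]
      have hn1 : nrm (1 - α) = nrm α := by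
        simp only [nrm, α, QuadraticAlgebra.re_sub, QuadraticAlgebra.im_sub, QuadraticAlgebra.re_one,
          QuadraticAlgebra.im_one, zero_sub, neg_sq]
        congr 1
      have h3 := hmem 1 hn1
      rw [hw1, mul_neg, ← sub_eq_add_neg] at h3
      obtain ⟨f, hf⟩ := hfst 1 (d - 22 * y)
      rw [hf, mul_one] at h3 ⊢
      have h4 := (some_mem_circ.1 h3).2
      have h5 := wedge_mul l α 1
      rw [mul_one, hw1] at h5
      rw [h4, hβ, h5]
      congr 2
      ring
  have hl1 : ∀ d, a (some (1, d)) = some (l, d) := fun d => by simpa using hcirc 0 d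
  have hn : nrm l = 1 := by
    have h1 := hcirc 2 0
    rw [hl1] at h1
    have h2 := congrArg Prod.snd (Option.some.inj h1)
    have h3 : (44 : ZMod 43) ≠ 0 := by decide
    exact mul_left_cancel₀ h3 (by simp only at h2; linear_combination h2)
  refine ⟨Units.mk0 l hl0, ?_⟩
  ext1 q
  rcases q with _ | ⟨α, c⟩
  · rw [h0, dil_none]
  rw [dil_some, Units.val_mk0, hn, one_mul]
  rcases eq_or_ne α 0 with rfl | hα
  · rw [hz, mul_zero]
  · have h1 := hdil (Units.mk0 α hα) ((nrm α)⁻¹ * c)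
    rw [Units.val_mk0, mul_inv_cancel_left₀ (nrm_ne_zero hα), hl1, dil_some, Units.val_mk0,
      mul_inv_cancel_left₀ (nrm_ne_zero hα), mul_comm α] at h1
    exact h1

theorem IsSwap.exists_apply_zero_eq {L : Subgroup (Perm HermPoint)} (hL : IsUnitaryLike L)
    {w : Perm HermPoint} (hw : IsSwap L w) {c : ZMod 43} (hc : c ≠ 0) :
    ∃ d, d ≠ 0 ∧ w (some (0, c)) = some (0, d) := by
  obtain ⟨σ, hσ⟩ := hw.exists_sigma hL
  obtain ⟨d, hd⟩ := hw.exists_apply_eq hσ hc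
  refine ⟨d, ?_, hd⟩
  rintro rfl
  rw [← hw.apply_none] at hd
  cases w.injective hd

namespace IsUnitaryLike

variable {L L' : Subgroup (Perm HermPoint)}

theorem le (h : IsUnitaryLike L) (h' : IsUnitaryLike L') : L ≤ L' := by
  obtain ⟨w, hw⟩ := h.exists_isSwap
  obtain ⟨w', hw'⟩ := h'.exists_isSwap
  obtain ⟨d, hd, hwd⟩ := hw.exists_apply_zero_eq h one_ne_zero
  obtain ⟨e, he, hwe⟩ := hw'.exists_apply_zero_eq h' hd
  obtain ⟨γ, hγ⟩ := exists_nrm_eq (inv_ne_zero he)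
  have hdil : ∀ β, Commute (dil γ * w' * w) (dil β) := fun β => by
    have h1 : (((β ^ 43)⁻¹) ^ 43)⁻¹ = β := by
      have h2 : β ^ 1848 = 1 := by rw [← card_units_gaussField, pow_card_eq_one']
      rw [inv_pow, inv_inv, ← pow_mul, pow_succ _ 1848, h2, one_mul]
    rw [commute_iff_eq, mul_assoc, hw.mul_dil h, mul_assoc, ← mul_assoc w', hw'.mul_dil h', h1,
      ← mul_assoc, ← mul_assoc, ← mul_assoc, ← mul_assoc, ← dil_mul, ← dil_mul, mul_comm]
  have h1 : (dil γ * w' * w) (some (0, 1)) = some (0, 1) := by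
    rw [Perm.mul_apply, Perm.mul_apply, hwd, hwe, dil_some, mul_zero, hγ, inv_mul_cancel₀ he]
  obtain ⟨β, hβ⟩ : ∃ β, dil γ * w' * w = dil β := by
    refine eq_dil_of_fixes_axis ?_ hdil (fun S hS => ?_) (fun c => ?_)
    · rw [Perm.mul_apply, Perm.mul_apply, hw.apply_none, hw'.apply_zero, dil_none]
    · rw [Perm.coe_mul, Set.image_comp]
      exact h'.isBlock_image (mul_mem (h'.dil_mem γ) hw'.mem) (h.isBlock_image hw.mem hS)
    · rcases eq_or_ne c 0 with rfl | hc
      · rw [Perm.mul_apply, Perm.mul_apply, hw.apply_zero, hw'.apply_none, dil_apply_zero]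
      · obtain ⟨β, hβ⟩ := exists_nrm_eq hc
        have h2 : some ((0 : GaussField), c) = dil β (some (0, 1)) := by
          rw [dil_some, mul_zero, hβ, mul_one]
        rw [h2, ← Perm.mul_apply, (hdil β).eq, Perm.mul_apply, h1]
  have hwL : w ∈ L' := by
    rw [eq_inv_mul_of_mul_eq hβ]
    exact mul_mem (inv_mem (mul_mem (h'.dil_mem _) hw'.mem)) (h'.dil_mem _)
  have hnone : ∀ g ∈ L, g none = none → g ∈ L' := fun g hg hg1 => by
    obtain ⟨α, c, β, rfl⟩ := h.exists_eq g hg hg1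
    exact mul_mem (h'.trl_mem _ _) (h'.dil_mem _)
  intro g hg
  rcases hq : g none with _ | ⟨α, c⟩
  · exact hnone g hg hq
  · have h2 := hnone (w * trl (-α) (-c) * g) (mul_mem (mul_mem hw.mem (h.trl_mem _ _)) hg)
      (by rw [Perm.mul_apply, hq, Perm.mul_apply, trl_neg_apply, hw.apply_zero])
    exact (L'.mul_mem_cancel_left (mul_mem hwL (h'.trl_mem _ _))).1 h2

end IsUnitaryLike

/-- Two groups with the order and the prime graph degrees of `U₃(43)` are isomorphic. -/
theorem nonempty_mulEquiv {G H : Type*} [Group G] [Finite G] [Group H] [Finite H] (hG : ODPattern G)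
    (hH : ODPattern H) : Nonempty (G ≃* H) := by
  obtain ⟨φ, hφ, hφL⟩ := exists_isUnitaryLike hG
  obtain ⟨ψ, hψ, hψL⟩ := exists_isUnitaryLike hH
  have h1 : φ.range = ψ.range := le_antisymm (hφL.le hψL) (hψL.le hφL)
  exact ⟨((MonoidHom.ofInjective hφ).trans (MulEquiv.subgroupCongr h1)).trans
    (MonoidHom.ofInjective hψ).symm⟩

end U343

/-- Any two finite groups of order `2^5 * 3 * 7 * 11^2 * 13 * 43^3 * 139` whose prime graphs have
vertex degrees deg 2 = 4, deg 3 = 3, deg 7 = 3, deg 11 = 4, deg 13 = 1, deg 43 = 2, deg 139 = 1 are isomorphic (the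
order and degree pattern of the simple unitary group `U_3(43)`). -/
theorem od_characterization_U_3_43
    (G H : Type*) [Group G] [Finite G] [Group H] [Finite H]
    (hG : Nat.card G = 2^5 * 3 * 7 * 11^2 * 13 * 43^3 * 139)
    (hH : Nat.card H = 2^5 * 3 * 7 * 11^2 * 13 * 43^3 * 139)
    (hG2 : gkDegree G 2 = 4)
    (hG3 : gkDegree G 3 = 3)
    (hG7 : gkDegree G 7 = 3)
    (hG11 : gkDegree G 11 = 4)
    (hG13 : gkDegree G 13 = 1)
    (hG43 : gkDegree G 43 = 2)
    (hG139 : gkDegree G 139 = 1)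
    (hH2 : gkDegree H 2 = 4)
    (hH3 : gkDegree H 3 = 3)
    (hH7 : gkDegree H 7 = 3)
    (hH11 : gkDegree H 11 = 4)
    (hH13 : gkDegree H 13 = 1)
    (hH43 : gkDegree H 43 = 2)
    (hH139 : gkDegree H 139 = 1) :
    Nonempty (G ≃* H) :=
  U343.nonempty_mulEquiv ⟨hG, hG2, hG11, hG13, hG43, hG139⟩ ⟨hH, hH2, hH11, hH13, hH43, hH139⟩
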